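/- There exist real numbers α < β such that the set Π_{⫿,fin} of uniform Turán densities of finite families of 3-graphs is dense in the interval [α, β]; equivalently, [α, β] ⊆ closure(Π_{⫿,fin}). -/

import Mathlib

open Filter

/-- A finite `r`-graph: a collection of `r`-element subsets (edges) of a finite
vertex set, which we take to be `Fin n`. -/
structure HGraph (r : ℕ) where
  n : ℕ
  edges : Finset (Finset (Fin n))
  card_eq : ∀ e ∈ edges, e.card = r

/-- `H` embeds into `G` as a subgraph (via an injective map on vertices sending
edges to edges). -/
def HGraph.Embeds {r : ℕ} (H G : HGraph r) : Prop :=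
  ∃ f : Fin H.n → Fin G.n, Function.Injective f ∧ ∀ e ∈ H.edges, e.image f ∈ G.edges

/-- `G` is `F`-free: no member of the family `F` embeds into `G`. -/
def IsFree {r : ℕ} (F : Set (HGraph r)) (G : HGraph r) : Prop :=
  ∀ H ∈ F, ¬ H.Embeds G

/-- `ex(n, F)`: the maximum number of edges of an `F`-free `r`-graph on `n` vertices. -/
noncomputable def exNum (r : ℕ) (F : Set (HGraph r)) (n : ℕ) : ℕ :=
  sSup { m : ℕ | ∃ G : HGraph r, G.n = n ∧ IsFree F G ∧ G.edges.card = m }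

/-- The Turán density of the family `F` is `x`. -/
def HasTuranDensity (r : ℕ) (F : Set (HGraph r)) (x : ℝ) : Prop :=
  Tendsto (fun n => (exNum r F n : ℝ) / (n.choose r : ℝ)) atTop (nhds x)

/-- `Π^{(r)}_∞`: the set of Turán densities of (possibly infinite) families of `r`-graphs. -/
def PiInf (r : ℕ) : Set ℝ := { x | ∃ F : Set (HGraph r), HasTuranDensity r F x }

/-- `H` is `(d, η, ⫿)`-uniformly dense: every vertex subset `U` spans at least
`d·binom(|U|,3) − η·n³` edges. -/
def UniformlyDense (H : HGraph 3) (d η : ℝ) : Prop :=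
  ∀ U : Finset (Fin H.n),
    d * (U.card.choose 3 : ℝ) - η * (H.n : ℝ) ^ 3 ≤
      ((H.edges.filter (fun e => e ⊆ U)).card : ℝ)

/-- The uniform Turán density `π_⫿(F)` of a family `F` of `3`-graphs. -/
noncomputable def uniformTuranDensity (F : Set (HGraph 3)) : ℝ :=
  sSup { d : ℝ | d ∈ Set.Icc (0 : ℝ) 1 ∧
    ∀ η : ℝ, 0 < η → ∀ n₀ : ℕ,
      ∃ H : HGraph 3, IsFree F H ∧ UniformlyDense H d η ∧ n₀ ≤ H.n }

/-- `Π_{⫿,fin}`: the set of uniform Turán densities of finite families of `3`-graphs. -/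
def PiUnifFin : Set ℝ :=
  { x | ∃ F : Set (HGraph 3), F.Finite ∧ uniformTuranDensity F = x }

/-- A ternary relation invariant under all permutations of its arguments. -/
def SymRel {C : Type*} (A : C → C → C → Prop) : Prop :=
  (∀ a b c, A a b c → A b a c) ∧ ∀ a b c, A a b c → A a c b

open Classical in
/-- The indicator function of a ternary relation. -/
noncomputable def ind {C : Type*} (A : C → C → C → Prop) (a b c : C) : ℝ :=
  if A a b c then 1 else 0

lemma ind_nonneg {C : Type*} (A : C → C → C → Prop) (a b c : C) : 0 ≤ ind A a b c := by
  unfold ind; split_ifs <;> norm_num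

lemma ind_le_one {C : Type*} (A : C → C → C → Prop) (a b c : C) : ind A a b c ≤ 1 := by
  unfold ind; split_ifs <;> norm_num

/-- The Lagrangian polynomial of a ternary relation. -/
noncomputable def lagPoly {C : Type*} [Fintype C] (A : C → C → C → Prop) (w : C → ℝ) : ℝ :=
  ∑ a, ∑ b, ∑ c, ind A a b c * (w a * w b * w c)

/-- Nonnegative weights of total mass at most one. -/
def subSimplex (C : Type*) [Fintype C] : Set (C → ℝ) :=
  {w | (∀ a, 0 ≤ w a) ∧ ∑ a, w a ≤ 1}

/-- The Lagrangian of a ternary relation. -/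
noncomputable def lagr {C : Type*} [Fintype C] (A : C → C → C → Prop) : ℝ :=
  sSup (lagPoly A '' subSimplex C)

section
variable {C : Type*} [Fintype C] {A : C → C → C → Prop} {w v : C → ℝ}

lemma lagPoly_nonneg (hw : ∀ a, 0 ≤ w a) : 0 ≤ lagPoly A w := by
  refine Finset.sum_nonneg fun a _ => Finset.sum_nonneg fun b _ => Finset.sum_nonneg fun c _ => ?_
  have := ind_nonneg A a b c
  have := hw a; have := hw b; have := hw c
  positivity

lemma sum_cube_eq (w : C → ℝ) : (∑ a, w a) ^ 3 = ∑ a, ∑ b, ∑ c, w a * w b * w c := by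
  rw [pow_three', Finset.sum_mul_sum, Finset.sum_mul]
  refine Finset.sum_congr rfl fun a _ => ?_
  rw [Finset.sum_mul]
  refine Finset.sum_congr rfl fun b _ => ?_
  rw [Finset.mul_sum]

lemma lagPoly_mono_weight (hw : ∀ a, 0 ≤ w a) (h : ∀ a, w a ≤ v a) :
    lagPoly A w ≤ lagPoly A v := by
  refine Finset.sum_le_sum fun a _ => Finset.sum_le_sum fun b _ => Finset.sum_le_sum fun c _ => ?_
  have ha := hw a; have hb := hw b; have hc := hw c
  refine mul_le_mul_of_nonneg_left ?_ (ind_nonneg A a b c)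
  have := (hw a).trans (h a)
  have := (hw b).trans (h b)
  gcongr <;> apply h

lemma lagPoly_le_cube (hw : ∀ a, 0 ≤ w a) : lagPoly A w ≤ (∑ a, w a) ^ 3 := by
  rw [sum_cube_eq]
  refine Finset.sum_le_sum fun a _ => Finset.sum_le_sum fun b _ => Finset.sum_le_sum fun c _ => ?_
  have ha := hw a; have hb := hw b; have hc := hw c
  have := mul_le_mul_of_nonneg_right (ind_le_one A a b c) (show 0 ≤ w a * w b * w c by positivity)
  linarith

lemma lagPoly_smul (t : ℝ) (w : C → ℝ) : lagPoly A (fun a => t * w a) = t ^ 3 * lagPoly A w := by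
  simp only [lagPoly, Finset.mul_sum]
  refine Finset.sum_congr rfl fun a _ => Finset.sum_congr rfl fun b _ =>
    Finset.sum_congr rfl fun c _ => by ring

lemma continuous_lagPoly : Continuous (lagPoly A) := by
  unfold lagPoly
  fun_prop

lemma isCompact_subSimplex : IsCompact (subSimplex C) := by
  have hsub : subSimplex C ⊆ Set.pi Set.univ fun _ : C => Set.Icc (0 : ℝ) 1 := by
    intro w hw a _
    exact ⟨hw.1 a, (Finset.single_le_sum (fun b _ => hw.1 b) (Finset.mem_univ a)).trans hw.2⟩
  refine IsCompact.of_isClosed_subset (isCompact_univ_pi fun _ => isCompact_Icc) ?_ hsub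
  have h1 : IsClosed {w : C → ℝ | ∀ a, 0 ≤ w a} := by
    simp only [Set.ofPred_forall]
    exact isClosed_iInter fun a => isClosed_le continuous_const (continuous_apply a)
  exact h1.inter (isClosed_le (continuous_finsetSum _ fun a _ => continuous_apply a) continuous_const)

lemma zero_mem_subSimplex : (0 : C → ℝ) ∈ subSimplex C := by
  simp [subSimplex]

lemma exists_lagPoly_eq_lagr (A : C → C → C → Prop) :
    ∃ w ∈ subSimplex C, lagPoly A w = lagr A := by
  obtain ⟨w, hw, h⟩ := isCompact_subSimplex.exists_sSup_image_eq ⟨_, zero_mem_subSimplex⟩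
    (continuous_lagPoly (A := A)).continuousOn
  exact ⟨w, hw, h.symm⟩

lemma lagPoly_le_lagr (hw : w ∈ subSimplex C) : lagPoly A w ≤ lagr A :=
  le_csSup (isCompact_subSimplex.image continuous_lagPoly).bddAbove ⟨w, hw, rfl⟩

lemma lagr_nonneg (A : C → C → C → Prop) : 0 ≤ lagr A := by
  refine le_trans ?_ (lagPoly_le_lagr zero_mem_subSimplex)
  exact lagPoly_nonneg fun _ => le_rfl

lemma lagr_le_of_forall {x : ℝ} (h : ∀ w ∈ subSimplex C, lagPoly A w ≤ x) : lagr A ≤ x := by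
  obtain ⟨w, hw, h'⟩ := exists_lagPoly_eq_lagr A
  exact h' ▸ h w hw

lemma lagr_le_one (A : C → C → C → Prop) : lagr A ≤ 1 := by
  refine lagr_le_of_forall fun w hw => (lagPoly_le_cube hw.1).trans ?_
  exact pow_le_one₀ (Finset.sum_nonneg fun a _ => hw.1 a) hw.2

lemma lagPoly_le_lagr_mul (hw : ∀ a, 0 ≤ w a) : lagPoly A w ≤ lagr A * (∑ a, w a) ^ 3 := by
  rcases (Finset.sum_nonneg fun a _ => hw a : 0 ≤ ∑ a, w a).eq_or_lt with h | h
  · have := lagPoly_le_cube (A := A) hw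
    rw [← h] at this ⊢
    simpa using this
  · set s := ∑ a, w a with hs
    have hmem : (fun a => s⁻¹ * w a) ∈ subSimplex C := by
      refine ⟨fun a => mul_nonneg (inv_nonneg.2 h.le) (hw a), ?_⟩
      rw [← Finset.mul_sum, ← hs, inv_mul_cancel₀ h.ne']
    have h1 := lagPoly_le_lagr (A := A) hmem
    rw [lagPoly_smul] at h1
    have : lagPoly A w = s ^ 3 * (s⁻¹ ^ 3 * lagPoly A w) := by field_simp
    rw [this, mul_comm (lagr A)]
    gcongr

end

/-- The set of Lagrangians of symmetric palettes. -/
def lagSet : Set ℝ :=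
  {x | ∃ (C : Type) (_ : Fintype C) (_ : Nonempty C) (A : C → C → C → Prop),
    SymRel A ∧ lagr A = x}

lemma exists_weight_sum_one {C : Type*} [Fintype C] [Nonempty C] (A : C → C → C → Prop) :
    ∃ w : C → ℝ, (∀ a, 0 ≤ w a) ∧ ∑ a, w a = 1 ∧ lagPoly A w = lagr A := by
  classical
  obtain ⟨w, hw, h⟩ := exists_lagPoly_eq_lagr A
  let c0 := Classical.arbitrary C
  let v : C → ℝ := fun a => w a + if a = c0 then 1 - ∑ b, w b else 0
  have hwv : ∀ a, w a ≤ v a := fun a => by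
    have := hw.2
    simp only [v]; split_ifs <;> linarith
  have hv : ∀ a, 0 ≤ v a := fun a => (hw.1 a).trans (hwv a)
  have hs : ∑ a, v a = 1 := by simp [v, Finset.sum_add_distrib]
  exact ⟨v, hv, hs, le_antisymm (lagPoly_le_lagr ⟨hv, hs.le⟩)
    (h ▸ lagPoly_mono_weight hw.1 hwv)⟩

lemma card_ordered_triples {V : Type*} [DecidableEq V] (U e : Finset V) (he : e.card = 3)
    (hU : e ⊆ U) :
    ((U ×ˢ U ×ˢ U).filter fun p => ({p.1, p.2.1, p.2.2} : Finset V) = e).card = 6 := by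
  obtain ⟨a, b, c, hab, hac, hbc, rfl⟩ := Finset.card_eq_three.1 he
  have ha : a ∈ U := hU (by simp)
  have hb : b ∈ U := hU (by simp)
  have hc : c ∈ U := hU (by simp)
  have : ((U ×ˢ U ×ˢ U).filter fun p => ({p.1, p.2.1, p.2.2} : Finset V) = {a, b, c}) =
      {(a, b, c), (a, c, b), (b, a, c), (b, c, a), (c, a, b), (c, b, a)} := by
    ext ⟨x, y, z⟩
    simp only [Finset.mem_filter, Finset.mem_product, Finset.mem_insert, Finset.mem_singleton,
      Prod.mk.injEq]
    constructor
    · rintro ⟨-, h⟩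
      have h1 : x ∈ ({a, b, c} : Finset V) := h ▸ by simp
      have h2 : y ∈ ({a, b, c} : Finset V) := h ▸ by simp
      have h3 : z ∈ ({a, b, c} : Finset V) := h ▸ by simp
      have h4 : a ∈ ({x, y, z} : Finset V) := h.symm ▸ by simp
      have h5 : b ∈ ({x, y, z} : Finset V) := h.symm ▸ by simp
      have h6 : c ∈ ({x, y, z} : Finset V) := h.symm ▸ by simp
      simp only [Finset.mem_insert, Finset.mem_singleton] at h1 h2 h3 h4 h5 h6
      grind
    · rintro (⟨rfl, rfl, rfl⟩ | ⟨rfl, rfl, rfl⟩ | ⟨rfl, rfl, rfl⟩ | ⟨rfl, rfl, rfl⟩ |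
        ⟨rfl, rfl, rfl⟩ | ⟨rfl, rfl, rfl⟩) <;> refine ⟨⟨‹_›, ‹_›, ‹_›⟩, ?_⟩ <;> ext t <;>
        simp only [Finset.mem_insert, Finset.mem_singleton] <;> tauto
  rw [this]
  rw [Finset.card_insert_of_notMem, Finset.card_insert_of_notMem, Finset.card_insert_of_notMem,
    Finset.card_insert_of_notMem, Finset.card_insert_of_notMem, Finset.card_singleton] <;>
    simp [hab, hac, hbc, hab.symm, hac.symm, hbc.symm]

/-- The number of ordered triples spanning an edge inside `U` is six times the number of edges. -/
lemma sum_triples_eq {V : Type*} [DecidableEq V] (E : Finset (Finset V))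
    (hE : ∀ e ∈ E, e.card = 3) (U : Finset V) :
    (∑ x ∈ U, ∑ y ∈ U, ∑ z ∈ U, if ({x, y, z} : Finset V) ∈ E then (1 : ℝ) else 0) =
      6 * ((E.filter (fun e => e ⊆ U)).card : ℝ) := by
  have h1 : (∑ x ∈ U, ∑ y ∈ U, ∑ z ∈ U, if ({x, y, z} : Finset V) ∈ E then (1 : ℝ) else 0) =
      ∑ p ∈ U ×ˢ U ×ˢ U, if ({p.1, p.2.1, p.2.2} : Finset V) ∈ E then (1 : ℝ) else 0 := by
    simp_rw [Finset.sum_product]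
  rw [h1, ← Finset.sum_filter, Finset.sum_const, nsmul_eq_mul, mul_one]
  have h2 := Finset.card_eq_sum_card_fiberwise
    (s := (U ×ˢ U ×ˢ U).filter fun p => ({p.1, p.2.1, p.2.2} : Finset V) ∈ E)
    (t := E.filter (fun e => e ⊆ U)) (f := fun p => ({p.1, p.2.1, p.2.2} : Finset V)) (by
      rintro ⟨x, y, z⟩ hp
      simp only [Finset.coe_filter, Finset.mem_product, Set.mem_ofPred_eq] at hp ⊢
      refine ⟨hp.2, ?_⟩
      intro t ht
      simp only [Finset.mem_insert, Finset.mem_singleton] at ht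
      rcases ht with rfl | rfl | rfl
      exacts [hp.1.1, hp.1.2.1, hp.1.2.2])
  rw [h2, Finset.sum_congr rfl (g := fun _ => 6), Finset.sum_const]
  · rw [smul_eq_mul]
    push_cast
    ring
  · intro e he
    rw [Finset.mem_filter] at he
    rw [← card_ordered_triples U e (hE e he.1) he.2, Finset.filter_filter]
    congr 1
    ext p
    simp only [Finset.mem_filter]
    constructor
    · rintro ⟨h, -, h₂⟩
      exact ⟨h, h₂⟩
    · rintro ⟨h, h₂⟩
      exact ⟨h, h₂ ▸ he.1, h₂⟩

/-- All rectangle sums of `f` inside `U` are bounded by `E`. -/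
def CutDisc {V : Type*} (U : Finset V) (f : V → V → ℝ) (E : ℝ) : Prop :=
  ∀ X ⊆ U, ∀ Y ⊆ U, |∑ x ∈ X, ∑ y ∈ Y, f x y| ≤ E

section
variable {V : Type*}

open Classical in
/-- The indicator function of a proposition. -/
noncomputable def pind (p : Prop) : ℝ := if p then 1 else 0

lemma pind_nonneg (p : Prop) : 0 ≤ pind p := by
  unfold pind; split_ifs <;> norm_num

lemma pind_le_one (p : Prop) : pind p ≤ 1 := by
  unfold pind; split_ifs <;> norm_num

lemma sum_pind_mul (U : Finset V) (P : V → Prop) [DecidablePred P] (f : V → ℝ) :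
    ∑ x ∈ U, f x * pind (P x) = ∑ x ∈ U.filter P, f x := by
  rw [Finset.sum_filter]
  refine Finset.sum_congr rfl fun x _ => ?_
  unfold pind
  split_ifs <;> simp

lemma triangle_count {U : Finset V} {R1 R2 R3 : V → V → Prop} {p1 p2 p3 E : ℝ}
    (h1 : CutDisc U (fun x y => pind (R1 x y) - p1) E)
    (h2 : CutDisc U (fun x y => pind (R2 x y) - p2) E)
    (h3 : CutDisc U (fun x y => pind (R3 x y) - p3) E)
    (hp1 : p1 ∈ Set.Icc (0 : ℝ) 1) (hp2 : p2 ∈ Set.Icc (0 : ℝ) 1) :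
    |∑ x ∈ U, ∑ y ∈ U, ∑ z ∈ U, pind (R1 x y) * pind (R2 y z) * pind (R3 x z) -
      p1 * p2 * p3 * (U.card : ℝ) ^ 3| ≤ 3 * E * U.card := by
  classical
  have hE : 0 ≤ E := (abs_nonneg _).trans (h1 ∅ (by simp) ∅ (by simp))
  have key : ∑ x ∈ U, ∑ y ∈ U, ∑ z ∈ U, pind (R1 x y) * pind (R2 y z) * pind (R3 x z) -
      p1 * p2 * p3 * (U.card : ℝ) ^ 3 =
      ∑ z ∈ U, ∑ x ∈ U.filter (fun x => R3 x z), ∑ y ∈ U.filter (fun y => R2 y z),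
          (pind (R1 x y) - p1) +
      p1 * ∑ x ∈ U, ∑ y ∈ U, ∑ z ∈ U.filter (fun z => R3 x z), (pind (R2 y z) - p2) +
      p1 * p2 * ∑ y ∈ U, ∑ x ∈ U, ∑ z ∈ U, (pind (R3 x z) - p3) := by
    have e1 : ∑ z ∈ U, ∑ x ∈ U.filter (fun x => R3 x z), ∑ y ∈ U.filter (fun y => R2 y z),
          (pind (R1 x y) - p1) = ∑ x ∈ U, ∑ y ∈ U, ∑ z ∈ U,
          (pind (R1 x y) - p1) * pind (R2 y z) * pind (R3 x z) := by
      simp_rw [← sum_pind_mul, Finset.sum_mul]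
      rw [Finset.sum_comm]
      refine Finset.sum_congr rfl fun x _ => ?_
      rw [Finset.sum_comm]
    have e2 : ∑ x ∈ U, ∑ y ∈ U, ∑ z ∈ U.filter (fun z => R3 x z), (pind (R2 y z) - p2) =
        ∑ x ∈ U, ∑ y ∈ U, ∑ z ∈ U, (pind (R2 y z) - p2) * pind (R3 x z) := by
      simp_rw [← sum_pind_mul]
    have e3 : ∑ y ∈ U, ∑ x ∈ U, ∑ z ∈ U, (pind (R3 x z) - p3) =
        ∑ x ∈ U, ∑ y ∈ U, ∑ z ∈ U, (pind (R3 x z) - p3) := Finset.sum_comm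
    have e4 : (U.card : ℝ) ^ 3 = ∑ x ∈ U, ∑ y ∈ U, ∑ z ∈ U, (1 : ℝ) := by
      simp; ring
    rw [e1, e2, e3, e4]
    simp_rw [Finset.mul_sum, ← Finset.sum_add_distrib, ← Finset.sum_sub_distrib]
    refine Finset.sum_congr rfl fun x _ => Finset.sum_congr rfl fun y _ =>
      Finset.sum_congr rfl fun z _ => by ring
  have b1 : |∑ z ∈ U, ∑ x ∈ U.filter (fun x => R3 x z), ∑ y ∈ U.filter (fun y => R2 y z),
          (pind (R1 x y) - p1)| ≤ U.card * E := by
    refine (Finset.abs_sum_le_sum_abs _ _).trans ?_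
    rw [← nsmul_eq_mul, ← Finset.sum_const]
    exact Finset.sum_le_sum fun z _ => h1 _ (Finset.filter_subset _ _) _ (Finset.filter_subset _ _)
  have b2 : |∑ x ∈ U, ∑ y ∈ U, ∑ z ∈ U.filter (fun z => R3 x z), (pind (R2 y z) - p2)| ≤
      U.card * E := by
    refine (Finset.abs_sum_le_sum_abs _ _).trans ?_
    rw [← nsmul_eq_mul, ← Finset.sum_const]
    exact Finset.sum_le_sum fun x _ => h2 _ subset_rfl _ (Finset.filter_subset _ _)
  have b3 : |∑ y ∈ U, ∑ x ∈ U, ∑ z ∈ U, (pind (R3 x z) - p3)| ≤ U.card * E := by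
    refine (Finset.abs_sum_le_sum_abs _ _).trans ?_
    rw [← nsmul_eq_mul, ← Finset.sum_const]
    exact Finset.sum_le_sum fun x _ => h3 _ subset_rfl _ subset_rfl
  rw [key]
  refine (abs_add_le _ _).trans ?_
  refine (add_le_add_left (abs_add_le _ _) _).trans ?_
  rw [abs_mul, abs_mul, abs_of_nonneg hp1.1, abs_of_nonneg (mul_nonneg hp1.1 hp2.1)]
  have hUE : (0 : ℝ) ≤ U.card * E := by positivity
  have c2 := mul_le_mul hp1.2 b2 (abs_nonneg _) zero_le_one
  have c3 := mul_le_mul (mul_le_one₀ hp1.2 hp2.1 hp2.2) b3 (abs_nonneg _) zero_le_one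
  linarith

/-- The number of triples in `U` whose pair colours satisfy `A`, when every colour class is
uniformly distributed. -/
lemma count_palette {C : Type*} [Fintype C] (A : C → C → C → Prop) {U : Finset V}
    (c : V → V → C) {p : C → ℝ} {E : ℝ} (hp : ∀ a, p a ∈ Set.Icc (0 : ℝ) 1)
    (h : ∀ a, CutDisc U (fun x y => pind (c x y = a) - p a) E) :
    |∑ x ∈ U, ∑ y ∈ U, ∑ z ∈ U, ind A (c x y) (c y z) (c x z) -
      lagPoly A p * (U.card : ℝ) ^ 3| ≤ 3 * (Fintype.card C : ℝ) ^ 3 * E * U.card := by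
  classical
  have hind : ∀ x y z, ind A (c x y) (c y z) (c x z) =
      ∑ a, ∑ b, ∑ d, ind A a b d * (pind (c x y = a) * pind (c y z = b) * pind (c x z = d)) := by
    intro x y z
    rw [Finset.sum_eq_single (c x y), Finset.sum_eq_single (c y z),
      Finset.sum_eq_single (c x z)]
    · simp [pind]
    · intro d _ hd; simp [pind, hd.symm]
    · simp
    · intro d _ hd; simp [pind, hd.symm]
    · simp
    · intro d _ hd; simp [pind, hd.symm]
    · simp
  have key : ∑ x ∈ U, ∑ y ∈ U, ∑ z ∈ U, ind A (c x y) (c y z) (c x z) -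
      lagPoly A p * (U.card : ℝ) ^ 3 = ∑ a, ∑ b, ∑ d, ind A a b d *
        (∑ x ∈ U, ∑ y ∈ U, ∑ z ∈ U, pind (c x y = a) * pind (c y z = b) * pind (c x z = d) -
          p a * p b * p d * (U.card : ℝ) ^ 3) := by
    simp_rw [mul_sub, Finset.sum_sub_distrib]
    congr 1
    · simp_rw [hind, Finset.mul_sum]
      have sc : ∀ F : V → C → ℝ, ∑ x ∈ U, ∑ a, F x a = ∑ a, ∑ x ∈ U, F x a :=
        fun F => Finset.sum_comm
      simp_rw [sc]
    · simp_rw [lagPoly, Finset.sum_mul, mul_assoc]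
  rw [key]
  have hE : ∀ a : C, 0 ≤ E := fun a => (abs_nonneg _).trans (h a ∅ (by simp) ∅ (by simp))
  have : 3 * (Fintype.card C : ℝ) ^ 3 * E * U.card =
      ∑ a : C, ∑ b : C, ∑ d : C, 3 * E * (U.card : ℝ) := by
    simp; ring
  rw [this]
  refine (Finset.abs_sum_le_sum_abs _ _).trans (Finset.sum_le_sum fun a _ => ?_)
  refine (Finset.abs_sum_le_sum_abs _ _).trans (Finset.sum_le_sum fun b _ => ?_)
  refine (Finset.abs_sum_le_sum_abs _ _).trans (Finset.sum_le_sum fun d _ => ?_)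
  rw [abs_mul, abs_of_nonneg (ind_nonneg _ _ _ _)]
  have h1 := triangle_count (h a) (h b) (h d) (hp a) (hp b)
  refine (mul_le_mul (ind_le_one A a b d) h1 (abs_nonneg _) zero_le_one).trans ?_
  linarith

end

/-- The sum of `f` over the rectangle `X × Y`. -/
def rectSum {V : Type*} (f : V → V → ℝ) (X Y : Finset V) : ℝ := ∑ x ∈ X, ∑ y ∈ Y, f x y

section
variable {V : Type*} [DecidableEq V] {f : V → V → ℝ}

lemma rectSum_union_left {X X' Y : Finset V} (h : Disjoint X X') :
    rectSum f (X ∪ X') Y = rectSum f X Y + rectSum f X' Y :=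
  Finset.sum_union h

lemma rectSum_union_right {X Y Y' : Finset V} (h : Disjoint Y Y') :
    rectSum f X (Y ∪ Y') = rectSum f X Y + rectSum f X Y' := by
  simp only [rectSum, Finset.sum_union h, Finset.sum_add_distrib]

lemma rectSum_symm {V : Type*} {f : V → V → ℝ} (hs : ∀ x y, f x y = f y x) (X Y : Finset V) :
    rectSum f X Y = rectSum f Y X := by
  unfold rectSum
  rw [Finset.sum_comm]
  simp_rw [hs]

lemma rectSum_nonneg {V : Type*} {f : V → V → ℝ} (h0 : ∀ x y, 0 ≤ f x y) (X Y : Finset V) :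
    0 ≤ rectSum f X Y :=
  Finset.sum_nonneg fun _ _ => Finset.sum_nonneg fun _ _ => h0 _ _

lemma rectSum_le {V : Type*} {f : V → V → ℝ} (h1 : ∀ x y, f x y ≤ 1) (X Y : Finset V) :
    rectSum f X Y ≤ X.card * Y.card := by
  have : (X.card * Y.card : ℝ) = ∑ x ∈ X, ∑ y ∈ Y, (1 : ℝ) := by simp
  rw [this]
  exact Finset.sum_le_sum fun _ _ => Finset.sum_le_sum fun _ _ => h1 _ _

lemma rectSum_sdiff_left {X P Y : Finset V} (h : P ⊆ X) :
    rectSum f X Y = rectSum f P Y + rectSum f (X \ P) Y := by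
  rw [← rectSum_union_left Finset.disjoint_sdiff, Finset.union_sdiff_of_subset h]

lemma rectSum_sdiff_right {X Y Q : Finset V} (h : Q ⊆ Y) :
    rectSum f X Y = rectSum f X Q + rectSum f X (Y \ Q) := by
  rw [← rectSum_union_right Finset.disjoint_sdiff, Finset.union_sdiff_of_subset h]

lemma exists_low_subset_card (hs : ∀ x y, f x y = f y x) (h1 : ∀ x y, f x y ≤ 1)
    (h0 : ∀ x y, 0 ≤ f x y) {t : ℝ} (ht : 0 ≤ t) (s : ℕ) (P : Finset V) (hP : s ≤ P.card)
    (h : rectSum f P P ≤ t * P.card ^ 2 + P.card) :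
    ∃ Q ⊆ P, Q.card = s ∧ rectSum f Q Q ≤ t * (s : ℝ) ^ 2 + s := by
  induction hn : P.card - s generalizing P with
  | zero =>
    have : P.card = s := by omega
    exact ⟨P, subset_rfl, this, this ▸ h⟩
  | succ k ih =>
    have hne : P.Nonempty := Finset.card_pos.1 (by omega)
    obtain ⟨v, hv, hmax⟩ := P.exists_max_image (fun x => ∑ y ∈ P, f x y) hne
    have hcard : (P.erase v).card = P.card - 1 := Finset.card_erase_of_mem hv
    have hstep : rectSum f (P.erase v) (P.erase v) ≤
        t * ((P.erase v).card : ℝ) ^ 2 + ((P.erase v).card : ℝ) := by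
      have hge : rectSum f P P ≤ P.card * ∑ y ∈ P, f v y := by
        rw [← nsmul_eq_mul, ← Finset.sum_const]
        exact Finset.sum_le_sum fun x hx => hmax x hx
      have e1 : rectSum f P P = rectSum f {v} P + rectSum f (P.erase v) P := by
        rw [Finset.erase_eq]
        exact rectSum_sdiff_left (by simpa using hv)
      have e2 : rectSum f (P.erase v) P = rectSum f (P.erase v) {v} +
          rectSum f (P.erase v) (P.erase v) := by
        rw [Finset.erase_eq]
        exact rectSum_sdiff_right (by simpa using hv)
      have e3 : rectSum f {v} P = rectSum f {v} {v} + rectSum f {v} (P.erase v) := by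
        rw [Finset.erase_eq]
        exact rectSum_sdiff_right (by simpa using hv)
      have e4 : rectSum f (P.erase v) {v} = rectSum f {v} (P.erase v) := rectSum_symm hs _ _
      have e5 : rectSum f {v} P = ∑ y ∈ P, f v y := by simp [rectSum]
      have e6 : rectSum f {v} {v} ≤ 1 := by simpa [rectSum] using h1 v v
      have e7 := rectSum_nonneg h0 (P.erase v) (P.erase v)
      have e8 := rectSum_nonneg h0 P P
      have hp1 : 1 ≤ P.card := hne.card_pos
      rw [hcard, Nat.cast_sub hp1, Nat.cast_one]
      set p := (P.card : ℝ) with hp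
      have hp1' : (1 : ℝ) ≤ p := by rw [hp]; exact_mod_cast hp1
      set D := ∑ y ∈ P, f v y with hD
      have key : rectSum f (P.erase v) (P.erase v) ≤ rectSum f P P - 2 * D + 1 := by linarith
      rcases hp1.eq_or_lt with h' | h'
      · have h0' : (P.erase v) = ∅ := Finset.card_eq_zero.1 (by omega)
        rw [h0']
        have : p = 1 := by rw [hp, ← h']; simp
        rw [this]
        simp [rectSum]
      · have hp2 : (2 : ℝ) ≤ p := by rw [hp]; exact_mod_cast h'
        have : p * rectSum f (P.erase v) (P.erase v) ≤ p * (t * (p - 1) ^ 2 + (p - 1)) := by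
          have a1 : p * rectSum f (P.erase v) (P.erase v) ≤
              p * rectSum f P P - 2 * (p * D) + p := by nlinarith
          have a2 : (p - 2) * rectSum f P P ≤ (p - 2) * (t * p ^ 2 + p) :=
            mul_le_mul_of_nonneg_left h (by linarith)
          nlinarith
        exact le_of_mul_le_mul_left this (by linarith)
    obtain ⟨Q, hQ, hQc, hQe⟩ := ih (P.erase v) (by omega) hstep (by omega)
    exact ⟨Q, hQ.trans (Finset.erase_subset _ _), hQc, hQe⟩

end

/-- If every large subset of `W` has density at least `t`, then `W` has a large subset on which
`f` is `ε`-uniform. -/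
def UnifClaim (ε t : ℝ) : Prop :=
  ∃ ρ > (0 : ℝ), ∃ δ > (0 : ℝ), ∃ N : ℕ, ρ ≤ 1 ∧
    ∀ (V : Type) [DecidableEq V] (f : V → V → ℝ), (∀ x y, f x y = f y x) → (∀ x y, 0 ≤ f x y) →
      (∀ x y, f x y ≤ 1) → ∀ W : Finset V, N ≤ W.card →
      (∀ X ⊆ W, ρ * W.card ≤ X.card → t * (X.card : ℝ) ^ 2 ≤ rectSum f X X) →
      ∃ U ⊆ W, δ * W.card ≤ U.card ∧ ∃ p ∈ Set.Icc (0 : ℝ) 1,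
        CutDisc U (fun x y => f x y - p) (ε * (U.card : ℝ) ^ 2)

section
variable {V : Type} [DecidableEq V] {f : V → V → ℝ}

lemma cross_lower (hs : ∀ x y, f x y = f y x) (h0 : ∀ x y, 0 ≤ f x y)
    {t κ : ℝ} (ht0 : 0 ≤ t) (ht1 : t ≤ 1) (hκ : 0 ≤ κ)
    {U : Finset V} {k : ℝ} {s : ℕ} (hspos : 0 < s) (hk : 0 ≤ k) (hs1 : 1 ≤ κ * s)
    (hU : ∀ X ⊆ U, s ≤ X.card → t * (X.card : ℝ) ^ 2 ≤ rectSum f X X)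
    (hlow : ∀ X ⊆ U, k ≤ X.card → ∃ P ⊆ X, P.card = s ∧
      rectSum f P P ≤ (t + κ) * (s : ℝ) ^ 2 + s)
    (X Y : Finset V) (hX : X ⊆ U) (hY : Y ⊆ U) (hXY : Disjoint X Y) :
    t * X.card * Y.card - k * X.card - k * Y.card - 2 * κ * X.card * Y.card ≤ rectSum f X Y := by
  have hsR : (0 : ℝ) < s := by exact_mod_cast hspos
  have stage0 : ∀ P ⊆ U, P.card = s → rectSum f P P ≤ (t + κ) * (s : ℝ) ^ 2 + s →
      ∀ Q ⊆ U, Q.card = s → rectSum f Q Q ≤ (t + κ) * (s : ℝ) ^ 2 + s → Disjoint P Q →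
      (t - 2 * κ) * (s : ℝ) ^ 2 ≤ rectSum f P Q := by
    intro P hP hPs hPe Q hQ hQs hQe hPQ
    have hc : (P ∪ Q).card = 2 * s := by rw [Finset.card_union_of_disjoint hPQ]; omega
    have := hU (P ∪ Q) (Finset.union_subset hP hQ) (by omega)
    rw [rectSum_union_left hPQ, rectSum_union_right hPQ, rectSum_union_right hPQ,
      rectSum_symm hs Q P, hc] at this
    push_cast at this
    nlinarith
  have stage1 : ∀ P ⊆ U, P.card = s → rectSum f P P ≤ (t + κ) * (s : ℝ) ^ 2 + s →
      ∀ n : ℕ, ∀ Y ⊆ U, Y.card = n → Disjoint P Y →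
      s * (t * (Y.card - k) - 2 * κ * Y.card) ≤ rectSum f P Y := by
    intro P hP hPs hPe n
    induction n using Nat.strong_induction_on with
    | _ n ih =>
      intro Y hY hYn hPY
      by_cases hYk : k ≤ Y.card
      · obtain ⟨Q, hQY, hQs, hQe⟩ := hlow Y hY hYk
        have hc : (Y \ Q).card = Y.card - s := by rw [Finset.card_sdiff_of_subset hQY, hQs]
        have hle : s ≤ Y.card := hQs ▸ Finset.card_le_card hQY
        have h2 := ih (Y \ Q).card (by omega) (Y \ Q) (Finset.sdiff_subset.trans hY) rfl
          (hPY.mono_right Finset.sdiff_subset)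
        have h1 := stage0 P hP hPs hPe Q (hQY.trans hY) hQs hQe (hPY.mono_right hQY)
        rw [rectSum_sdiff_right hQY]
        rw [hc, Nat.cast_sub hle] at h2
        nlinarith
      · refine le_trans ?_ (rectSum_nonneg h0 _ _)
        push Not at hYk
        refine mul_nonpos_of_nonneg_of_nonpos hsR.le ?_
        have : t * (Y.card - k) ≤ 0 := mul_nonpos_of_nonneg_of_nonpos ht0 (by linarith)
        have : 0 ≤ 2 * κ * Y.card := by positivity
        linarith
  have stage2 : ∀ n : ℕ, ∀ X ⊆ U, X.card = n → Disjoint X Y →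
      X.card * (t * (Y.card - k) - 2 * κ * Y.card) - k * Y.card ≤ rectSum f X Y := by
    intro n
    induction n using Nat.strong_induction_on with
    | _ n ih =>
      intro X hX hXn hXY
      by_cases hXk : k ≤ X.card
      · obtain ⟨P, hPX, hPs, hPe⟩ := hlow X hX hXk
        have hc : (X \ P).card = X.card - s := by rw [Finset.card_sdiff_of_subset hPX, hPs]
        have hle : s ≤ X.card := hPs ▸ Finset.card_le_card hPX
        have h2 := ih (X \ P).card (by omega) (X \ P) (Finset.sdiff_subset.trans hX) rfl
          (hXY.mono_left Finset.sdiff_subset)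
        have h1 := stage1 P (hPX.trans hX) hPs hPe _ Y hY rfl (hXY.mono_left hPX)
        rw [rectSum_sdiff_left hPX]
        rw [hc, Nat.cast_sub hle] at h2
        nlinarith
      · refine le_trans ?_ (rectSum_nonneg h0 _ _)
        push Not at hXk
        have hYc : (0 : ℝ) ≤ Y.card := by positivity
        have hXc : (0 : ℝ) ≤ X.card := by positivity
        have : t * (Y.card - k) - 2 * κ * Y.card ≤ Y.card := by nlinarith
        have := mul_le_mul_of_nonneg_left this hXc
        nlinarith
  have := stage2 _ X hX rfl hXY
  have hXc : (0 : ℝ) ≤ X.card := by positivity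
  have : X.card * (t * k) ≤ X.card * (1 * k) := by gcongr
  nlinarith

lemma cutDisc_of_lower {t κ : ℝ} {U : Finset V} (hκ : 0 ≤ κ)
    (hcross : ∀ X ⊆ U, ∀ Y ⊆ U, Disjoint X Y →
      t * X.card * Y.card - 4 * κ * (U.card : ℝ) ^ 2 ≤ rectSum f X Y)
    (hdiag : ∀ X ⊆ U, t * (X.card : ℝ) ^ 2 - κ * (U.card : ℝ) ^ 2 ≤ rectSum f X X)
    (hU : rectSum f U U ≤ (t + κ) * (U.card : ℝ) ^ 2) :
    CutDisc U (fun x y => f x y - t) (40 * κ * (U.card : ℝ) ^ 2) := by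
  have lower : ∀ X ⊆ U, ∀ Y ⊆ U,
      t * X.card * Y.card - 13 * κ * (U.card : ℝ) ^ 2 ≤ rectSum f X Y := by
    intro X hX Y hY
    have e1 : rectSum f X Y = rectSum f (X ∩ Y) Y + rectSum f (X \ (X ∩ Y)) Y :=
      rectSum_sdiff_left Finset.inter_subset_left
    have e2 : rectSum f (X ∩ Y) Y = rectSum f (X ∩ Y) (X ∩ Y) + rectSum f (X ∩ Y) (Y \ (X ∩ Y)) :=
      rectSum_sdiff_right Finset.inter_subset_right
    have hi : X ∩ Y ⊆ U := Finset.inter_subset_left.trans hX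
    have d1 := hdiag _ hi
    have d2 := hcross _ hi (Y \ (X ∩ Y)) (Finset.sdiff_subset.trans hY) Finset.disjoint_sdiff
    have d3 := hcross (X \ (X ∩ Y)) (Finset.sdiff_subset.trans hX) Y hY (by
      rw [Finset.sdiff_inter_self_left]; exact Finset.sdiff_disjoint)
    have c1 : (X.card : ℝ) = (X ∩ Y).card + (X \ (X ∩ Y)).card := by
      rw [add_comm]
      exact_mod_cast (Finset.card_sdiff_add_card_eq_card Finset.inter_subset_left).symm
    have c2 : (Y.card : ℝ) = (X ∩ Y).card + (Y \ (X ∩ Y)).card := by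
      rw [add_comm]
      exact_mod_cast (Finset.card_sdiff_add_card_eq_card Finset.inter_subset_right).symm
    have : 0 ≤ κ * (U.card : ℝ) ^ 2 := by positivity
    rw [e1, e2, c1]
    have : t * ((X ∩ Y).card + (X \ (X ∩ Y)).card) * Y.card =
      t * ((X ∩ Y).card : ℝ) ^ 2 + t * (X ∩ Y).card * (Y \ (X ∩ Y)).card +
        t * (X \ (X ∩ Y)).card * Y.card := by rw [c2]; ring
    linarith
  intro X hX Y hY
  have hr : ∑ x ∈ X, ∑ y ∈ Y, (f x y - t) = rectSum f X Y - t * X.card * Y.card := by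
    simp only [rectSum, Finset.sum_sub_distrib, Finset.sum_const, nsmul_eq_mul]
    ring
  rw [hr, abs_le]
  have : 0 ≤ κ * (U.card : ℝ) ^ 2 := by positivity
  have l1 := lower X hX Y hY
  have l2 := lower X hX (U \ Y) Finset.sdiff_subset
  have l3 := lower (U \ X) Finset.sdiff_subset U subset_rfl
  have e1 : rectSum f U U = rectSum f X U + rectSum f (U \ X) U := rectSum_sdiff_left hX
  have e2 : rectSum f X U = rectSum f X Y + rectSum f X (U \ Y) := rectSum_sdiff_right hY
  have c1 : (U.card : ℝ) = Y.card + (U \ Y).card := by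
    rw [add_comm]
    exact_mod_cast (Finset.card_sdiff_add_card_eq_card hY).symm
  have c2 : (U.card : ℝ) = X.card + (U \ X).card := by
    rw [add_comm]
    exact_mod_cast (Finset.card_sdiff_add_card_eq_card hX).symm
  have c3 : t * (U.card : ℝ) ^ 2 = t * X.card * Y.card + t * X.card * (U \ Y).card +
      t * (U \ X).card * U.card := by
    calc t * (U.card : ℝ) ^ 2 = t * X.card * U.card + t * (U \ X).card * U.card := by
          rw [pow_two]; nth_rewrite 1 [c2]; ring
      _ = _ := by nth_rewrite 1 [c1]; ring
  constructor <;> linarith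

end

lemma unifClaim_step {κ t : ℝ} (hκ : 0 < κ) (ht0 : 0 ≤ t) (hκ1 : κ ≤ 1)
    (h : UnifClaim (40 * κ) (t + κ)) : UnifClaim (40 * κ) t := by
  obtain ⟨ρ, hρ, δ, hδ, N, hρ1, H⟩ := h
  set σ := κ * ρ with hσ
  have hσ0 : 0 < σ := by positivity
  have hσ1 : σ ≤ 1 := mul_le_one₀ hκ1 hρ.le hρ1
  obtain ⟨N', hN'⟩ := exists_nat_ge (max (N / σ) (1 / (κ * (ρ * σ))))
  refine ⟨ρ * σ, by positivity, min (δ * σ) ρ, by positivity, N', mul_le_one₀ hρ1 hσ0.le hσ1, ?_⟩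
  intro V _ f hs h0 h1 W hW hWd
  have hWc : max (N / σ) (1 / (κ * (ρ * σ))) ≤ W.card := hN'.trans (by exact_mod_cast hW)
  have hWN : (N : ℝ) ≤ σ * W.card := by
    have := (le_max_left _ _).trans hWc
    rw [div_le_iff₀ hσ0] at this
    linarith
  have hWk : 1 ≤ κ * (ρ * σ * W.card) := by
    have := (le_max_right _ _).trans hWc
    rw [div_le_iff₀ (by positivity)] at this
    linarith
  by_cases hcase : ∃ W' ⊆ W, σ * W.card ≤ W'.card ∧
      ∀ X ⊆ W', ρ * W'.card ≤ X.card → (t + κ) * (X.card : ℝ) ^ 2 ≤ rectSum f X X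
  · obtain ⟨W', hW'W, hW'c, hW'⟩ := hcase
    obtain ⟨U, hU, hUc, hUp⟩ := H V f hs h0 h1 W' (by exact_mod_cast hWN.trans hW'c) hW'
    refine ⟨U, hU.trans hW'W, le_trans ?_ hUc, hUp⟩
    calc min (δ * σ) ρ * W.card ≤ δ * σ * W.card := by gcongr; exact min_le_left _ _
      _ = δ * (σ * W.card) := by ring
      _ ≤ δ * W'.card := by gcongr
  push Not at hcase
  obtain ⟨U, hUW, hUc, hUe⟩ := hcase W subset_rfl (by
    have : (0 : ℝ) ≤ W.card := by positivity
    nlinarith)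
  set s := ⌈ρ * σ * W.card⌉₊ with hs_def
  have hWpos : (0 : ℝ) < W.card := by
    by_contra hneg
    have : (W.card : ℝ) = 0 := le_antisymm (not_lt.1 hneg) (by positivity)
    rw [this] at hWk
    norm_num at hWk
  have hsge : ρ * σ * W.card ≤ s := Nat.le_ceil _
  have hspos : 0 < s := Nat.ceil_pos.2 (by positivity)
  have hs1 : 1 ≤ κ * s := hWk.trans (by gcongr)
  have hUdense : ∀ X ⊆ U, s ≤ X.card → t * (X.card : ℝ) ^ 2 ≤ rectSum f X X := fun X hX hc =>
    hWd X (hX.trans hUW) (hsge.trans (by exact_mod_cast hc))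
  have hUpos : (0 : ℝ) < U.card := lt_of_lt_of_le (by positivity) hUc
  have hUd : t * (U.card : ℝ) ^ 2 ≤ rectSum f U U := by
    refine hUdense U subset_rfl (Nat.ceil_le.2 (le_trans ?_ hUc))
    have : ρ * (σ * W.card) ≤ ρ * (1 * W.card) := by gcongr
    linarith
  have ht1 : t ≤ 1 := by
    have h2 := hUd.trans (rectSum_le h1 U U)
    have : 0 < (U.card : ℝ) ^ 2 := by positivity
    by_contra hgt
    push Not at hgt
    nlinarith
  have hlow : ∀ X ⊆ U, σ * W.card ≤ X.card → ∃ P ⊆ X, P.card = s ∧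
      rectSum f P P ≤ (t + κ) * (s : ℝ) ^ 2 + s := by
    intro X hX hXc
    obtain ⟨P, hPX, hPc, hPe⟩ := hcase X (hX.trans hUW) hXc
    have hsP : s ≤ P.card := Nat.ceil_le.2 (le_trans (by
      rw [mul_assoc]; gcongr) hPc)
    obtain ⟨Q, hQ, hQs, hQe⟩ := exists_low_subset_card hs h1 h0 (by positivity) s P hsP
      (hPe.le.trans (le_add_of_nonneg_right (by positivity)))
    exact ⟨Q, hQ.trans hPX, hQs, hQe⟩
  have hkU : σ * W.card ≤ κ * U.card := by
    calc σ * W.card = κ * (ρ * W.card) := by rw [hσ]; ring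
      _ ≤ κ * U.card := by gcongr
  refine ⟨U, hUW, le_trans (by gcongr; exact min_le_right _ _) hUc, t, ⟨ht0, ht1⟩,
    cutDisc_of_lower hκ.le ?_ ?_ hUe.le⟩
  · intro X hX Y hY hXY
    refine le_trans ?_ (cross_lower hs h0 ht0 ht1 hκ.le hspos (by positivity) hs1 hUdense hlow
      X Y hX hY hXY)
    have hXc : (X.card : ℝ) ≤ U.card := by exact_mod_cast Finset.card_le_card hX
    have hYc : (Y.card : ℝ) ≤ U.card := by exact_mod_cast Finset.card_le_card hY
    have a1 : σ * W.card * X.card ≤ κ * U.card * U.card := by gcongr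
    have a2 : σ * W.card * Y.card ≤ κ * U.card * U.card := by gcongr
    have a3 : 2 * κ * X.card * Y.card ≤ 2 * κ * U.card * U.card := by gcongr
    nlinarith
  · intro X hX
    by_cases hc : s ≤ X.card
    · have := hUdense X hX hc
      have : 0 ≤ κ * (U.card : ℝ) ^ 2 := by positivity
      linarith
    · push Not at hc
      refine le_trans ?_ (rectSum_nonneg h0 _ _)
      have hXc : (X.card : ℝ) ≤ U.card := by exact_mod_cast Finset.card_le_card hX
      have : (X.card : ℝ) < ρ * σ * W.card := Nat.lt_ceil.1 hc
      have h3 : ρ * (σ * W.card) ≤ 1 * (κ * U.card) := by gcongr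
      have h4 : (X.card : ℝ) * X.card ≤ (κ * U.card) * U.card := by
        gcongr
        linarith
      have : t * (X.card : ℝ) ^ 2 ≤ 1 * (X.card : ℝ) ^ 2 := by gcongr
      nlinarith

lemma unifClaim_of_one_lt {ε t : ℝ} (ht : 1 < t) : UnifClaim ε t := by
  refine ⟨1, one_pos, 1, one_pos, 1, le_rfl, ?_⟩
  intro V _ f _ _ h1 W hW h
  have h2 := (h W subset_rfl (by simp)).trans (rectSum_le h1 W W)
  have : (1 : ℝ) ≤ W.card := by exact_mod_cast hW
  have : 0 < (W.card : ℝ) ^ 2 := by positivity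
  nlinarith

lemma unifClaim_zero {ε : ℝ} (hε : 0 < ε) (hε1 : ε ≤ 1) : UnifClaim ε 0 := by
  have hκ : 0 < ε / 40 := by positivity
  have hεκ : 40 * (ε / 40) = ε := by ring
  obtain ⟨K, hK⟩ := exists_nat_gt (1 / (ε / 40))
  rw [div_lt_iff₀ hκ] at hK
  have : ∀ k : ℕ, k ≤ K → UnifClaim (40 * (ε / 40)) ((K - k : ℕ) * (ε / 40)) := by
    intro k
    induction k with
    | zero => exact fun _ => unifClaim_of_one_lt (by simpa using hK)
    | succ k ih =>
      intro hk
      refine unifClaim_step hκ (by positivity) (by linarith) ?_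
      have e : K - k = (K - (k + 1)) + 1 := by omega
      have := ih (by omega)
      rw [e] at this
      push_cast at this
      rwa [add_mul, one_mul] at this
  have := this K le_rfl
  rwa [hεκ, Nat.sub_self, Nat.cast_zero, zero_mul] at this

/-- Every colouring of pairs is uniform on some large subset. -/
lemma exists_uniform_subset {C : Type} (S : Finset C) {ε : ℝ} (hε : 0 < ε)
    (hε1 : ε ≤ 1) :
    ∃ δ > (0 : ℝ), ∃ N : ℕ, ∀ (V : Type) [DecidableEq V] (c : V → V → C),
      (∀ x y, c x y = c y x) → ∀ W : Finset V, N ≤ W.card → ∃ U ⊆ W, δ * W.card ≤ U.card ∧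
        ∃ p : C → ℝ, ∀ a ∈ S, p a ∈ Set.Icc (0 : ℝ) 1 ∧
          CutDisc U (fun x y => pind (c x y = a) - p a) (ε * (U.card : ℝ) ^ 2) := by
  classical
  induction S using Finset.induction_on generalizing ε with
  | empty =>
    exact ⟨1, one_pos, 0, fun V _ c _ W _ => ⟨W, subset_rfl, by simp, 0, by simp⟩⟩
  | insert b S hb ih =>
    obtain ⟨ρ, hρ, δ, hδ, N, hρ1, H⟩ := unifClaim_zero hε hε1
    have hm : 0 < min δ 1 := by positivity
    obtain ⟨δ', hδ', N', H'⟩ := ih (ε := ε * min δ 1 ^ 2) (by positivity)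
      (mul_le_one₀ hε1 (by positivity) (pow_le_one₀ hm.le (min_le_right _ _)))
    obtain ⟨N₂, hN₂⟩ := exists_nat_ge (N / δ')
    refine ⟨min δ 1 * δ', by positivity, max N' N₂, ?_⟩
    intro V _ c hc W hW
    obtain ⟨U, hUW, hUc, p, hp⟩ := H' V c hc W ((le_max_left _ _).trans hW)
    have hWN : (N₂ : ℝ) ≤ W.card := by exact_mod_cast (le_max_right _ _).trans hW
    have hUN : N ≤ U.card := by
      have h1 := hN₂.trans hWN
      rw [div_le_iff₀ hδ'] at h1
      have : (N : ℝ) ≤ U.card := by linarith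
      exact_mod_cast this
    obtain ⟨U', hU', hU'c, q, hq, hqd⟩ := H V (fun x y => pind (c x y = b))
      (fun x y => by rw [hc]) (fun _ _ => pind_nonneg _) (fun _ _ => pind_le_one _) U hUN
      (fun X _ _ => by
        rw [zero_mul]; exact rectSum_nonneg (fun _ _ => pind_nonneg _) _ _)
    have hmU : min δ 1 * U.card ≤ U'.card :=
      le_trans (by gcongr; exact min_le_left _ _) hU'c
    refine ⟨U', hU'.trans hUW, ?_, Function.update p b q, ?_⟩
    · rw [mul_assoc]
      exact le_trans (by gcongr) hmU
    · intro a ha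
      rcases Finset.mem_insert.1 ha with rfl | ha
      · simpa using ⟨hq, hqd⟩
      · have hab : a ≠ b := fun h => hb (h ▸ ha)
        rw [Function.update_of_ne hab]
        refine ⟨(hp a ha).1, fun X hX Y hY => ((hp a ha).2 X (hX.trans hU') Y
          (hY.trans hU')).trans ?_⟩
        calc ε * min δ 1 ^ 2 * (U.card : ℝ) ^ 2 = ε * (min δ 1 * U.card) ^ 2 := by ring
          _ ≤ ε * (U'.card : ℝ) ^ 2 := by gcongr

/-- `G` is paintable by the palette `A`: pairs of vertices can be coloured such that every edge
satisfies `A`. -/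
def Paintable {C : Type*} (A : C → C → C → Prop) (G : HGraph 3) : Prop :=
  ∃ c : Fin G.n → Fin G.n → C, (∀ x y, c x y = c y x) ∧
    ∀ x y z, {x, y, z} ∈ G.edges → A (c x y) (c y z) (c x z)

section
variable {q : ℕ} [Fact q.Prime]

lemma card_dependent (y : ZMod q × ZMod q) :
    (((Finset.univ : Finset (ZMod q × ZMod q)).filter
      (fun z => y.1 * z.2 = y.2 * z.1)).card : ℝ) ≤ (if y = 0 then (q : ℝ) ^ 2 else 0) + q := by
  split_ifs with h
  · have := Finset.card_filter_le (Finset.univ : Finset (ZMod q × ZMod q))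
      (fun z => y.1 * z.2 = y.2 * z.1)
    rw [Finset.card_univ, Fintype.card_prod, ZMod.card] at this
    have h2 : (((Finset.univ : Finset (ZMod q × ZMod q)).filter
      (fun z => y.1 * z.2 = y.2 * z.1)).card : ℝ) ≤ (q * q : ℕ) := by exact_mod_cast this
    push_cast at h2
    have : (0 : ℝ) ≤ q := by positivity
    nlinarith
  · have hsub : (Finset.univ : Finset (ZMod q × ZMod q)).filter
        (fun z => y.1 * z.2 = y.2 * z.1) ⊆
        (Finset.univ : Finset (ZMod q)).image (fun c => (c * y.1, c * y.2)) := by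
      rintro ⟨a, b⟩ hz
      simp only [Finset.mem_filter, Finset.mem_univ, true_and] at hz
      simp only [Finset.mem_image, Finset.mem_univ, true_and, Prod.mk.injEq]
      by_cases h1 : y.1 = 0
      · have h2 : y.2 ≠ 0 := fun h2 => h (Prod.ext h1 h2)
        refine ⟨b / y.2, ?_, by field_simp⟩
        rw [h1, zero_mul] at hz
        rcases mul_eq_zero.1 hz.symm with h3 | h3
        · exact absurd h3 h2
        · simp [h1, h3]
      · refine ⟨a / y.1, by field_simp, ?_⟩
        field_simp
        linear_combination -hz
    have := (Finset.card_le_card hsub).trans Finset.card_image_le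
    rw [Finset.card_univ, ZMod.card] at this
    rw [zero_add]
    exact_mod_cast this

lemma sum_mul_eq_zero_of_independent {ψ : ZMod q → ℝ} (hψ : ∑ t, ψ t = 0)
    {y z : ZMod q × ZMod q} (h : y.1 * z.2 ≠ y.2 * z.1) :
    ∑ x : ZMod q × ZMod q, ψ (x.1 * y.1 + x.2 * y.2) * ψ (x.1 * z.1 + x.2 * z.2) = 0 := by
  have hinj : Function.Injective (fun x : ZMod q × ZMod q =>
      (x.1 * y.1 + x.2 * y.2, x.1 * z.1 + x.2 * z.2)) := by
    rintro ⟨a, b⟩ ⟨a', b'⟩ hx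
    simp only [Prod.mk.injEq] at hx ⊢
    have hd : y.1 * z.2 - y.2 * z.1 ≠ 0 := sub_ne_zero.2 h
    constructor
    · refine mul_right_cancel₀ hd ?_
      linear_combination z.2 * hx.1 - y.2 * hx.2
    · refine mul_right_cancel₀ hd ?_
      linear_combination y.1 * hx.2 - z.1 * hx.1
  have hbij := Finite.injective_iff_bijective.1 hinj
  rw [Function.Bijective.sum_comp hbij (fun p : ZMod q × ZMod q => ψ p.1 * ψ p.2),
    Fintype.sum_prod_type]
  simp only
  rw [← Finset.sum_mul_sum, hψ, zero_mul]

lemma sq_rect_sum_le {ψ : ZMod q → ℝ} (hψ : ∑ t, ψ t = 0) (hψ1 : ∀ t, |ψ t| ≤ 1)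
    (X Y : Finset (ZMod q × ZMod q)) :
    (∑ x ∈ X, ∑ y ∈ Y, ψ (x.1 * y.1 + x.2 * y.2)) ^ 2 ≤ 2 * (q : ℝ) ^ 7 := by
  have hq1 : (1 : ℝ) ≤ q := by exact_mod_cast (Fact.out : q.Prime).one_lt.le
  have hc : ∀ Z : Finset (ZMod q × ZMod q), (Z.card : ℝ) ≤ (q : ℝ) ^ 2 := by
    intro Z
    have := Finset.card_le_univ Z
    rw [Fintype.card_prod, ZMod.card] at this
    rw [pow_two]
    exact_mod_cast this
  have hin : ∀ y z : ZMod q × ZMod q,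
      ∑ x : ZMod q × ZMod q, ψ (x.1 * y.1 + x.2 * y.2) * ψ (x.1 * z.1 + x.2 * z.2) ≤
        if y.1 * z.2 = y.2 * z.1 then (q : ℝ) ^ 2 else 0 := by
    intro y z
    split_ifs with h
    · calc _ ≤ ∑ x : ZMod q × ZMod q, (1 : ℝ) := by
            refine Finset.sum_le_sum fun x _ => (le_abs_self _).trans ?_
            rw [abs_mul]
            exact mul_le_one₀ (hψ1 _) (abs_nonneg _) (hψ1 _)
        _ ≤ _ := by
            rw [Finset.sum_const, nsmul_eq_mul, mul_one]
            exact hc _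
    · exact (sum_mul_eq_zero_of_independent hψ h).le
  have hnn : ∀ y z : ZMod q × ZMod q, (0 : ℝ) ≤ if y.1 * z.2 = y.2 * z.1 then (q : ℝ) ^ 2 else 0 :=
    fun y z => by split_ifs <;> positivity
  calc (∑ x ∈ X, ∑ y ∈ Y, ψ (x.1 * y.1 + x.2 * y.2)) ^ 2
      ≤ X.card * ∑ x ∈ X, (∑ y ∈ Y, ψ (x.1 * y.1 + x.2 * y.2)) ^ 2 :=
        sq_sum_le_card_mul_sum_sq
    _ ≤ (q : ℝ) ^ 2 * ∑ x : ZMod q × ZMod q, (∑ y ∈ Y, ψ (x.1 * y.1 + x.2 * y.2)) ^ 2 := by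
        gcongr
        · exact hc X
        · exact Finset.subset_univ X
    _ = (q : ℝ) ^ 2 * ∑ y ∈ Y, ∑ z ∈ Y,
          ∑ x : ZMod q × ZMod q, ψ (x.1 * y.1 + x.2 * y.2) * ψ (x.1 * z.1 + x.2 * z.2) := by
        congr 1
        simp_rw [pow_two, Finset.sum_mul_sum]
        rw [Finset.sum_comm]
        refine Finset.sum_congr rfl fun y _ => ?_
        rw [Finset.sum_comm]
    _ ≤ (q : ℝ) ^ 2 * ∑ y ∈ Y, ∑ z ∈ Y, (if y.1 * z.2 = y.2 * z.1 then (q : ℝ) ^ 2 else 0) := by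
        gcongr with y _ z _
        exact hin y z
    _ ≤ (q : ℝ) ^ 2 * ∑ y : ZMod q × ZMod q, ∑ z : ZMod q × ZMod q,
          (if y.1 * z.2 = y.2 * z.1 then (q : ℝ) ^ 2 else 0) := by
        refine mul_le_mul_of_nonneg_left ?_ (by positivity)
        calc _ ≤ ∑ y ∈ Y, ∑ z : ZMod q × ZMod q,
          (if y.1 * z.2 = y.2 * z.1 then (q : ℝ) ^ 2 else 0) :=
              Finset.sum_le_sum fun y _ => Finset.sum_le_sum_of_subset_of_nonneg
                (Finset.subset_univ Y) fun z _ _ => hnn y z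
          _ ≤ _ := Finset.sum_le_sum_of_subset_of_nonneg (Finset.subset_univ Y)
                fun y _ _ => Finset.sum_nonneg fun z _ => hnn y z
    _ ≤ (q : ℝ) ^ 2 * ∑ y : ZMod q × ZMod q, (q : ℝ) ^ 2 *
          ((if y = 0 then (q : ℝ) ^ 2 else 0) + q) := by
        refine mul_le_mul_of_nonneg_left (Finset.sum_le_sum fun y _ => ?_) (by positivity)
        rw [← Finset.sum_filter, Finset.sum_const, nsmul_eq_mul, mul_comm]
        exact mul_le_mul_of_nonneg_left (card_dependent y) (by positivity)
    _ = (q : ℝ) ^ 2 * ((q : ℝ) ^ 2 * ((q : ℝ) ^ 2 + q ^ 2 * q)) := by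
        rw [← Finset.mul_sum, Finset.sum_add_distrib, Finset.sum_ite_eq' Finset.univ
          (0 : ZMod q × ZMod q) (fun _ => (q : ℝ) ^ 2)]
        rw [Finset.sum_const, Finset.card_univ, Fintype.card_prod, ZMod.card]
        simp only [Finset.mem_univ, if_true, nsmul_eq_mul]
        push_cast
        ring
    _ ≤ 2 * (q : ℝ) ^ 7 := by
        have : (q : ℝ) ^ 6 ≤ (q : ℝ) ^ 7 := pow_le_pow_right₀ hq1 (by norm_num)
        nlinarith

lemma exists_fiber_card {C : Type*} [Fintype C] [Nonempty C] {w : C → ℝ} (hw : ∀ a, 0 ≤ w a)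
    (hw1 : ∑ a, w a = 1) :
    ∃ φ : ZMod q → C, ∀ a, w a - 1 / q ≤ (∑ t, pind (φ t = a)) / q := by
  classical
  have hq0 : (0 : ℝ) < q := by exact_mod_cast (Fact.out : q.Prime).pos
  have hcard : Fintype.card (Σ a : C, Fin ⌊q * w a⌋₊) ≤ Fintype.card (ZMod q) := by
    rw [Fintype.card_sigma, ZMod.card]
    simp only [Fintype.card_fin]
    have : (∑ a, (⌊q * w a⌋₊ : ℝ)) ≤ q := by
      calc _ ≤ ∑ a, q * w a :=
            Finset.sum_le_sum fun a _ => Nat.floor_le (mul_nonneg hq0.le (hw a))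
        _ = q := by rw [← Finset.mul_sum, hw1, mul_one]
    exact_mod_cast this
  obtain ⟨e⟩ := Function.Embedding.nonempty_of_card_le hcard
  refine ⟨Function.extend e Sigma.fst (fun _ => Classical.arbitrary C), fun a => ?_⟩
  rw [le_div_iff₀ hq0]
  have h1 : (⌊q * w a⌋₊ : ℝ) ≤
      ∑ t, pind (Function.extend e Sigma.fst (fun _ => Classical.arbitrary C) t = a) := by
    let g : Fin ⌊q * w a⌋₊ ↪ ZMod q :=
      ⟨fun i => e ⟨a, i⟩, fun i j h => by simpa using e.injective h⟩
    calc (⌊q * w a⌋₊ : ℝ) = ∑ t ∈ Finset.univ.map g, (1 : ℝ) := by simp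
      _ ≤ ∑ t ∈ Finset.univ.map g,
          pind (Function.extend e Sigma.fst (fun _ => Classical.arbitrary C) t = a) := by
          refine Finset.sum_le_sum fun t ht => ?_
          obtain ⟨i, -, rfl⟩ := Finset.mem_map.1 ht
          have : Function.extend e Sigma.fst (fun _ => Classical.arbitrary C) (g i) = a :=
            e.injective.extend_apply _ _ _
          simp [this, pind]
      _ ≤ _ := Finset.sum_le_sum_of_subset_of_nonneg (Finset.subset_univ _)
          fun _ _ _ => pind_nonneg _
  have h2 := (Nat.lt_floor_add_one (q * w a)).le
  have : (w a - 1 / q) * q = q * w a - 1 := by field_simp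
  linarith

end

open Classical in
/-- The triples of `Fin n` with pair colours satisfying `A`. -/
noncomputable def paletteEdges {C : Type*} (A : C → C → C → Prop) {n : ℕ}
    (c : Fin n → Fin n → C) : Finset (Finset (Fin n)) :=
  Finset.univ.filter fun e => e.card = 3 ∧ ∀ x y z, e = {x, y, z} → A (c x y) (c y z) (c x z)

lemma mem_paletteEdges {C : Type*} (A : C → C → C → Prop) {n : ℕ}
    (c : Fin n → Fin n → C) (e : Finset (Fin n)) : e ∈ paletteEdges A c ↔
      e.card = 3 ∧ ∀ x y z, e = {x, y, z} → A (c x y) (c y z) (c x z) := by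
  simp only [paletteEdges, Finset.mem_filter, Finset.mem_univ, true_and]

/-- The `3`-graph on `Fin n` whose edges are the triples with pair colours satisfying `A`. -/
noncomputable def paletteGraph {C : Type*} (A : C → C → C → Prop) (n : ℕ)
    (c : Fin n → Fin n → C) : HGraph 3 where
  n := n
  edges := paletteEdges A c
  card_eq e he := ((mem_paletteEdges A c e).1 he).1

lemma paintable_paletteGraph {C : Type*} (A : C → C → C → Prop) (n : ℕ)
    (c : Fin n → Fin n → C) (hc : ∀ x y, c x y = c y x) : Paintable A (paletteGraph A n c) :=
  ⟨c, hc, fun x y z h => ((mem_paletteEdges A c _).1 h).2 x y z rfl⟩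

lemma triple_mem_paletteEdges {C : Type*} {A : C → C → C → Prop} (hA : SymRel A) {n : ℕ}
    {c : Fin n → Fin n → C} (hc : ∀ x y, c x y = c y x) {x y z : Fin n} (hxy : x ≠ y)
    (hyz : y ≠ z) (hxz : x ≠ z) (h : A (c x y) (c y z) (c x z)) :
    {x, y, z} ∈ (paletteEdges A c) := by
  refine (mem_paletteEdges A c _).2 ⟨Finset.card_eq_three.2 ⟨x, y, z, hxy, hxz, hyz, rfl⟩, ?_⟩
  intro a b d he
  have h1 : x ∈ ({a, b, d} : Finset _) := he ▸ by simp
  have h2 : y ∈ ({a, b, d} : Finset _) := he ▸ by simp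
  have h3 : z ∈ ({a, b, d} : Finset _) := he ▸ by simp
  simp only [Finset.mem_insert, Finset.mem_singleton] at h1 h2 h3
  have hs := hA.1
  have ht := hA.2
  rcases h1 with rfl | rfl | rfl <;> rcases h2 with rfl | rfl | rfl <;>
    rcases h3 with rfl | rfl | rfl <;> first | contradiction | grind

lemma six_mul_edges_ge {C : Type*} {A : C → C → C → Prop} (hA : SymRel A) {n : ℕ}
    {c : Fin n → Fin n → C} (hc : ∀ x y, c x y = c y x) (U : Finset (Fin n)) :
    ∑ x ∈ U, ∑ y ∈ U, ∑ z ∈ U, ind A (c x y) (c y z) (c x z) - 3 * (U.card : ℝ) ^ 2 ≤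
      6 * (((paletteEdges A c).filter (fun e => e ⊆ U)).card : ℝ) := by
  have h6 := sum_triples_eq (paletteEdges A c) (paletteGraph A n c).card_eq U
  have h3 : 3 * (U.card : ℝ) ^ 2 = ∑ x ∈ U, ∑ y ∈ U, ∑ z ∈ U,
      ((if x = y then (1 : ℝ) else 0) + (if y = z then 1 else 0) + (if x = z then 1 else 0)) := by
    simp only [Finset.sum_add_distrib, Finset.sum_ite_eq, Finset.sum_const, nsmul_eq_mul]
    have e1 : ∀ x ∈ U, ∑ y ∈ U, (U.card : ℝ) * (if x = y then 1 else 0) = U.card := by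
      intro x hx
      rw [← Finset.mul_sum, Finset.sum_ite_eq, if_pos hx, mul_one]
    have e2 : ∀ x ∈ U, (if x ∈ U then (1 : ℝ) else 0) = 1 := fun x hx => if_pos hx
    rw [Finset.sum_congr rfl e1, Finset.sum_congr rfl e2]
    have e3 : ∑ x ∈ U, (U.card : ℝ) * (if x ∈ U then (1 : ℝ) else 0) = U.card * U.card := by
      rw [← Finset.mul_sum, Finset.sum_congr rfl e2]; simp
    rw [e3]
    simp
    ring
  rw [← h6, h3]
  simp_rw [← Finset.sum_sub_distrib]
  refine Finset.sum_le_sum fun x _ => Finset.sum_le_sum fun y _ => Finset.sum_le_sum fun z _ => ?_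
  have hi1 := ind_le_one A (c x y) (c y z) (c x z)
  have hi0 := ind_nonneg A (c x y) (c y z) (c x z)
  have hp : (0 : ℝ) ≤ if ({x, y, z} : Finset (Fin n)) ∈ (paletteEdges A c) then 1 else 0 := by
    split_ifs <;> norm_num
  by_cases hxy : x = y
  · simp only [hxy, if_true] at *
    split_ifs at * <;> linarith
  by_cases hyz : y = z
  · simp only [hyz, if_true] at *
    split_ifs at * <;> linarith
  by_cases hxz : x = z
  · simp only [hxz, if_true] at *
    split_ifs at * <;> linarith
  simp only [hxy, hyz, hxz, if_false]
  by_cases h : A (c x y) (c y z) (c x z)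
  · rw [if_pos (triple_mem_paletteEdges hA hc hxy hyz hxz h)]
    linarith
  · have : ind A (c x y) (c y z) (c x z) = 0 := if_neg h
    linarith

lemma card_paletteEdges_ge {C : Type*} [Fintype C] {A : C → C → C → Prop} (hA : SymRel A) {n : ℕ}
    {c : Fin n → Fin n → C} (hc : ∀ x y, c x y = c y x) (U : Finset (Fin n)) {p : C → ℝ} {E d : ℝ}
    (hp : ∀ a, p a ∈ Set.Icc (0 : ℝ) 1) (h : ∀ a, CutDisc U (fun x y => pind (c x y = a) - p a) E)
    (hd : 0 ≤ d) (hdp : d ≤ lagPoly A p) :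
    6 * (d * (U.card.choose 3 : ℝ)) - (3 * (Fintype.card C : ℝ) ^ 3 * E * U.card +
      3 * (U.card : ℝ) ^ 2) ≤ 6 * (((paletteEdges A c).filter (fun e => e ⊆ U)).card : ℝ) := by
  have hcount := count_palette A c hp h
  have h6 := six_mul_edges_ge hA hc U
  have hch : (U.card.choose 3 : ℝ) ≤ (U.card : ℝ) ^ 3 / 6 := by
    have := Nat.choose_le_pow_div (α := ℝ) 3 U.card
    norm_num [Nat.factorial] at this
    linarith
  have b3 : 6 * (d * (U.card.choose 3 : ℝ)) ≤ lagPoly A p * (U.card : ℝ) ^ 3 := by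
    calc 6 * (d * (U.card.choose 3 : ℝ)) ≤ 6 * (lagPoly A p * ((U.card : ℝ) ^ 3 / 6)) := by
          gcongr
          exact hd.trans hdp
      _ = _ := by ring
  have := (abs_le.1 hcount).1
  linarith

/-- Paintable graphs can be uniformly dense with density close to the Lagrangian. -/
lemma exists_paintable_dense {C : Type} [Fintype C] [Nonempty C] {A : C → C → C → Prop}
    (hA : SymRel A) {d : ℝ} (hd0 : 0 ≤ d) (hd : d < lagr A) {η : ℝ} (hη : 0 < η) (n₀ : ℕ) :
    ∃ H : HGraph 3, Paintable A H ∧ UniformlyDense H d η ∧ n₀ ≤ H.n := by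
  obtain ⟨w, hw, hw1, hwA⟩ := exists_weight_sum_one A
  have htend : Tendsto (fun q : ℕ => lagPoly A (fun a => max (w a - 1 / (q : ℝ)) 0)) atTop
      (nhds (lagPoly A w)) := by
    refine (continuous_lagPoly.tendsto w).comp (tendsto_pi_nhds.2 fun a => ?_)
    have h1 : Tendsto (fun q : ℕ => max (w a - 1 / (q : ℝ)) 0) atTop (nhds (max (w a - 0) 0)) :=
      (tendsto_const_nhds.sub tendsto_one_div_atTop_nhds_zero_nat).max tendsto_const_nhds
    rwa [sub_zero, max_eq_left (hw a)] at h1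
  rw [hwA] at htend
  have hev := (htend.eventually (lt_mem_nhds hd))
  obtain ⟨N, hN⟩ := eventually_atTop.1 hev
  set K : ℝ := (Fintype.card C : ℝ) ^ 3 + 1 with hK
  have hK1 : 1 ≤ K := by rw [hK]; linarith [show (0 : ℝ) ≤ (Fintype.card C : ℝ) ^ 3 by positivity]
  obtain ⟨N₁, hN₁⟩ := exists_nat_ge (max (2 / (η / K) ^ 2) (1 / η))
  obtain ⟨q, hq, hprime⟩ := Nat.exists_infinite_primes (max (max N N₁) n₀)
  have : Fact q.Prime := ⟨hprime⟩
  have hqN : N ≤ q := ((le_max_left _ _).trans (le_max_left _ _)).trans hq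
  have hqN₁ : N₁ ≤ q := ((le_max_right _ _).trans (le_max_left _ _)).trans hq
  have hqn₀ : n₀ ≤ q := (le_max_right _ _).trans hq
  have hqR : max (2 / (η / K) ^ 2) (1 / η) ≤ q := hN₁.trans (by exact_mod_cast hqN₁)
  have hq0 : (0 : ℝ) < q := by exact_mod_cast hprime.pos
  have hq1 : (1 : ℝ) ≤ q := by exact_mod_cast hprime.one_lt.le
  obtain ⟨φ, hφ⟩ := exists_fiber_card (q := q) hw hw1
  set p : C → ℝ := fun a => (∑ t, pind (φ t = a)) / q with hp
  have hp01 : ∀ a, p a ∈ Set.Icc (0 : ℝ) 1 := by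
    intro a
    refine ⟨div_nonneg (Finset.sum_nonneg fun _ _ => pind_nonneg _) hq0.le, ?_⟩
    rw [hp]
    simp only
    rw [div_le_one hq0]
    calc ∑ t : ZMod q, pind (φ t = a) ≤ ∑ t : ZMod q, (1 : ℝ) :=
          Finset.sum_le_sum fun _ _ => pind_le_one _
      _ = q := by simp [ZMod.card]
  have hdp : d ≤ lagPoly A p := by
    refine (hN q hqN).le.trans (lagPoly_mono_weight (fun a => le_max_right _ _) fun a => ?_)
    exact max_le (hφ a) (hp01 a).1
  have hcard : Fintype.card (ZMod q × ZMod q) = q * q := by rw [Fintype.card_prod, ZMod.card]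
  let e : Fin (q * q) ≃ ZMod q × ZMod q := (Fintype.equivFinOfCardEq hcard).symm
  let c : Fin (q * q) → Fin (q * q) → C := fun x y =>
    φ ((e x).1 * (e y).1 + (e x).2 * (e y).2)
  have hc : ∀ x y, c x y = c y x := fun x y => by
    simp only [c, mul_comm]
  refine ⟨paletteGraph A (q * q) c, paintable_paletteGraph A _ c hc, ?_,
    hqn₀.trans (Nat.le_mul_self q)⟩
  change ∀ U : Finset (Fin (q * q)), d * (U.card.choose 3 : ℝ) - η * ((q * q : ℕ) : ℝ) ^ 3 ≤
    (((paletteEdges A c).filter (fun e => e ⊆ U)).card : ℝ)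
  intro U
  have hdisc : ∀ a, CutDisc U (fun x y => pind (c x y = a) - p a) (η / K * (q : ℝ) ^ 4) := by
    intro a X _ Y _
    have hψ : ∑ t, (pind (φ t = a) - p a) = 0 := by
      rw [Finset.sum_sub_distrib, Finset.sum_const, Finset.card_univ, ZMod.card, nsmul_eq_mul, hp]
      simp only
      field_simp
      simp
    have := sq_rect_sum_le (ψ := fun t => pind (φ t = a) - p a) hψ (fun t => by
      rw [abs_le]
      have h1 := pind_nonneg (φ t = a)
      have h2 := pind_le_one (φ t = a)
      have h3 := hp01 a
      constructor <;> linarith [h3.1, h3.2]) (X.map e.toEmbedding) (Y.map e.toEmbedding)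
    simp only [Finset.sum_map] at this
    refine abs_le_of_sq_le_sq (this.trans ?_) (by positivity)
    have h2 := (le_max_left _ _).trans hqR
    rw [div_le_iff₀ (by positivity)] at h2
    calc 2 * (q : ℝ) ^ 7 ≤ (q * (η / K) ^ 2) * (q : ℝ) ^ 7 := by gcongr
      _ = (η / K * (q : ℝ) ^ 4) ^ 2 := by ring
  have hcount := card_paletteEdges_ge hA hc U hp01 hdisc hd0 hdp
  have hUq : (U.card : ℝ) ≤ (q : ℝ) ^ 2 := by
    have := Finset.card_le_univ U
    rw [Fintype.card_fin] at this
    rw [pow_two]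
    exact_mod_cast this
  have hn : ((q * q : ℕ) : ℝ) = (q : ℝ) ^ 2 := by
    push_cast
    ring
  have b1 : 3 * (Fintype.card C : ℝ) ^ 3 * (η / K * (q : ℝ) ^ 4) * U.card ≤ 3 * η * (q : ℝ) ^ 6 := by
    have h1 : (Fintype.card C : ℝ) ^ 3 / K ≤ 1 := by
      rw [div_le_one (by linarith)]; linarith
    calc 3 * (Fintype.card C : ℝ) ^ 3 * (η / K * (q : ℝ) ^ 4) * U.card
        ≤ 3 * (Fintype.card C : ℝ) ^ 3 * (η / K * (q : ℝ) ^ 4) * (q : ℝ) ^ 2 := by gcongr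
      _ = 3 * η * (q : ℝ) ^ 6 * ((Fintype.card C : ℝ) ^ 3 / K) := by ring
      _ ≤ 3 * η * (q : ℝ) ^ 6 * 1 := by gcongr
      _ = _ := mul_one _
  have b2 : 3 * (U.card : ℝ) ^ 2 ≤ 3 * η * (q : ℝ) ^ 6 := by
    have h2 := (le_max_right _ _).trans hqR
    rw [div_le_iff₀ hη] at h2
    have h3 : 1 * 1 ≤ (q : ℝ) * (q * η) := by gcongr
    calc 3 * (U.card : ℝ) ^ 2 ≤ 3 * ((q : ℝ) ^ 2) ^ 2 := by gcongr
      _ = 3 * (q : ℝ) ^ 4 * (1 * 1) := by ring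
      _ ≤ 3 * (q : ℝ) ^ 4 * (q * (q * η)) := by gcongr
      _ = _ := by ring
  have e6 : η * ((q : ℝ) ^ 2) ^ 3 = η * (q : ℝ) ^ 6 := by rw [← pow_mul]
  rw [hn, e6]
  linarith

/-- The trilinear form with kernel `K`. -/
def tri {α β γ : Type*} [Fintype α] [Fintype β] [Fintype γ] (K : α → β → γ → ℝ)
    (f : α → ℝ) (g : β → ℝ) (h : γ → ℝ) : ℝ :=
  ∑ x, ∑ y, ∑ z, K x y z * (f x * g y * h z)

section
variable {α β γ : Type*} [Fintype α] [Fintype β] [Fintype γ] {K : α → β → γ → ℝ}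

lemma abs_sum_mul_le_of_sets {F f : α → ℝ} {E : ℝ} (hF : ∀ X : Finset α, |∑ x ∈ X, F x| ≤ E)
    (hf : ∀ x, |f x| ≤ 1) : |∑ x, F x * f x| ≤ 2 * E := by
  classical
  have h1 : |∑ x, F x * f x| ≤ ∑ x, |F x| := by
    refine (Finset.abs_sum_le_sum_abs _ _).trans (Finset.sum_le_sum fun x _ => ?_)
    rw [abs_mul]
    exact mul_le_of_le_one_right (abs_nonneg _) (hf x)
  have h2 : ∑ x, |F x| = ∑ x ∈ Finset.univ.filter (fun x => 0 ≤ F x), F x -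
      ∑ x ∈ Finset.univ.filter (fun x => ¬ 0 ≤ F x), F x := by
    rw [← Finset.sum_filter_add_sum_filter_not Finset.univ (fun x => 0 ≤ F x), sub_eq_add_neg,
      ← Finset.sum_neg_distrib]
    congr 1
    · exact Finset.sum_congr rfl fun x hx => abs_of_nonneg (Finset.mem_filter.1 hx).2
    · exact Finset.sum_congr rfl fun x hx => abs_of_neg (not_le.1 (Finset.mem_filter.1 hx).2)
  have h3 := abs_le.1 (hF (Finset.univ.filter (fun x => 0 ≤ F x)))
  have h4 := abs_le.1 (hF (Finset.univ.filter (fun x => ¬ 0 ≤ F x)))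
  linarith [h3.2, h4.1]

/-- The indicator function of a finite set. -/
noncomputable def sind (X : Finset α) : α → ℝ := fun x => pind (x ∈ X)

lemma abs_sind_le_one {α : Type*} (X : Finset α) (x : α) : |sind X x| ≤ 1 := by
  unfold sind
  rw [abs_of_nonneg (pind_nonneg _)]
  exact pind_le_one _

lemma sum_mul_sind (X : Finset α) (F : α → ℝ) : ∑ x, F x * sind X x = ∑ x ∈ X, F x := by
  classical
  simp only [sind]
  rw [sum_pind_mul]
  congr 1
  ext x
  simp

lemma tri_eq_first (K : α → β → γ → ℝ) (f : α → ℝ) (g : β → ℝ) (h : γ → ℝ) :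
    tri K f g h = ∑ x, (∑ y, ∑ z, K x y z * (g y * h z)) * f x := by
  simp only [tri, Finset.sum_mul]
  exact Finset.sum_congr rfl fun x _ => Finset.sum_congr rfl fun y _ =>
    Finset.sum_congr rfl fun z _ => by ring

lemma tri_rotate (K : α → β → γ → ℝ) (f : α → ℝ) (g : β → ℝ) (h : γ → ℝ) :
    tri K f g h = tri (fun y z x => K x y z) g h f := by
  simp only [tri]
  rw [Finset.sum_comm]
  refine Finset.sum_congr rfl fun y _ => ?_
  rw [Finset.sum_comm]
  exact Finset.sum_congr rfl fun z _ => Finset.sum_congr rfl fun x _ => by ring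

lemma abs_tri_le_first {g : β → ℝ} {h : γ → ℝ} {E : ℝ}
    (hE : ∀ X : Finset α, |tri K (sind X) g h| ≤ E) {f : α → ℝ} (hf : ∀ x, |f x| ≤ 1) :
    |tri K f g h| ≤ 2 * E := by
  rw [tri_eq_first]
  refine abs_sum_mul_le_of_sets (fun X => ?_) hf
  have := hE X
  rwa [tri_eq_first, sum_mul_sind] at this

lemma abs_tri_le_of_sets {E : ℝ}
    (hE : ∀ (X : Finset α) (Y : Finset β) (Z : Finset γ), |tri K (sind X) (sind Y) (sind Z)| ≤ E)
    {f : α → ℝ} {g : β → ℝ} {h : γ → ℝ} (hf : ∀ x, |f x| ≤ 1) (hg : ∀ x, |g x| ≤ 1)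
    (hh : ∀ x, |h x| ≤ 1) : |tri K f g h| ≤ 8 * E := by
  have h1 : ∀ (Y : Finset β) (Z : Finset γ), |tri K f (sind Y) (sind Z)| ≤ 2 * E :=
    fun Y Z => abs_tri_le_first (fun X => hE X Y Z) hf
  have h2 : ∀ Z : Finset γ, |tri K f g (sind Z)| ≤ 2 * (2 * E) := by
    intro Z
    rw [tri_rotate]
    exact abs_tri_le_first (fun Y => by rw [← tri_rotate]; exact h1 Y Z) hg
  have h3 : |tri K f g h| ≤ 2 * (2 * (2 * E)) := by
    rw [tri_rotate, tri_rotate]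
    exact abs_tri_le_first (fun Z => by rw [← tri_rotate, ← tri_rotate]; exact h2 Z) hh
  linarith

lemma tri_sub (K K' : α → β → γ → ℝ) (f : α → ℝ) (g : β → ℝ) (h : γ → ℝ) :
    tri (fun x y z => K x y z - K' x y z) f g h = tri K f g h - tri K' f g h := by
  simp only [tri, sub_mul, Finset.sum_sub_distrib]

end

/-- A weak regularity lemma: every bounded kernel is close in cut norm to a kernel depending only
on boundedly many labels. -/
lemma exists_label_approx {V : Type*} [Fintype V] {e : ℝ} (he : 0 < e) (k : ℕ) :
    ∀ K : V → V → V → ℝ, ∑ x, ∑ y, ∑ z, K x y z ^ 2 ≤ k * (e ^ 2 * (Fintype.card V : ℝ) ^ 3) →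
    ∃ (L : Type) (_ : Fintype L) (lab : V → L) (σ : L → L → L → ℝ), Fintype.card L ≤ 8 ^ k ∧
      ∀ X Y Z : Finset V, |tri (fun x y z => K x y z - σ (lab x) (lab y) (lab z))
        (sind X) (sind Y) (sind Z)| ≤ e * (Fintype.card V : ℝ) ^ 3 := by
  induction k with
  | zero =>
    intro K hK
    refine ⟨Unit, inferInstance, fun _ => (), fun _ _ _ => 0, by simp, fun X Y Z => ?_⟩
    have h0 : ∀ x y z, K x y z = 0 := by
      intro x y z
      have hK' : ∑ x, ∑ y, ∑ z, K x y z ^ 2 ≤ 0 := by simpa using hK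
      have h1 : K x y z ^ 2 ≤ ∑ x, ∑ y, ∑ z, K x y z ^ 2 :=
        (Finset.single_le_sum (f := fun z => K x y z ^ 2) (fun _ _ => sq_nonneg _)
          (Finset.mem_univ z)).trans <|
        (Finset.single_le_sum (f := fun y => ∑ z, K x y z ^ 2)
          (fun _ _ => Finset.sum_nonneg fun _ _ => sq_nonneg _) (Finset.mem_univ y)).trans <|
        Finset.single_le_sum (f := fun x => ∑ y, ∑ z, K x y z ^ 2)
          (fun _ _ => Finset.sum_nonneg fun _ _ => Finset.sum_nonneg fun _ _ => sq_nonneg _)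
          (Finset.mem_univ x)
      nlinarith [sq_nonneg (K x y z)]
    simp only [tri, h0, sub_zero, zero_mul, Finset.sum_const_zero, abs_zero]
    positivity
  | succ k ih =>
    intro K hK
    by_cases hcut : ∀ X Y Z : Finset V, |tri K (sind X) (sind Y) (sind Z)| ≤
        e * (Fintype.card V : ℝ) ^ 3
    · refine ⟨Unit, inferInstance, fun _ => (), fun _ _ _ => 0, ?_, fun X Y Z => ?_⟩
      · simpa using Nat.one_le_pow _ _ (by norm_num)
      · simpa using hcut X Y Z
    push Not at hcut
    obtain ⟨X, Y, Z, hXYZ⟩ := hcut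
    set T := tri K (sind X) (sind Y) (sind Z) with hT
    obtain ⟨c, hc, hcT⟩ : ∃ c : ℝ, c ^ 2 = e ^ 2 ∧ c * T = e * |T| := by
      rcases le_total 0 T with h | h
      · exact ⟨e, rfl, by rw [abs_of_nonneg h]⟩
      · exact ⟨-e, by ring, by rw [abs_of_nonpos h]; ring⟩
    set P : V → V → V → ℝ := fun x y z => sind X x * sind Y y * sind Z z with hP
    have hsq : ∑ x, ∑ y, ∑ z, (K x y z - c * P x y z) ^ 2 ≤
        k * (e ^ 2 * (Fintype.card V : ℝ) ^ 3) := by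
      have e1 : ∑ x, ∑ y, ∑ z, (K x y z - c * P x y z) ^ 2 =
          ∑ x, ∑ y, ∑ z, K x y z ^ 2 - 2 * (c * T) + c ^ 2 * ∑ x, ∑ y, ∑ z, P x y z ^ 2 := by
        simp only [hT, tri, Finset.mul_sum, ← Finset.sum_sub_distrib, ← Finset.sum_add_distrib]
        exact Finset.sum_congr rfl fun x _ => Finset.sum_congr rfl fun y _ =>
          Finset.sum_congr rfl fun z _ => by simp only [hP]; ring
      have e2 : ∑ x, ∑ y, ∑ z, P x y z ^ 2 ≤ (Fintype.card V : ℝ) ^ 3 := by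
        have : (Fintype.card V : ℝ) ^ 3 = ∑ _x : V, ∑ _y : V, ∑ _z : V, (1 : ℝ) := by
          simp; ring
        rw [this]
        refine Finset.sum_le_sum fun x _ => Finset.sum_le_sum fun y _ =>
          Finset.sum_le_sum fun z _ => ?_
        rw [← sq_abs, hP]
        simp only [abs_mul]
        exact pow_le_one₀ (by positivity) (mul_le_one₀ (mul_le_one₀ (abs_sind_le_one _ _)
          (abs_nonneg _) (abs_sind_le_one _ _)) (abs_nonneg _) (abs_sind_le_one _ _))
      have e3 : e ^ 2 * ∑ x, ∑ y, ∑ z, P x y z ^ 2 ≤ e ^ 2 * (Fintype.card V : ℝ) ^ 3 := by gcongr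
      have e4 : e * (e * (Fintype.card V : ℝ) ^ 3) ≤ e * |T| := by gcongr
      push_cast at hK
      rw [e1, hc, hcT]
      nlinarith
    obtain ⟨L, hL, lab, σ, hcard, hσ⟩ := ih _ hsq
    classical
    refine ⟨Bool × Bool × Bool × L, inferInstance,
      fun v => (decide (v ∈ X), decide (v ∈ Y), decide (v ∈ Z), lab v),
      fun a b d => σ a.2.2.2 b.2.2.2 d.2.2.2 + c * (pind (a.1 = true) * pind (b.2.1 = true) *
        pind (d.2.2.1 = true)), ?_, fun X' Y' Z' => ?_⟩
    · simp only [Fintype.card_prod, Fintype.card_bool]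
      rw [pow_succ]
      omega
    · convert hσ X' Y' Z' using 3
      ext x y z
      simp only [decide_eq_true_eq, hP, sind]
      ring

section
variable {V L : Type*} [Fintype V]

open Classical in
/-- The normalised indicator of a label class. -/
noncomputable def classAvg (lab : V → L) (l : L) (x : V) : ℝ :=
  pind (lab x = l) / (Finset.univ.filter fun v => lab v = l).card

lemma classAvg_nonneg (lab : V → L) (l : L) (x : V) : 0 ≤ classAvg lab l x :=
  div_nonneg (pind_nonneg _) (Nat.cast_nonneg _)

lemma card_labelClass_pos (lab : V → L) (x : V) [DecidablePred fun v => lab v = lab x] :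
    (0 : ℝ) < (Finset.univ.filter fun v => lab v = lab x).card := by
  exact_mod_cast Finset.card_pos.2 ⟨x, by simp⟩

lemma sum_classAvg (lab : V → L) (v : V) : ∑ x, classAvg lab (lab v) x = 1 := by
  classical
  have h := card_labelClass_pos lab v
  simp only [classAvg]
  rw [← Finset.sum_div, div_eq_one_iff_eq (by convert h.ne')]
  simp [pind, Finset.sum_boole]

lemma sum_classAvg_label (lab : V → L) (v : V) : ∑ x, classAvg lab (lab x) v = 1 := by
  classical
  rw [← sum_classAvg lab v]
  refine Finset.sum_congr rfl fun x _ => ?_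
  by_cases hx : lab v = lab x
  · simp [classAvg, hx]
  · simp [classAvg, hx, pind, Ne.symm hx]

lemma tri_sum_weights {α β γ ι : Type*} [Fintype α] [Fintype β] [Fintype γ] [Fintype ι]
    (K : α → β → γ → ℝ) (f : ι → ℝ) (a : ι → α → ℝ) (g : β → ℝ) (h : γ → ℝ) :
    ∑ i, f i * tri K (a i) g h = tri K (fun x => ∑ i, f i * a i x) g h := by
  simp only [tri_eq_first, Finset.mul_sum]
  rw [Finset.sum_comm]
  refine Finset.sum_congr rfl fun x _ => Finset.sum_congr rfl fun i _ => by ring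

lemma tri_classAvg (K : V → V → V → ℝ) (lab : V → L) (f g h : V → ℝ) :
    tri (fun x y z => tri K (classAvg lab (lab x)) (classAvg lab (lab y)) (classAvg lab (lab z)))
      f g h = tri K (fun v => ∑ x, f x * classAvg lab (lab x) v)
        (fun v => ∑ x, g x * classAvg lab (lab x) v)
        (fun v => ∑ x, h x * classAvg lab (lab x) v) := by
  rw [← tri_sum_weights]
  conv_rhs =>
    enter [2, x]
    rw [tri_rotate, ← tri_sum_weights]
    enter [2, 2, y]
    rw [tri_rotate, ← tri_sum_weights]
  simp only [tri, Finset.mul_sum]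
  refine Finset.sum_congr rfl fun x _ => Finset.sum_congr rfl fun y _ =>
    Finset.sum_congr rfl fun z _ => ?_
  conv_lhs => rw [← tri, tri_rotate, tri_rotate]
  simp only [tri, Finset.sum_mul]
  refine Finset.sum_congr rfl fun x' _ => Finset.sum_congr rfl fun y' _ =>
    Finset.sum_congr rfl fun z' _ => by ring

lemma abs_sum_mul_classAvg_le {f : V → ℝ} (hf : ∀ x, |f x| ≤ 1) (lab : V → L) (v : V) :
    |∑ x, f x * classAvg lab (lab x) v| ≤ 1 := by
  refine (Finset.abs_sum_le_sum_abs _ _).trans ?_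
  rw [← sum_classAvg_label lab v]
  refine Finset.sum_le_sum fun x _ => ?_
  rw [abs_mul, abs_of_nonneg (classAvg_nonneg lab (lab x) v)]
  exact mul_le_of_le_one_left (classAvg_nonneg _ _ _) (hf x)

lemma sum_classAvg_le_one (lab : V → L) (l : L) : ∑ x, classAvg lab l x ≤ 1 := by
  by_cases h : ∃ v, lab v = l
  · obtain ⟨v, rfl⟩ := h
    exact (sum_classAvg lab v).le
  · push Not at h
    simp [classAvg, pind, h]

lemma abs_tri_le_of_kernel {α β γ : Type*} [Fintype α] [Fintype β] [Fintype γ]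
    {K : α → β → γ → ℝ} (hK : ∀ x y z, |K x y z| ≤ 1) (f : α → ℝ) (g : β → ℝ) (h : γ → ℝ) :
    |tri K f g h| ≤ (∑ x, |f x|) * (∑ y, |g y|) * ∑ z, |h z| := by
  have h1 : (∑ x, |f x|) * (∑ y, |g y|) * ∑ z, |h z| =
      ∑ x, ∑ y, ∑ z, |f x| * |g y| * |h z| := by
    simp only [← Finset.mul_sum, ← Finset.sum_mul]
  rw [h1]
  refine (Finset.abs_sum_le_sum_abs _ _).trans (Finset.sum_le_sum fun x _ => ?_)
  refine (Finset.abs_sum_le_sum_abs _ _).trans (Finset.sum_le_sum fun y _ => ?_)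
  refine (Finset.abs_sum_le_sum_abs _ _).trans (Finset.sum_le_sum fun z _ => ?_)
  rw [abs_mul, abs_mul, abs_mul]
  exact mul_le_of_le_one_left (by positivity) (hK x y z)

lemma abs_tri_classAvg_le_one {K : V → V → V → ℝ} (hK : ∀ x y z, |K x y z| ≤ 1) (lab : V → L)
    (a b c : L) : |tri K (classAvg lab a) (classAvg lab b) (classAvg lab c)| ≤ 1 := by
  refine (abs_tri_le_of_kernel hK _ _ _).trans ?_
  simp only [abs_of_nonneg (classAvg_nonneg lab _ _)]
  have h0 : ∀ l, 0 ≤ ∑ x, classAvg lab l x :=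
    fun l => Finset.sum_nonneg fun _ _ => classAvg_nonneg _ _ _
  exact mul_le_one₀ (mul_le_one₀ (sum_classAvg_le_one _ _) (h0 _) (sum_classAvg_le_one _ _))
    (h0 _) (sum_classAvg_le_one _ _)

lemma tri_label_classAvg (σ : L → L → L → ℝ) (lab : V → L) (a b c : V) :
    tri (fun x y z => σ (lab x) (lab y) (lab z)) (classAvg lab (lab a)) (classAvg lab (lab b))
      (classAvg lab (lab c)) = σ (lab a) (lab b) (lab c) := by
  have h : ∀ x y z, σ (lab x) (lab y) (lab z) *
      (classAvg lab (lab a) x * classAvg lab (lab b) y * classAvg lab (lab c) z) =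
      σ (lab a) (lab b) (lab c) *
      (classAvg lab (lab a) x * classAvg lab (lab b) y * classAvg lab (lab c) z) := by
    intro x y z
    by_cases hx : lab x = lab a
    · by_cases hy : lab y = lab b
      · by_cases hz : lab z = lab c
        · rw [hx, hy, hz]
        · simp [classAvg, pind, hz]
      · simp [classAvg, pind, hy]
    · simp [classAvg, pind, hx]
  simp only [tri, h, ← Finset.mul_sum, sum_classAvg, mul_one]

end

/-- Every bounded kernel is close, in cut norm, to a bounded kernel depending only on boundedly
many labels. -/
lemma exists_bounded_label_approx {e : ℝ} (he : 0 < e) : ∃ q : ℕ, ∀ (V : Type) [Fintype V]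
    (K : V → V → V → ℝ), (∀ x y z, |K x y z| ≤ 1) →
    ∃ (L : Type) (_ : Fintype L) (lab : V → L) (κ : L → L → L → ℝ), Fintype.card L ≤ q ∧
      (∀ a b c, |κ a b c| ≤ 1) ∧
      ∀ f g h : V → ℝ, (∀ x, |f x| ≤ 1) → (∀ x, |g x| ≤ 1) → (∀ x, |h x| ≤ 1) →
        |tri (fun x y z => K x y z - κ (lab x) (lab y) (lab z)) f g h| ≤
          e * (Fintype.card V : ℝ) ^ 3 := by
  obtain ⟨k, hk⟩ := exists_nat_ge (1 / (e / 16) ^ 2)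
  refine ⟨8 ^ k, fun V _ K hK => ?_⟩
  have hk1 : 1 ≤ k * (e / 16) ^ 2 := by rwa [div_le_iff₀ (by positivity)] at hk
  have hsq : ∑ x, ∑ y, ∑ z, K x y z ^ 2 ≤ k * ((e / 16) ^ 2 * (Fintype.card V : ℝ) ^ 3) := by
    have h1 : ∑ x, ∑ y, ∑ z, K x y z ^ 2 ≤ ∑ _x : V, ∑ _y : V, ∑ _z : V, (1 : ℝ) := by
      refine Finset.sum_le_sum fun x _ => Finset.sum_le_sum fun y _ =>
        Finset.sum_le_sum fun z _ => ?_
      rw [← sq_abs]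
      exact pow_le_one₀ (abs_nonneg _) (hK x y z)
    have h2 : ∑ _x : V, ∑ _y : V, ∑ _z : V, (1 : ℝ) = (Fintype.card V : ℝ) ^ 3 := by
      simp; ring
    have h3 := mul_le_mul_of_nonneg_right hk1 (by positivity : 0 ≤ (Fintype.card V : ℝ) ^ 3)
    linarith
  obtain ⟨L, hL, lab, σ, hcard, hcut⟩ := exists_label_approx (by positivity) k K hsq
  refine ⟨L, hL, lab, fun a b c => tri K (classAvg lab a) (classAvg lab b) (classAvg lab c),
    hcard, abs_tri_classAvg_le_one hK lab, fun f g h hf hg hh => ?_⟩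
  have key : tri (fun x y z => K x y z - tri K (classAvg lab (lab x)) (classAvg lab (lab y))
      (classAvg lab (lab z))) f g h =
      tri (fun x y z => K x y z - σ (lab x) (lab y) (lab z)) f g h -
      tri (fun x y z => tri (fun x y z => K x y z - σ (lab x) (lab y) (lab z))
        (classAvg lab (lab x)) (classAvg lab (lab y)) (classAvg lab (lab z))) f g h := by
    rw [← tri_sub]
    congr 1
    ext x y z
    rw [tri_sub, tri_label_classAvg]
    ring
  rw [key, tri_classAvg]
  have h1 := abs_tri_le_of_sets hcut hf hg hh
  have h2 := abs_tri_le_of_sets hcut (abs_sum_mul_classAvg_le hf lab)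
    (abs_sum_mul_classAvg_le hg lab) (abs_sum_mul_classAvg_le hh lab)
  refine (abs_sub _ _).trans ?_
  linarith

/-- Duplicate the last two arguments of a kernel. -/
def dup {α β γ : Type*} (K : α → β → γ → ℝ) : β × β → γ × γ → α → ℝ :=
  fun y z x => K x y.1 z.1 * K x y.2 z.2

section
variable {α β γ : Type*} [Fintype α] [Fintype β] [Fintype γ] {K : α → β → γ → ℝ}

lemma abs_dup_le {α β γ : Type*} {K : α → β → γ → ℝ} {B : ℝ}
    (hK : ∀ x y z, |K x y z| ≤ B) (y : β × β) (z : γ × γ) (x : α) :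
    |dup K y z x| ≤ B ^ 2 := by
  rw [dup, abs_mul, sq]
  have := (abs_nonneg _).trans (hK x y.1 z.1)
  gcongr <;> exact hK _ _ _

lemma tri_sq_le (f : α → ℝ) (g : β → ℝ) (h : γ → ℝ) (hf : ∀ x, |f x| ≤ 1) :
    tri K f g h ^ 2 ≤ Fintype.card α *
      tri (dup K) (fun y => g y.1 * g y.2) (fun z => h z.1 * h z.2) (fun _ => 1) := by
  rw [tri_eq_first]
  have h1 := Finset.sum_mul_sq_le_sq_mul_sq Finset.univ
    (fun x => ∑ y, ∑ z, K x y z * (g y * h z)) f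
  have h2 : ∑ x, f x ^ 2 ≤ Fintype.card α := by
    have : (Fintype.card α : ℝ) = ∑ _x : α, (1 : ℝ) := by simp
    rw [this]
    refine Finset.sum_le_sum fun x _ => ?_
    rw [← sq_abs]
    exact pow_le_one₀ (abs_nonneg _) (hf x)
  have h3 : ∑ x, (∑ y, ∑ z, K x y z * (g y * h z)) ^ 2 =
      tri (dup K) (fun y => g y.1 * g y.2) (fun z => h z.1 * h z.2) (fun _ => 1) := by
    rw [← tri_rotate (fun x y z => dup K y z x)]
    simp only [tri, dup, Fintype.sum_prod_type, one_mul]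
    refine Finset.sum_congr rfl fun x _ => ?_
    rw [sq, Finset.sum_mul_sum]
    refine Finset.sum_congr rfl fun y _ => Finset.sum_congr rfl fun y' _ => ?_
    rw [Finset.sum_mul_sum]
    refine Finset.sum_congr rfl fun z _ => Finset.sum_congr rfl fun z' _ => ?_
    ring
  rw [← h3, mul_comm]
  exact h1.trans (mul_le_mul_of_nonneg_left h2 (Finset.sum_nonneg fun _ _ => sq_nonneg _))

lemma abs_tri_dup_le {B E : ℝ} (hK : ∀ x y z, |K x y z| ≤ B)
    (hE : ∀ (f : α → ℝ) (g : β → ℝ) (h : γ → ℝ), (∀ x, |f x| ≤ 1) → (∀ x, |g x| ≤ 1) →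
      (∀ x, |h x| ≤ 1) → |tri K f g h| ≤ E) (hB : 0 < B)
    (f : β × β → ℝ) (g : γ × γ → ℝ) (h : α → ℝ) (hf : ∀ x, |f x| ≤ 1) (hg : ∀ x, |g x| ≤ 1)
    (hh : ∀ x, |h x| ≤ 1) :
    |tri (dup K) f g h| ≤ Fintype.card β * Fintype.card γ * (B * E) := by
  have key : tri (dup K) f g h = ∑ y', ∑ z', B * tri K (fun x => B⁻¹ * K x y' z' * h x)
      (fun y => f (y, y')) (fun z => g (z, z')) := by
    rw [← tri_rotate (fun x y z => dup K y z x)]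
    simp only [tri, dup, Fintype.sum_prod_type, Finset.mul_sum]
    have h1 : ∀ F : α → β → β → γ → γ → ℝ, ∑ x, ∑ y, ∑ y', ∑ z, ∑ z', F x y y' z z' =
        ∑ y', ∑ z', ∑ x, ∑ y, ∑ z, F x y y' z z' := by
      intro F
      rw [Finset.sum_congr rfl fun x _ => Finset.sum_comm, Finset.sum_comm]
      refine Finset.sum_congr rfl fun y' _ => ?_
      rw [Finset.sum_congr rfl fun x _ => Finset.sum_congr rfl fun y _ => Finset.sum_comm,
        Finset.sum_congr rfl fun x _ => Finset.sum_comm, Finset.sum_comm]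
    rw [h1]
    refine Finset.sum_congr rfl fun y' _ => Finset.sum_congr rfl fun z' _ =>
      Finset.sum_congr rfl fun x _ => Finset.sum_congr rfl fun y _ =>
      Finset.sum_congr rfl fun z _ => ?_
    field_simp
  rw [key]
  have : (Fintype.card β * Fintype.card γ * (B * E) : ℝ) = ∑ _y : β, ∑ _z : γ, B * E := by
    simp; ring
  rw [this]
  refine (Finset.abs_sum_le_sum_abs _ _).trans (Finset.sum_le_sum fun y _ => ?_)
  refine (Finset.abs_sum_le_sum_abs _ _).trans (Finset.sum_le_sum fun z _ => ?_)
  rw [abs_mul, abs_of_pos hB]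
  gcongr
  refine hE _ _ _ (fun x => ?_) (fun _ => hf _) fun _ => hg _
  rw [abs_mul, abs_mul, abs_of_pos (inv_pos.2 hB)]
  refine mul_le_one₀ ?_ (abs_nonneg _) (hh x)
  rw [inv_mul_le_iff₀ hB, mul_one]
  exact hK _ _ _

end

/-- The sum obtained from a kernel by three duplications. -/
def boxSum {V : Type*} [Fintype V] (K : V → V → V → ℝ) : ℝ :=
  tri (dup (dup (dup K))) (fun _ => 1) (fun _ => 1) (fun _ => 1)

section
variable {V : Type*} [Fintype V] {K : V → V → V → ℝ}

lemma tri_pow_eight_le (f g h : V → ℝ) (hf : ∀ x, |f x| ≤ 1) (hg : ∀ x, |g x| ≤ 1)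
    (hh : ∀ x, |h x| ≤ 1) : tri K f g h ^ 8 ≤ (Fintype.card V : ℝ) ^ 12 * boxSum K := by
  have hmul : ∀ {ι : Type _} {f : ι → ℝ}, (∀ x, |f x| ≤ 1) → ∀ p : ι × ι, |f p.1 * f p.2| ≤ 1 := by
    intro ι f hf p
    rw [abs_mul]
    exact mul_le_one₀ (hf _) (abs_nonneg _) (hf _)
  have h1 := tri_sq_le (K := K) f g h hf
  have h2 := tri_sq_le (K := dup K) _ (fun z => h z.1 * h z.2) (fun _ => 1) (hmul hg)
  have h3 := tri_sq_le (K := dup (dup K)) _ (fun _ => 1 * 1) (fun _ => 1) (hmul (hmul hh))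
  simp only [mul_one, Fintype.card_prod] at h2 h3
  push_cast at h2 h3
  change _ ≤ _ * boxSum K at h3
  have hn : (0 : ℝ) ≤ Fintype.card V := Nat.cast_nonneg _
  generalize (Fintype.card V : ℝ) = n at *
  generalize tri K f g h = T at *
  generalize tri (dup K) _ _ _ = T1 at *
  generalize tri (dup (dup K)) _ _ _ = T2 at *
  calc T ^ 8 = ((T ^ 2) ^ 2) ^ 2 := by ring
    _ ≤ ((n * T1) ^ 2) ^ 2 := by gcongr
    _ = (n ^ 2 * T1 ^ 2) ^ 2 := by ring
    _ ≤ (n ^ 2 * (n * n * T2)) ^ 2 := by gcongr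
    _ = n ^ 8 * T2 ^ 2 := by ring
    _ ≤ n ^ 8 * (n * n * (n * n) * boxSum K) := by gcongr
    _ = n ^ 12 * boxSum K := by ring

lemma boxSum_le {E : ℝ} (hK : ∀ x y z, |K x y z| ≤ 2)
    (hE : ∀ (f g h : V → ℝ), (∀ x, |f x| ≤ 1) → (∀ x, |g x| ≤ 1) →
      (∀ x, |h x| ≤ 1) → |tri K f g h| ≤ E) :
    boxSum K ≤ 128 * E * (Fintype.card V : ℝ) ^ 9 := by
  have h1 := abs_tri_dup_le hK hE (by norm_num)
  have h2 := abs_tri_dup_le (abs_dup_le hK) h1 (by norm_num)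
  have h3 := abs_tri_dup_le (abs_dup_le (abs_dup_le hK)) h2 (by norm_num) (fun _ => 1) (fun _ => 1)
    (fun _ => 1) (by simp) (by simp) (by simp)
  refine (le_abs_self _).trans (h3.trans (le_of_eq ?_))
  simp only [Fintype.card_prod]
  push_cast
  ring

end

section
variable {I J V : Type*} [Fintype I] [Fintype J] [Fintype V]

lemma sum_comp_injective [DecidableEq I] [DecidableEq J] {σ : I → J} (hσ : Function.Injective σ)
    (G : (I → V) → ℝ) :
    (∑ s : J → V, G (s ∘ σ)) * (Fintype.card V : ℝ) ^ Fintype.card I =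
      (Fintype.card V : ℝ) ^ Fintype.card J * ∑ v, G v := by
  classical
  let e1 : (J → V) ≃ ({j // j ∈ Set.range σ} → V) × ({j // j ∉ Set.range σ} → V) :=
    Equiv.piEquivPiSubtypeProd (fun j => j ∈ Set.range σ) fun _ => V
  let e2 : ({j // j ∈ Set.range σ} → V) ≃ (I → V) :=
    Equiv.arrowCongr (Equiv.ofInjective σ hσ).symm (Equiv.refl V)
  let e3 : (J → V) ≃ (I → V) × ({j // j ∉ Set.range σ} → V) := e1.trans (e2.prodCongr (Equiv.refl _))
  have h3 : ∀ s, (e3 s).1 = s ∘ σ := by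
    intro s
    ext i
    simp [e3, e1, e2, Equiv.piEquivPiSubtypeProd, Equiv.arrowCongr]
  have h1 : ∑ s : J → V, G (s ∘ σ) = ∑ p : (I → V) × ({j // j ∉ Set.range σ} → V), G p.1 :=
    Fintype.sum_equiv e3 _ _ fun s => by rw [h3]
  have h4 := Fintype.card_congr e3
  rw [Fintype.card_prod, Fintype.card_fun, Fintype.card_fun] at h4
  rw [h1, Fintype.sum_prod_type]
  simp only [Finset.sum_const, Finset.card_univ, nsmul_eq_mul]
  rw [← Finset.mul_sum]
  have h5 : (Fintype.card V : ℝ) ^ Fintype.card J = (Fintype.card V : ℝ) ^ Fintype.card I *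
      Fintype.card ({j // j ∉ Set.range σ} → V) := by
    exact_mod_cast h4
  rw [h5]
  ring

lemma sum_not_injective_le [DecidableEq I] [Nonempty J] :
    (∑ σ : I → J, pind (¬ Function.Injective σ)) * Fintype.card J ≤
      (Fintype.card I : ℝ) ^ 2 * (Fintype.card J : ℝ) ^ Fintype.card I := by
  classical
  have h1 : ∀ σ : I → J, pind (¬ Function.Injective σ) ≤
      ∑ i, ∑ j, if i = j then 0 else pind (σ i = σ j) := by
    intro σ
    have h0 : ∀ i j, 0 ≤ if i = j then 0 else pind (σ i = σ j) := by
      intro i j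
      split_ifs
      exacts [le_rfl, pind_nonneg _]
    by_cases hσ : Function.Injective σ
    · simp only [pind, hσ, not_true_eq_false, if_false]
      exact Finset.sum_nonneg fun i _ => Finset.sum_nonneg fun j _ => h0 i j
    · have hσ' := hσ
      simp only [Function.Injective, not_forall] at hσ
      obtain ⟨i, j, hij, hne⟩ := hσ
      refine (le_of_eq ?_).trans ((Finset.single_le_sum (f := fun j => if i = j then 0 else
        pind (σ i = σ j)) (fun j _ => h0 i j) (Finset.mem_univ j)).trans
        (Finset.single_le_sum (f := fun i => ∑ j, if i = j then 0 else pind (σ i = σ j))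
        (fun i _ => Finset.sum_nonneg fun j _ => h0 i j) (Finset.mem_univ i)))
      simp [pind, hσ', hne, hij]
  have hJ : (0 : ℝ) < Fintype.card J := by exact_mod_cast Fintype.card_pos
  have h2 : ∀ i j : I, i ≠ j → (∑ σ : I → J, pind (σ i = σ j)) * Fintype.card J =
      (Fintype.card J : ℝ) ^ Fintype.card I := by
    intro i j hij
    have hinj : Function.Injective ![i, j] := by
      intro a b
      fin_cases a <;> fin_cases b <;> simp [hij, hij.symm]
    have h := sum_comp_injective (V := J) hinj fun v => pind (v 0 = v 1)
    have h' : ∑ v : Fin 2 → J, pind (v 0 = v 1) = Fintype.card J := by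
      rw [Fintype.sum_equiv (finTwoArrowEquiv J) (fun v => pind (v 0 = v 1))
        (fun p : J × J => pind (p.1 = p.2)) (fun _ => rfl), Fintype.sum_prod_type]
      simp [pind]
    rw [h'] at h
    simp only [Function.comp_apply, Matrix.cons_val_zero, Matrix.cons_val_one,
      Fintype.card_fin] at h
    have : (∑ σ : I → J, pind (σ i = σ j)) * Fintype.card J * Fintype.card J =
      (Fintype.card J : ℝ) ^ Fintype.card I * Fintype.card J := by rw [← h]; ring
    exact mul_right_cancel₀ hJ.ne' this
  calc (∑ σ : I → J, pind (¬ Function.Injective σ)) * Fintype.card J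
      ≤ (∑ σ : I → J, ∑ i, ∑ j, if i = j then 0 else pind (σ i = σ j)) * Fintype.card J := by
        gcongr with σ
        exact h1 σ
    _ = ∑ i, ∑ j, (∑ σ : I → J, if i = j then 0 else pind (σ i = σ j)) * Fintype.card J := by
        rw [Finset.sum_comm, Finset.sum_mul]
        refine Finset.sum_congr rfl fun i _ => ?_
        rw [Finset.sum_comm, Finset.sum_mul]
    _ ≤ ∑ _i : I, ∑ _j : I, (Fintype.card J : ℝ) ^ Fintype.card I := by
        refine Finset.sum_le_sum fun i _ => Finset.sum_le_sum fun j _ => ?_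
        by_cases hij : i = j
        · simp [hij]
        · simp only [hij, if_false]
          exact (h2 i j hij).le
    _ = _ := by simp; ring

lemma sum_abs_sum_le [DecidableEq J] {φ : V → ℝ} (hφ : ∀ v, |φ v| ≤ 1) (h0 : ∑ v, φ v = 0) :
    ∑ s : J → V, |∑ i, φ (s i)| ≤
      √(Fintype.card J) * (Fintype.card V : ℝ) ^ Fintype.card J := by
  have hsq : ∑ s : J → V, |∑ i, φ (s i)| ^ 2 ≤
      Fintype.card J * (Fintype.card V : ℝ) ^ Fintype.card J := by
    have h1 : ∑ s : J → V, |∑ i, φ (s i)| ^ 2 = ∑ i, ∑ j, ∑ s : J → V, φ (s i) * φ (s j) := by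
      rw [Finset.sum_congr rfl fun i _ => Finset.sum_comm, Finset.sum_comm]
      refine Finset.sum_congr rfl fun s _ => ?_
      rw [sq_abs, sq, Finset.sum_mul_sum]
    rw [h1]
    have h2 : ∀ i j : J, ∑ s : J → V, φ (s i) * φ (s j) ≤
        if i = j then (Fintype.card V : ℝ) ^ Fintype.card J else 0 := by
      intro i j
      split_ifs with hij
      · have : (Fintype.card V : ℝ) ^ Fintype.card J = ∑ _s : J → V, (1 : ℝ) := by simp
        rw [this]
        refine Finset.sum_le_sum fun s _ => (le_abs_self _).trans ?_
        rw [abs_mul]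
        exact mul_le_one₀ (hφ _) (abs_nonneg _) (hφ _)
      · have hinj : Function.Injective ![i, j] := by
          intro a b
          fin_cases a <;> fin_cases b <;> simp [hij, Ne.symm hij]
        have h := sum_comp_injective (V := V) hinj fun v => φ (v 0) * φ (v 1)
        rw [Fintype.sum_equiv (finTwoArrowEquiv V) (fun v => φ (v 0) * φ (v 1))
          (fun p : V × V => φ p.1 * φ p.2) (fun _ => rfl), Fintype.sum_prod_type] at h
        simp only [← Finset.mul_sum, h0, mul_zero, Finset.sum_const_zero] at h
        rcases mul_eq_zero.1 h with h | h
        · exact h.le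
        · have hV : Fintype.card V = 0 := by
            simpa using h
          have := Fintype.card_eq_zero_iff.1 hV
          have : IsEmpty (J → V) := ⟨fun s => isEmptyElim (s i)⟩
          simp
    refine (Finset.sum_le_sum fun i _ => Finset.sum_le_sum fun j _ => h2 i j).trans (le_of_eq ?_)
    simp
  have h3 := Finset.sum_mul_sq_le_sq_mul_sq Finset.univ (fun s : J → V => |∑ i, φ (s i)|)
    fun _ => 1
  simp only [mul_one, one_pow, Finset.sum_const, Finset.card_univ, Fintype.card_fun,
    nsmul_eq_mul, Nat.cast_pow] at h3
  rw [← pow_le_pow_iff_left₀ (Finset.sum_nonneg fun _ _ => abs_nonneg _) (by positivity)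
    two_ne_zero]
  refine h3.trans ((mul_le_mul_of_nonneg_right hsq (by positivity)).trans (le_of_eq ?_))
  rw [mul_pow, Real.sq_sqrt (Nat.cast_nonneg _)]
  ring

end

section
variable {V : Type*}

/-- The summand of `boxSum`, as a function of twelve vertices. -/
def boxTerm (K : V → V → V → ℝ) (v : Fin 12 → V) : ℝ :=
  dup (dup (dup K)) ((v 0, v 1), (v 2, v 3)) ((v 4, v 5), (v 6, v 7)) ((v 8, v 9), (v 10, v 11))

/-- Twelve vertices as a triple of quadruples. -/
def twelveEquiv (V : Type*) : (Fin 12 → V) ≃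
    ((V × V) × (V × V)) × ((V × V) × (V × V)) × ((V × V) × (V × V)) where
  toFun v := (((v 0, v 1), (v 2, v 3)), ((v 4, v 5), (v 6, v 7)), ((v 8, v 9), (v 10, v 11)))
  invFun p := ![p.1.1.1, p.1.1.2, p.1.2.1, p.1.2.2, p.2.1.1.1, p.2.1.1.2, p.2.1.2.1, p.2.1.2.2,
    p.2.2.1.1, p.2.2.1.2, p.2.2.2.1, p.2.2.2.2]
  left_inv v := by
    funext i
    fin_cases i <;> rfl
  right_inv _ := rfl

lemma boxSum_eq [Fintype V] (K : V → V → V → ℝ) : boxSum K = ∑ v, boxTerm K v := by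
  rw [Fintype.sum_equiv (twelveEquiv V) (boxTerm K)
    (fun p => dup (dup (dup K)) p.1 p.2.1 p.2.2) (fun _ => rfl), Fintype.sum_prod_type]
  simp only [boxSum, tri, mul_one]
  exact Finset.sum_congr rfl fun x _ => (Fintype.sum_prod_type
    fun p : ((V × V) × (V × V)) × ((V × V) × (V × V)) => dup (dup (dup K)) x p.1 p.2).symm

lemma abs_boxTerm_le {K : V → V → V → ℝ} (hK : ∀ x y z, |K x y z| ≤ 2) (v : Fin 12 → V) :
    |boxTerm K v| ≤ 256 :=
  (abs_dup_le (abs_dup_le (abs_dup_le hK)) _ _ _).trans (by norm_num)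

lemma boxSum_nonneg [Fintype V] [Nonempty V] (K : V → V → V → ℝ) : 0 ≤ boxSum K := by
  have h := tri_pow_eight_le (K := K) (fun _ => 1) (fun _ => 1) (fun _ => 1) (by simp) (by simp)
    (by simp)
  have h0 : (0 : ℝ) < (Fintype.card V : ℝ) ^ 12 := by
    have : 0 < Fintype.card V := Fintype.card_pos
    positivity
  exact nonneg_of_mul_nonneg_right ((Even.pow_nonneg (by decide) _).trans h) h0

lemma sum_boxSum_comp_le [Fintype V] [Nonempty V] {J : Type*} [Fintype J] [DecidableEq J]
    [Nonempty J] {K : V → V → V → ℝ} (hK : ∀ x y z, |K x y z| ≤ 2) :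
    ∑ s : J → V, boxSum (fun i j k => K (s i) (s j) (s k)) ≤
      (Fintype.card V : ℝ) ^ Fintype.card J * ((Fintype.card J : ℝ) ^ 12 *
        (boxSum K / (Fintype.card V : ℝ) ^ 12 + 73728 / Fintype.card J)) := by
  have hV : (0 : ℝ) < Fintype.card V := by exact_mod_cast Fintype.card_pos
  have hJ : (0 : ℝ) < Fintype.card J := by exact_mod_cast Fintype.card_pos
  set N : ℝ := (Fintype.card V : ℝ) ^ Fintype.card J with hN
  have hNs : N = ∑ _s : J → V, (1 : ℝ) := by simp [hN]
  set T := boxSum K / (Fintype.card V : ℝ) ^ 12 with hT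
  have hT0 : 0 ≤ T := div_nonneg (boxSum_nonneg K) (by positivity)
  have h1 : ∑ s : J → V, boxSum (fun i j k => K (s i) (s j) (s k)) =
      ∑ σ : Fin 12 → J, ∑ s : J → V, boxTerm K (s ∘ σ) := by
    rw [Finset.sum_comm]
    exact Finset.sum_congr rfl fun s _ => boxSum_eq _
  have h2 : ∀ σ : Fin 12 → J, ∑ s : J → V, boxTerm K (s ∘ σ) ≤
      N * T + N * (512 * pind (¬ Function.Injective σ)) := by
    intro σ
    have hN0 : 0 ≤ N := by positivity
    by_cases hσ : Function.Injective σ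
    · have h := sum_comp_injective (V := V) hσ (boxTerm K)
      rw [← boxSum_eq, Fintype.card_fin] at h
      have : ∑ s : J → V, boxTerm K (s ∘ σ) = N * T := by
        rw [hT, ← mul_div_assoc, eq_div_iff (by positivity), h]
      simp [this, pind, hσ]
    · have : ∑ s : J → V, boxTerm K (s ∘ σ) ≤ N * 256 := by
        rw [hNs, Finset.sum_mul]
        refine Finset.sum_le_sum fun s _ => ?_
        rw [one_mul]
        exact (le_abs_self _).trans (abs_boxTerm_le hK _)
      simp only [pind, hσ, not_false_eq_true, if_true]
      nlinarith [mul_nonneg hN0 hT0]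
  rw [h1]
  refine (Finset.sum_le_sum fun σ _ => h2 σ).trans ?_
  rw [Finset.sum_add_distrib, ← Finset.mul_sum, ← Finset.mul_sum, ← Finset.mul_sum]
  have h3 := sum_not_injective_le (I := Fin 12) (J := J)
  simp only [Fintype.card_fin] at h3
  have h4 : ∑ σ : Fin 12 → J, pind (¬ Function.Injective σ) ≤
      144 * (Fintype.card J : ℝ) ^ 12 / Fintype.card J := by
    rw [le_div_iff₀ hJ]
    refine h3.trans (le_of_eq ?_)
    norm_num
  simp only [Finset.sum_const, Finset.card_univ, Fintype.card_fun, Fintype.card_fin,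
    nsmul_eq_mul, Nat.cast_pow]
  have h5 : N * (512 * ∑ σ : Fin 12 → J, pind (¬ Function.Injective σ)) ≤
      N * (512 * (144 * (Fintype.card J : ℝ) ^ 12 / Fintype.card J)) := by gcongr
  refine (add_le_add le_rfl h5).trans (le_of_eq ?_)
  ring

end

section
variable {V L : Type*} [Fintype L]

/-- The number of elements of `U` with a given label. -/
noncomputable def labelCount (U : Finset V) (a : V → L) (l : L) : ℝ := ∑ i ∈ U, pind (a i = l)

lemma labelCount_nonneg {V L : Type*} (U : Finset V) (a : V → L) (l : L) : 0 ≤ labelCount U a l :=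
  Finset.sum_nonneg fun _ _ => pind_nonneg _

lemma sum_labelCount_mul (U : Finset V) (a : V → L) (F : L → ℝ) :
    ∑ l, F l * labelCount U a l = ∑ i ∈ U, F (a i) := by
  simp only [labelCount, Finset.mul_sum]
  rw [Finset.sum_comm]
  refine Finset.sum_congr rfl fun i _ => ?_
  rw [Finset.sum_eq_single (a i) (fun l _ hl => by simp [pind, hl.symm]) (by simp)]
  simp [pind]

lemma sum_labelCount (U : Finset V) (a : V → L) : ∑ l, labelCount U a l = U.card := by
  have := sum_labelCount_mul U a fun _ => 1
  simpa using this

lemma tri_labelCount (κ : L → L → L → ℝ) (U : Finset V) (a : V → L) :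
    tri κ (labelCount U a) (labelCount U a) (labelCount U a) =
      ∑ x ∈ U, ∑ y ∈ U, ∑ z ∈ U, κ (a x) (a y) (a z) := by
  rw [tri_eq_first, sum_labelCount_mul U a fun l => ∑ y, ∑ z, κ l y z *
    (labelCount U a y * labelCount U a z)]
  refine Finset.sum_congr rfl fun x _ => ?_
  rw [← sum_labelCount_mul U a fun l => ∑ z ∈ U, κ (a x) l (a z)]
  refine Finset.sum_congr rfl fun y _ => ?_
  rw [← sum_labelCount_mul U a fun l => κ (a x) y l, Finset.sum_mul]
  refine Finset.sum_congr rfl fun z _ => by ring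

lemma abs_tri_sub_tri_le {κ : L → L → L → ℝ} (hκ : ∀ a b c, |κ a b c| ≤ 1) {f g : L → ℝ}
    (hf : ∑ l, |f l| ≤ 1) (hg : ∑ l, |g l| ≤ 1) :
    |tri κ f f f - tri κ g g g| ≤ 3 * ∑ l, |f l - g l| := by
  have key : tri κ f f f - tri κ g g g = tri κ (fun l => f l - g l) f f +
      tri κ g (fun l => f l - g l) f + tri κ g g (fun l => f l - g l) := by
    simp only [tri, ← Finset.sum_add_distrib, ← Finset.sum_sub_distrib]
    refine Finset.sum_congr rfl fun x _ => Finset.sum_congr rfl fun y _ =>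
      Finset.sum_congr rfl fun z _ => by ring
  have h0 : ∀ f : L → ℝ, 0 ≤ ∑ l, |f l| := fun f => Finset.sum_nonneg fun _ _ => abs_nonneg _
  have h1 := (abs_tri_le_of_kernel hκ (fun l => f l - g l) f f).trans
    (mul_le_of_le_one_right (mul_nonneg (h0 _) (h0 _)) hf)
  have h2 := (abs_tri_le_of_kernel hκ g (fun l => f l - g l) f).trans
    (mul_le_of_le_one_right (mul_nonneg (h0 _) (h0 _)) hf)
  have h3 := (abs_tri_le_of_kernel hκ g g (fun l => f l - g l)).trans
    (mul_le_of_le_one_left (h0 _) (mul_le_one₀ hg (h0 _) hg))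
  have h1' := h1.trans (mul_le_of_le_one_right (h0 _) hf)
  have h2' := h2.trans (mul_le_of_le_one_left (h0 _) hg)
  rw [key]
  refine (abs_add_three _ _ _).trans ?_
  linarith

/-- Any set of labelled indices can be mirrored by a vertex set with nearly the same label
frequencies. -/
lemma exists_mirror_set {V L : Type*} [Fintype V] [Nonempty V] {m : ℕ} (hm : 0 < m) (lab : V → L)
    (a : Fin m → L) (U : Finset (Fin m)) : ∃ X : Finset V, ∀ l,
      |labelCount X lab l / Fintype.card V - labelCount U a l / m| ≤
        |labelCount Finset.univ a l / m - labelCount Finset.univ lab l / Fintype.card V| +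
          1 / Fintype.card V := by
  classical
  set n := Fintype.card V with hn
  have hn0 : (0 : ℝ) < n := by exact_mod_cast Fintype.card_pos
  have hm0 : (0 : ℝ) < m := by exact_mod_cast hm
  have hX : ∀ l, ∃ Xl : Finset V, Xl ⊆ Finset.univ.filter (fun v => lab v = l) ∧
      Xl.card = min (Finset.univ.filter fun v => lab v = l).card ⌊labelCount U a l * n / m⌋₊ :=
    fun l => Finset.exists_subset_card_eq (min_le_left _ _)
  choose Xl hXl hcard using hX
  have hcount : ∀ (S : Finset V) l, labelCount S lab l = (S.filter fun v => lab v = l).card := by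
    intro S l
    simp [labelCount, pind, Finset.sum_boole]
  refine ⟨Finset.univ.filter fun v => v ∈ Xl (lab v), fun l => ?_⟩
  have h1 : (Finset.univ.filter fun v => v ∈ Xl (lab v)).filter (fun v => lab v = l) = Xl l := by
    ext v
    simp only [Finset.mem_filter, Finset.mem_univ, true_and]
    constructor
    · rintro ⟨h, rfl⟩
      exact h
    · intro h
      have := (Finset.mem_filter.1 (hXl l h)).2
      exact ⟨this ▸ h, this⟩
  rw [hcount, h1, hcard, hcount]
  set N := (Finset.univ.filter fun v => lab v = l).card
  set u := labelCount U a l with hu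
  have hu0 : 0 ≤ u := labelCount_nonneg _ _ _
  have hM : u ≤ labelCount Finset.univ a l :=
    Finset.sum_le_sum_of_subset_of_nonneg (Finset.subset_univ _) fun _ _ _ => pind_nonneg _
  have hpos : 0 ≤ u * n / m := by positivity
  rcases le_total N ⌊u * n / m⌋₊ with h | h
  · rw [min_eq_left h]
    have h2 : (N : ℝ) ≤ u * n / m := (Nat.cast_le.2 h).trans (Nat.floor_le hpos)
    have h3 : (N : ℝ) / n ≤ u / m := by
      rw [div_le_iff₀ hn0]
      refine h2.trans (le_of_eq (by ring))
    have h4 : u / m ≤ labelCount Finset.univ a l / m := by gcongr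
    rw [abs_of_nonpos (by linarith), abs_of_nonneg (by linarith)]
    have : (0 : ℝ) ≤ 1 / n := by positivity
    linarith
  · rw [min_eq_right h]
    have h2 := Nat.floor_le hpos
    have h3 := Nat.lt_floor_add_one (u * n / m)
    have h4 : (⌊u * n / m⌋₊ : ℝ) / n ≤ u / m := by
      rw [div_le_iff₀ hn0]
      refine h2.trans (le_of_eq (by ring))
    have h5 : u / m ≤ (⌊u * n / m⌋₊ : ℝ) / n + 1 / n := by
      rw [← add_div, le_div_iff₀ hn0]
      refine (le_of_eq (by ring)).trans h3.le
    have := abs_nonneg (labelCount Finset.univ a l / m - N / n)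
    rw [abs_of_nonpos (by linarith)]
    linarith

lemma sum_abs_labelCount_sub_le {V L : Type*} [Fintype V] [Nonempty V] {m : ℕ} (hm : 0 < m)
    (lab : V → L) (l : L) : ∑ s : Fin m → V, |labelCount Finset.univ (lab ∘ s) l / m -
      labelCount Finset.univ lab l / Fintype.card V| ≤ (Fintype.card V : ℝ) ^ m / √m := by
  have hn0 : (0 : ℝ) < Fintype.card V := by exact_mod_cast Fintype.card_pos
  have hm0 : (0 : ℝ) < m := by exact_mod_cast hm
  set p := labelCount Finset.univ lab l / Fintype.card V with hp
  have hp0 : 0 ≤ p := div_nonneg (labelCount_nonneg _ _ _) hn0.le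
  have hp1 : p ≤ 1 := by
    rw [hp, div_le_one hn0]
    refine (Finset.sum_le_sum fun x _ => pind_le_one _).trans (by simp)
  have h := sum_abs_sum_le (J := Fin m) (φ := fun v => pind (lab v = l) - p)
    (fun v => by
      have := pind_nonneg (lab v = l)
      have := pind_le_one (lab v = l)
      rw [abs_le]
      constructor <;> linarith)
    (by
      rw [Finset.sum_sub_distrib]
      simp only [Finset.sum_const, Finset.card_univ, nsmul_eq_mul]
      rw [hp, mul_div_cancel₀ _ hn0.ne', labelCount, sub_self])
  rw [Fintype.card_fin] at h
  have h1 : ∀ s : Fin m → V, |labelCount Finset.univ (lab ∘ s) l / m - p| =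
      |∑ i, (pind (lab (s i) = l) - p)| / m := by
    intro s
    rw [Finset.sum_sub_distrib, ← abs_of_pos hm0, ← abs_div]
    simp only [Finset.sum_const, Finset.card_univ, nsmul_eq_mul, Fintype.card_fin]
    rw [abs_of_pos hm0, sub_div, mul_div_cancel_left₀ _ hm0.ne']
    rfl
  simp only [h1]
  rw [← Finset.sum_div, div_le_div_iff₀ hm0 (Real.sqrt_pos.2 hm0)]
  calc _ ≤ √m * (Fintype.card V : ℝ) ^ m * √m := by gcongr
    _ = (Fintype.card V : ℝ) ^ m * (√m * √m) := by ring
    _ = _ := by rw [Real.mul_self_sqrt hm0.le]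

end

lemma tri_sind {V : Type*} [Fintype V] (K : V → V → V → ℝ) (X : Finset V) :
    tri K (sind X) (sind X) (sind X) = ∑ x ∈ X, ∑ y ∈ X, ∑ z ∈ X, K x y z := by
  rw [tri_eq_first, sum_mul_sind]
  refine Finset.sum_congr rfl fun x _ => ?_
  rw [← sum_mul_sind X fun y => ∑ z ∈ X, K x y z]
  refine Finset.sum_congr rfl fun y _ => ?_
  rw [← sum_mul_sind X fun z => K x y z, Finset.sum_mul]
  exact Finset.sum_congr rfl fun z _ => by ring

/-- Deterministic part of the sampling argument. -/
lemma sum_sample_ge {V L : Type*} [Fintype V] [Nonempty V] [Fintype L] {K : V → V → V → ℝ}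
    {κ : L → L → L → ℝ} (hκ : ∀ a b c, |κ a b c| ≤ 1) {lab : V → L} {e e' τ : ℝ}
    (hcut : ∀ f g h : V → ℝ, (∀ x, |f x| ≤ 1) → (∀ x, |g x| ≤ 1) → (∀ x, |h x| ≤ 1) →
        |tri (fun x y z => K x y z - κ (lab x) (lab y) (lab z)) f g h| ≤
          e * (Fintype.card V : ℝ) ^ 3)
    (hK : ∀ X : Finset V, -e' * (Fintype.card V : ℝ) ^ 3 ≤ ∑ x ∈ X, ∑ y ∈ X, ∑ z ∈ X, K x y z)
    {m : ℕ} (hm : 0 < m) (s : Fin m → V) (hτ : 0 ≤ τ)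
    (hbox : boxSum (fun i j k => K (s i) (s j) (s k) - κ (lab (s i)) (lab (s j)) (lab (s k))) ≤
      τ ^ 8 * (m : ℝ) ^ 12)
    (U : Finset (Fin m)) :
    -(τ + e + e' + 3 * (∑ l, |labelCount Finset.univ (lab ∘ s) l / m -
      labelCount Finset.univ lab l / Fintype.card V| + Fintype.card L / Fintype.card V)) *
      (m : ℝ) ^ 3 ≤ ∑ i ∈ U, ∑ j ∈ U, ∑ k ∈ U, K (s i) (s j) (s k) := by
  have hn0 : (0 : ℝ) < Fintype.card V := by exact_mod_cast Fintype.card_pos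
  have hm0 : (0 : ℝ) < m := by exact_mod_cast hm
  obtain ⟨X, hX⟩ := exists_mirror_set hm lab (lab ∘ s) U
  set n : ℝ := (Fintype.card V : ℝ) with hn
  set Δ := ∑ l, |labelCount Finset.univ (lab ∘ s) l / m - labelCount Finset.univ lab l / n| with hΔ
  have h1 : |tri (fun i j k => K (s i) (s j) (s k) - κ (lab (s i)) (lab (s j)) (lab (s k)))
      (sind U) (sind U) (sind U)| ≤ τ * (m : ℝ) ^ 3 := by
    rw [← pow_le_pow_iff_left₀ (abs_nonneg _) (by positivity) (by norm_num : (8 : ℕ) ≠ 0),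
      Even.pow_abs (by decide)]
    refine (tri_pow_eight_le _ _ _ (abs_sind_le_one U) (abs_sind_le_one U)
      (abs_sind_le_one U)).trans ?_
    rw [Fintype.card_fin]
    refine (mul_le_mul_of_nonneg_left hbox (by positivity)).trans (le_of_eq (by ring))
  have h2 : |tri (fun x y z => K x y z - κ (lab x) (lab y) (lab z)) (sind X) (sind X) (sind X)| ≤
      e * n ^ 3 := hcut _ _ _ (abs_sind_le_one X) (abs_sind_le_one X) (abs_sind_le_one X)
  rw [tri_sub, tri_sind, tri_sind] at h1 h2
  have h3 : |tri κ (fun l => labelCount X lab l / n) (fun l => labelCount X lab l / n)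
      (fun l => labelCount X lab l / n) - tri κ (fun l => labelCount U (lab ∘ s) l / m)
      (fun l => labelCount U (lab ∘ s) l / m) (fun l => labelCount U (lab ∘ s) l / m)| ≤
      3 * (Δ + Fintype.card L / n) := by
    refine (abs_tri_sub_tri_le hκ ?_ ?_).trans ?_
    · have : ∀ l, |labelCount X lab l / n| = labelCount X lab l / n :=
        fun l => abs_of_nonneg (div_nonneg (labelCount_nonneg _ _ _) hn0.le)
      simp only [this]
      rw [← Finset.sum_div, sum_labelCount, div_le_one hn0]
      exact Nat.cast_le.2 (Finset.card_le_univ X)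
    · have : ∀ l, |labelCount U (lab ∘ s) l / m| = labelCount U (lab ∘ s) l / m :=
        fun l => abs_of_nonneg (div_nonneg (labelCount_nonneg _ _ _) hm0.le)
      simp only [this]
      rw [← Finset.sum_div, sum_labelCount, div_le_one hm0]
      exact_mod_cast (Finset.card_le_univ U).trans (by simp)
    · gcongr
      refine (Finset.sum_le_sum fun l _ => hX l).trans (le_of_eq ?_)
      rw [Finset.sum_add_distrib]
      simp [hΔ, div_eq_mul_inv]
  have hdiv : ∀ (f : L → ℝ) (t : ℝ), tri κ (fun l => f l / t) (fun l => f l / t)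
      (fun l => f l / t) = tri κ f f f / t ^ 3 := by
    intro f t
    simp only [tri, Finset.sum_div]
    refine Finset.sum_congr rfl fun x _ => Finset.sum_congr rfl fun y _ =>
      Finset.sum_congr rfl fun z _ => by ring
  rw [hdiv, hdiv, tri_labelCount, tri_labelCount] at h3
  simp only [Function.comp_apply] at h3
  have hKX := hK X
  set SX := ∑ x ∈ X, ∑ y ∈ X, ∑ z ∈ X, κ (lab x) (lab y) (lab z)
  set SU := ∑ x ∈ U, ∑ y ∈ U, ∑ z ∈ U, κ (lab (s x)) (lab (s y)) (lab (s z))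
  have h4 : -(e' + e) ≤ SX / n ^ 3 := by
    rw [le_div_iff₀ (by positivity)]
    linarith [(abs_le.1 h2).2]
  have h5 : -(e' + e + 3 * (Δ + Fintype.card L / n)) ≤ SU / (m : ℝ) ^ 3 := by
    linarith [(abs_le.1 h3).2]
  rw [le_div_iff₀ (by positivity)] at h5
  linarith [(abs_le.1 h1).1]

/-- A one-sided sampling lemma: a kernel with no large negative sub-cube has a bounded-size sample
with the same property. -/
lemma exists_good_sample {ε : ℝ} (hε : 0 < ε) : ∃ m₀ : ℕ, ∀ m ≥ m₀, ∃ n₀ : ℕ, ∀ (V : Type)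
    [Fintype V] (K : V → V → V → ℝ), n₀ ≤ Fintype.card V → (∀ x y z, |K x y z| ≤ 1) →
    (∀ X : Finset V, -(ε / 4) * (Fintype.card V : ℝ) ^ 3 ≤ ∑ x ∈ X, ∑ y ∈ X, ∑ z ∈ X, K x y z) →
    ∃ s : Fin m → V, ∀ U : Finset (Fin m),
      -ε * (m : ℝ) ^ 3 ≤ ∑ i ∈ U, ∑ j ∈ U, ∑ k ∈ U, K (s i) (s j) (s k) := by
  set τ := min ((ε / 4) ^ 8) (ε / 24) with hτ
  have hτ0 : 0 < τ := lt_min (by positivity) (by positivity)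
  set e := min (τ / 256) (ε / 4) with he
  have he0 : 0 < e := lt_min (by positivity) (by positivity)
  obtain ⟨q, hq⟩ := exists_bounded_label_approx he0
  have hlim : Tendsto (fun m : ℕ => (73728 : ℝ) / m + q / √m) atTop (nhds 0) := by
    have h1 : Tendsto (fun m : ℕ => (73728 : ℝ) / m) atTop (nhds 0) :=
      tendsto_const_div_atTop_nhds_zero_nat _
    have h2 : Tendsto (fun m : ℕ => (q : ℝ) / √m) atTop (nhds 0) :=
      tendsto_const_nhds.div_atTop (Real.tendsto_sqrt_atTop.comp tendsto_natCast_atTop_atTop)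
    simpa using h1.add h2
  obtain ⟨m₁, hm₁⟩ := eventually_atTop.1 (hlim.eventually_le_const (show 0 < τ / 2 by positivity))
  refine ⟨max m₁ 1, fun m hm => ?_⟩
  have hm' := hm₁ m ((le_max_left _ _).trans hm)
  have hmpos : 0 < m := lt_of_lt_of_le one_pos ((le_max_right _ _).trans hm)
  obtain ⟨n₁, hn₁⟩ := exists_nat_ge (q / (ε / 24))
  refine ⟨max n₁ 1, fun V _ K hn hK1 hK => ?_⟩
  obtain ⟨L, hL, lab, κ, hcard, hκ, hcut⟩ := hq V K hK1
  have hnpos : 0 < Fintype.card V := lt_of_lt_of_le one_pos ((le_max_right _ _).trans hn)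
  have : Nonempty V := Fintype.card_pos_iff.1 hnpos
  have : Nonempty (Fin m) := ⟨⟨0, hmpos⟩⟩
  have hn0 : (0 : ℝ) < Fintype.card V := by exact_mod_cast hnpos
  have hm0 : (0 : ℝ) < m := by exact_mod_cast hmpos
  set D : V → V → V → ℝ := fun x y z => K x y z - κ (lab x) (lab y) (lab z) with hD
  have hD2 : ∀ x y z, |D x y z| ≤ 2 := fun x y z =>
    (abs_sub _ _).trans (by linarith [hK1 x y z, hκ (lab x) (lab y) (lab z)])
  have hb := boxSum_le hD2 hcut
  have hs := sum_boxSum_comp_le (J := Fin m) hD2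
  rw [Fintype.card_fin] at hs
  set n : ℝ := (Fintype.card V : ℝ) with hnn
  have hb' : boxSum D / n ^ 12 ≤ 128 * e := by
    rw [div_le_iff₀ (by positivity)]
    refine hb.trans (le_of_eq (by ring))
  have htot : ∑ s : Fin m → V, (boxSum (fun i j k => D (s i) (s j) (s k)) / (m : ℝ) ^ 12 +
      ∑ l, |labelCount Finset.univ (lab ∘ s) l / m - labelCount Finset.univ lab l / n|) ≤
      ∑ _s : Fin m → V, τ := by
    rw [Finset.sum_add_distrib, ← Finset.sum_div, Finset.sum_comm]
    have h1 : (∑ s : Fin m → V, boxSum (fun i j k => D (s i) (s j) (s k))) / (m : ℝ) ^ 12 ≤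
        n ^ m * (128 * e + 73728 / m) := by
      rw [div_le_iff₀ (by positivity)]
      refine hs.trans ?_
      have : n ^ m * ((m : ℝ) ^ 12 * (boxSum D / n ^ 12 + 73728 / m)) ≤
        n ^ m * ((m : ℝ) ^ 12 * (128 * e + 73728 / m)) := by gcongr
      refine this.trans (le_of_eq (by ring))
    have h2 : ∑ l, ∑ s : Fin m → V, |labelCount Finset.univ (lab ∘ s) l / m -
        labelCount Finset.univ lab l / n| ≤ n ^ m * (q / √m) := by
      refine (Finset.sum_le_sum fun l _ => sum_abs_labelCount_sub_le hmpos lab l).trans ?_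
      simp only [Finset.sum_const, Finset.card_univ, nsmul_eq_mul]
      have : (Fintype.card L : ℝ) ≤ q := by exact_mod_cast hcard
      calc (Fintype.card L : ℝ) * (n ^ m / √m) ≤ q * (n ^ m / √m) := by gcongr
        _ = _ := by ring
    have h3 : ∑ _s : Fin m → V, τ = n ^ m * τ := by simp [hnn]
    rw [h3]
    refine (add_le_add h1 h2).trans ?_
    rw [← mul_add]
    gcongr
    have : e ≤ τ / 256 := min_le_left _ _
    linarith
  obtain ⟨s, -, hs'⟩ := Finset.exists_le_of_sum_le (Finset.univ_nonempty) htot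
  have hbn : 0 ≤ boxSum (fun i j k => D (s i) (s j) (s k)) := boxSum_nonneg _
  have hΔ0 : 0 ≤ ∑ l, |labelCount Finset.univ (lab ∘ s) l / m -
      labelCount Finset.univ lab l / n| := Finset.sum_nonneg fun _ _ => abs_nonneg _
  have hbox : boxSum (fun i j k => D (s i) (s j) (s k)) ≤ (ε / 4) ^ 8 * (m : ℝ) ^ 12 := by
    have h1 : boxSum (fun i j k => D (s i) (s j) (s k)) / (m : ℝ) ^ 12 ≤ (ε / 4) ^ 8 :=
      (le_of_add_le_of_nonneg_left hs' hΔ0).trans (min_le_left _ _)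
    rwa [div_le_iff₀ (by positivity)] at h1
  refine ⟨s, fun U => le_trans ?_ (sum_sample_ge hκ hcut hK hmpos s (by positivity) hbox U)⟩
  have h1 : ∑ l, |labelCount Finset.univ (lab ∘ s) l / m -
      labelCount Finset.univ lab l / n| ≤ ε / 24 :=
    (le_of_add_le_of_nonneg_right hs' (by positivity)).trans (min_le_right _ _)
  have h2 : (Fintype.card L : ℝ) / n ≤ ε / 24 := by
    have h3 : (q : ℝ) / (ε / 24) ≤ n :=
      hn₁.trans (Nat.cast_le.2 ((le_max_left _ _).trans hn))
    rw [div_le_iff₀ hn0]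
    rw [div_le_iff₀ (by positivity)] at h3
    have : (Fintype.card L : ℝ) ≤ q := by exact_mod_cast hcard
    linarith
  have h3 : e ≤ ε / 4 := min_le_right _ _
  gcongr
  linarith

lemma six_mul_choose_three (k : ℕ) : 6 * (k.choose 3 : ℝ) = k * (k - 1) * (k - 2) := by
  induction k with
  | zero => simp
  | succ k ih =>
    have h2 := Nat.cast_choose_two ℝ k
    rw [Nat.choose_succ_succ]
    push_cast
    rw [mul_add, ih, h2]
    ring

/-- The finite family of non-paintable `3`-graphs on at most `m` vertices. -/
def nonPaintable {C : Type*} (A : C → C → C → Prop) (m : ℕ) : Set (HGraph 3) :=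
  {G | G.n ≤ m ∧ ¬ Paintable A G}

lemma finite_nonPaintable {C : Type*} (A : C → C → C → Prop) (m : ℕ) :
    (nonPaintable A m).Finite := by
  refine (Set.finite_range (fun p : Σ n : Fin (m + 1),
    {E : Finset (Finset (Fin n)) // ∀ e ∈ E, e.card = 3} => HGraph.mk p.1 p.2.1 p.2.2)).subset ?_
  rintro ⟨n, E, hE⟩ ⟨hn, -⟩
  exact ⟨⟨⟨n, Nat.lt_succ_of_le hn⟩, ⟨E, hE⟩⟩, rfl⟩

lemma Paintable.of_embeds {C : Type*} {A : C → C → C → Prop} {G H : HGraph 3}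
    (hH : Paintable A H) (h : G.Embeds H) : Paintable A G := by
  obtain ⟨c, hc, hcA⟩ := hH
  obtain ⟨f, -, hf⟩ := h
  refine ⟨fun x y => c (f x) (f y), fun x y => hc _ _, fun x y z hxyz => hcA _ _ _ ?_⟩
  simpa [Finset.image_insert] using hf _ hxyz

lemma Paintable.isFree {C : Type*} {A : C → C → C → Prop} {H : HGraph 3}
    (hH : Paintable A H) (m : ℕ) : IsFree (nonPaintable A m) H :=
  fun _ hG hGH => hG.2 (hH.of_embeds hGH)

/-- The subgraph induced by a vertex set, with vertices relabelled. -/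
noncomputable def HGraph.onSet (H : HGraph 3) (W : Finset (Fin H.n)) : HGraph 3 where
  n := W.card
  edges := Finset.univ.filter fun e => e.image (fun i => (W.equivFin.symm i : Fin H.n)) ∈ H.edges
  card_eq e he := by
    have h := H.card_eq _ (Finset.mem_filter.1 he).2
    rwa [Finset.card_image_of_injective _ (show Function.Injective fun i => (W.equivFin.symm i : Fin H.n)
      from Subtype.val_injective.comp (Equiv.injective _))] at h

lemma HGraph.mem_onSet (H : HGraph 3) (W : Finset (Fin H.n)) (e : Finset (Fin (H.onSet W).n)) :
    e ∈ (H.onSet W).edges ↔ e.image (fun i => (W.equivFin.symm i : Fin H.n)) ∈ H.edges :=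
  (Finset.mem_filter (s := (Finset.univ : Finset (Finset (Fin W.card))))).trans
    (and_iff_right (Finset.mem_univ (α := Finset (Fin W.card)) e))

lemma HGraph.onSet_embeds (H : HGraph 3) (W : Finset (Fin H.n)) : (H.onSet W).Embeds H :=
  ⟨fun i => (W.equivFin.symm i : Fin H.n), Subtype.val_injective.comp (Equiv.injective _),
    fun e he => (H.mem_onSet W e).1 he⟩

lemma exists_sample_colouring {C : Type*} {A : C → C → C → Prop} {H : HGraph 3} {m : ℕ}
    (hH : IsFree (nonPaintable A m) H) (s : Fin m → Fin H.n) :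
    ∃ c : Fin m → Fin m → C, (∀ i j, c i j = c j i) ∧
      ∀ i j k, {s i, s j, s k} ∈ H.edges → A (c i j) (c j k) (c i k) := by
  classical
  set W := Finset.univ.image s with hW
  have hWm : W.card ≤ m := Finset.card_image_le.trans (by simp)
  have hpaint : Paintable A (H.onSet W) := by
    by_contra h
    exact hH _ ⟨hWm, h⟩ (H.onSet_embeds W)
  obtain ⟨c, hc, hcA⟩ := hpaint
  have hs : ∀ i, s i ∈ W := fun i => Finset.mem_image_of_mem _ (Finset.mem_univ i)
  let e : Fin m → Fin W.card := fun i => W.equivFin ⟨s i, hs i⟩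
  refine ⟨fun i j => c (e i) (e j), fun i j => hc _ _, fun i j k hijk => hcA _ _ _ ?_⟩
  have h1 : Finset.image (fun i => (W.equivFin.symm i : Fin H.n)) {e i, e j, e k} =
      {s i, s j, s k} := by
    simp [Finset.image_insert, e]
  exact (H.mem_onSet W _).2 (h1.symm ▸ hijk)

lemma sum_edge_sub_ge {H : HGraph 3} {d η : ℝ} (hd0 : 0 ≤ d) (hd1 : d ≤ 1)
    (hH : UniformlyDense H d η)
    (X : Finset (Fin H.n)) : -(3 * (H.n : ℝ) ^ 2 + 6 * η * (H.n : ℝ) ^ 3) ≤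
      ∑ x ∈ X, ∑ y ∈ X, ∑ z ∈ X, ((if {x, y, z} ∈ H.edges then (1 : ℝ) else 0) - d) := by
  have h1 := sum_triples_eq H.edges H.card_eq X
  have h2 := hH X
  have h3 := six_mul_choose_three X.card
  simp only [Finset.sum_sub_distrib, h1]
  simp only [Finset.sum_const, nsmul_eq_mul]
  have h4 : (X.card : ℝ) ≤ H.n := by
    exact_mod_cast (Finset.card_le_univ X).trans (by simp)
  have h0 : (0 : ℝ) ≤ X.card := Nat.cast_nonneg _
  have h5 : (X.card : ℝ) ^ 2 ≤ (H.n : ℝ) ^ 2 := by gcongr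
  have h6 : d * (X.card : ℝ) ^ 2 ≤ (X.card : ℝ) ^ 2 := mul_le_of_le_one_left (by positivity) hd1
  have h7 : d * (6 * (X.card.choose 3 : ℝ)) = d * (X.card * (X.card - 1) * (X.card - 2)) := by
    rw [h3]
  have h8 : 0 ≤ d * X.card := by positivity
  nlinarith

lemma density_le_of_uniform {C : Type*} [Fintype C] {A : C → C → C → Prop} {V : Type*}
    {U : Finset V} (hU : 0 < U.card) (c : V → V → C) {p : C → ℝ} {ε : ℝ}
    (hε : (Fintype.card C : ℝ) * ε ≤ 1)
    (hp : ∀ a, p a ∈ Set.Icc (0 : ℝ) 1)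
    (h : ∀ a, CutDisc U (fun x y => pind (c x y = a) - p a) (ε * (U.card : ℝ) ^ 2)) :
    ∑ x ∈ U, ∑ y ∈ U, ∑ z ∈ U, ind A (c x y) (c y z) (c x z) ≤
      (lagr A + (7 * Fintype.card C + 3 * (Fintype.card C : ℝ) ^ 3) * ε) * (U.card : ℝ) ^ 3 := by
  have hU0 : (0 : ℝ) < U.card := by exact_mod_cast hU
  set k : ℝ := (Fintype.card C : ℝ) with hk
  have h1 := (abs_le.1 (count_palette A c hp h)).2
  have hsum : ∑ a, p a ≤ 1 + k * ε := by
    have h2 : ∀ a, p a * (U.card : ℝ) ^ 2 ≤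
        ∑ x ∈ U, ∑ y ∈ U, pind (c x y = a) + ε * (U.card : ℝ) ^ 2 := by
      intro a
      have h3 := (abs_le.1 (h a U subset_rfl U subset_rfl)).1
      simp only [Finset.sum_sub_distrib, Finset.sum_const, nsmul_eq_mul] at h3
      linarith
    have h4 := Finset.sum_le_sum fun a (_ : a ∈ Finset.univ) => h2 a
    rw [← Finset.sum_mul, Finset.sum_add_distrib, Finset.sum_comm] at h4
    have h5 : ∑ x ∈ U, ∑ a, ∑ y ∈ U, pind (c x y = a) = (U.card : ℝ) ^ 2 := by
      have : ∀ x, ∑ a, ∑ y ∈ U, pind (c x y = a) = U.card := fun x =>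
        sum_labelCount U (c x)
      simp only [this, Finset.sum_const, nsmul_eq_mul]
      ring
    rw [h5] at h4
    simp only [Finset.sum_const, Finset.card_univ, nsmul_eq_mul] at h4
    have h6 : (∑ a, p a) * (U.card : ℝ) ^ 2 ≤ (1 + k * ε) * (U.card : ℝ) ^ 2 := by linarith
    exact le_of_mul_le_mul_right h6 (by positivity)
  have hε0 : 0 ≤ k * ε := by
    rcases isEmpty_or_nonempty C with hC | ⟨⟨a⟩⟩
    · simp [hk]
    · have h3 := (abs_nonneg _).trans (h a U subset_rfl U subset_rfl)
      have : 0 ≤ ε := nonneg_of_mul_nonneg_left h3 (by positivity)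
      positivity
  have hs0 : 0 ≤ ∑ a, p a := Finset.sum_nonneg fun a _ => (hp a).1
  have h7 : lagPoly A p ≤ lagr A + 7 * (k * ε) := by
    refine (lagPoly_le_lagr_mul fun a => (hp a).1).trans ?_
    have h8 : (∑ a, p a) ^ 3 ≤ (1 + k * ε) ^ 3 := by gcongr
    have h9 : (1 + k * ε) ^ 3 ≤ 1 + 7 * (k * ε) := by nlinarith [mul_nonneg hε0 hε0]
    have h10 := mul_le_mul_of_nonneg_left (h8.trans h9) (lagr_nonneg A)
    have h11 := mul_le_mul_of_nonneg_right (lagr_le_one A) (by positivity : 0 ≤ 7 * (k * ε))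
    linarith
  have h12 := mul_le_mul_of_nonneg_right h7 (by positivity : 0 ≤ (U.card : ℝ) ^ 3)
  linarith

lemma exists_family_near_lagr {C : Type} [Fintype C] [Nonempty C] {A : C → C → C → Prop}
    (hA : SymRel A) {ε₀ : ℝ} (hε₀ : 0 < ε₀) (hε₁ : ε₀ ≤ 1) :
    ∃ x ∈ PiUnifFin, lagr A ≤ x ∧ x ≤ lagr A + ε₀ := by
  classical
  set k : ℝ := (Fintype.card C : ℝ) with hk
  have hk0 : 0 ≤ k := Nat.cast_nonneg _
  set ε := ε₀ / (20 * (k + 1) ^ 3) with hε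
  have hεpos : 0 < ε := by positivity
  have hεmul : (k + 1) ^ 3 * ε = ε₀ / 20 := by
    rw [hε]; field_simp
  have hk3 : 1 ≤ (k + 1) ^ 3 := one_le_pow₀ (by linarith)
  have hε1 : ε ≤ 1 := by nlinarith
  have hkε : k * ε ≤ 1 := by
    have : k ≤ (k + 1) ^ 3 := by nlinarith [mul_nonneg hk0 hk0]
    nlinarith
  have hkε' : (7 * k + 3 * k ^ 3) * ε ≤ ε₀ / 2 := by
    have : 7 * k + 3 * k ^ 3 ≤ 10 * (k + 1) ^ 3 := by
      have := pow_nonneg hk0 3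
      nlinarith [mul_nonneg hk0 hk0]
    nlinarith
  obtain ⟨δ, hδ, N, hQR⟩ := exists_uniform_subset (Finset.univ : Finset C) hεpos hε1
  set ε₁ := δ ^ 3 * (ε₀ / 2) with hε₁'
  have hε₁pos : 0 < ε₁ := by positivity
  obtain ⟨m₀, hm₀⟩ := exists_good_sample hε₁pos
  set m := max (max m₀ N) 1 with hm
  have hmpos : 0 < m := lt_of_lt_of_le one_pos (le_max_right _ _)
  obtain ⟨n₀, hn₀⟩ := hm₀ m ((le_max_left _ _).trans (le_max_left _ _))
  set S := {d : ℝ | d ∈ Set.Icc (0 : ℝ) 1 ∧ ∀ η : ℝ, 0 < η → ∀ n₀ : ℕ,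
      ∃ H : HGraph 3, IsFree (nonPaintable A m) H ∧ UniformlyDense H d η ∧ n₀ ≤ H.n} with hS
  have hbdd : BddAbove S := ⟨1, fun d hd => hd.1.2⟩
  refine ⟨uniformTuranDensity (nonPaintable A m), ⟨_, finite_nonPaintable A m, rfl⟩, ?_, ?_⟩
  · change lagr A ≤ sSup S
    refine le_of_forall_lt fun d hd => ?_
    by_cases hd0 : 0 ≤ d
    · obtain ⟨d', hd', hd''⟩ := exists_between hd
      refine lt_of_lt_of_le hd' (le_csSup hbdd ⟨⟨hd0.trans hd'.le,
        hd''.le.trans (lagr_le_one A)⟩, fun η hη n₀ => ?_⟩)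
      obtain ⟨H, hH, hH', hn⟩ := exists_paintable_dense hA (hd0.trans hd'.le) hd'' hη n₀
      exact ⟨H, hH.isFree m, hH', hn⟩
    · exact (not_le.1 hd0).trans_le (Real.sSup_nonneg fun d hd => hd.1.1)
  · change sSup S ≤ lagr A + ε₀
    refine Real.sSup_le (fun d hd => ?_) (add_nonneg (lagr_nonneg A) hε₀.le)
    obtain ⟨⟨hd0, hd1⟩, hd⟩ := hd
    obtain ⟨n₁, hn₁⟩ := exists_nat_ge (24 / ε₁)
    obtain ⟨H, hfree, hdense, hn⟩ := hd (ε₁ / 48) (by positivity) (max n₀ n₁)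
    obtain ⟨s, hs⟩ := hn₀ (Fin H.n)
      (fun x y z => (if {x, y, z} ∈ H.edges then (1 : ℝ) else 0) - d)
      (by simpa using (le_max_left _ _).trans hn)
      (fun x y z => by
        rw [abs_le]
        split_ifs <;> constructor <;> linarith)
      (fun X => by
        refine le_trans ?_ (sum_edge_sub_ge hd0 hd1 hdense X)
        rw [Fintype.card_fin]
        have h1 : 24 / ε₁ ≤ (H.n : ℝ) :=
          hn₁.trans (Nat.cast_le.2 ((le_max_right _ _).trans hn))
        rw [div_le_iff₀ hε₁pos] at h1
        have h2 : 24 * (H.n : ℝ) ^ 2 ≤ (H.n * ε₁) * (H.n : ℝ) ^ 2 := by gcongr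
        nlinarith)
    obtain ⟨c, hc, hcA⟩ := exists_sample_colouring hfree s
    obtain ⟨U, -, hUδ, p, hp⟩ := hQR (Fin m) c hc Finset.univ
      (by rw [Finset.card_univ, Fintype.card_fin]
          exact (le_max_right m₀ N).trans (le_max_left _ 1))
    have hm0 : (0 : ℝ) < m := by exact_mod_cast hmpos
    rw [Finset.card_univ, Fintype.card_fin] at hUδ
    have hU0 : (0 : ℝ) < U.card := lt_of_lt_of_le (by positivity) hUδ
    have hcount := density_le_of_uniform (A := A) (by exact_mod_cast hU0) c hkε
      (fun a => (hp a (Finset.mem_univ a)).1) fun a => (hp a (Finset.mem_univ a)).2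
    have h1 := hs U
    simp only [Finset.sum_sub_distrib] at h1
    simp only [Finset.sum_const, nsmul_eq_mul] at h1
    have h2 : ∑ i ∈ U, ∑ j ∈ U, ∑ l ∈ U, (if {s i, s j, s l} ∈ H.edges then (1 : ℝ) else 0) ≤
        ∑ i ∈ U, ∑ j ∈ U, ∑ l ∈ U, ind A (c i j) (c j l) (c i l) := by
      refine Finset.sum_le_sum fun i _ => Finset.sum_le_sum fun j _ =>
        Finset.sum_le_sum fun l _ => ?_
      split_ifs with h
      · simp [ind, hcA i j l h]
      · exact ind_nonneg _ _ _ _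
    have h3 : ε₁ * (m : ℝ) ^ 3 ≤ ε₀ / 2 * (U.card : ℝ) ^ 3 := by
      calc ε₁ * (m : ℝ) ^ 3 = ε₀ / 2 * (δ * m) ^ 3 := by rw [hε₁']; ring
        _ ≤ _ := by gcongr
    have h4 : d * (U.card : ℝ) ^ 3 ≤ (lagr A + ε₀) * (U.card : ℝ) ^ 3 := by
      have h5 := mul_le_mul_of_nonneg_right hkε' (by positivity : 0 ≤ (U.card : ℝ) ^ 3)
      linarith
    exact le_of_mul_le_mul_right h4 (by positivity)

lemma lagSet_subset_closure : lagSet ⊆ closure PiUnifFin := by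
  rintro x ⟨C, _, _, A, hA, rfl⟩
  refine Metric.mem_closure_iff.2 fun ε hε => ?_
  obtain ⟨x, hx, h1, h2⟩ := exists_family_near_lagr hA (ε₀ := min (ε / 2) 1)
    (lt_min (by positivity) one_pos) (min_le_right _ _)
  refine ⟨x, hx, ?_⟩
  have := min_le_left (ε / 2) 1
  rw [Real.dist_eq, abs_lt]
  constructor <;> linarith

/-- The palette on a disjoint union given by relations for triples inside either part and by graph
relations for triples meeting both parts. -/
def joinRel {C D : Type*} (A : C → C → C → Prop) (Q : C → C → Prop) (P : D → D → Prop)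
    (B : D → D → D → Prop) : C ⊕ D → C ⊕ D → C ⊕ D → Prop
  | .inl a, .inl b, .inl c => A a b c
  | .inl a, .inl b, .inr _ => Q a b
  | .inl a, .inr _, .inl b => Q a b
  | .inr _, .inl a, .inl b => Q a b
  | .inl _, .inr a, .inr b => P a b
  | .inr a, .inl _, .inr b => P a b
  | .inr a, .inr b, .inl _ => P a b
  | .inr a, .inr b, .inr c => B a b c

lemma symRel_joinRel {C D : Type*} {A : C → C → C → Prop} {Q : C → C → Prop} {P : D → D → Prop}
    {B : D → D → D → Prop} (hA : SymRel A) (hQ : ∀ a b, Q a b → Q b a)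
    (hP : ∀ a b, P a b → P b a) (hB : SymRel B) : SymRel (joinRel A Q P B) := by
  constructor
  · rintro (a | a) (b | b) (c | c) h <;>
      first | exact hA.1 _ _ _ h | exact hB.1 _ _ _ h | exact hQ _ _ h | exact hP _ _ h | exact h
  · rintro (a | a) (b | b) (c | c) h <;>
      first | exact hA.2 _ _ _ h | exact hB.2 _ _ _ h | exact hQ _ _ h | exact hP _ _ h | exact h

open Classical in
/-- The Lagrangian polynomial of a binary relation. -/
noncomputable def pairPoly {C : Type*} [Fintype C] (P : C → C → Prop) (w : C → ℝ) : ℝ :=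
  ∑ a, ∑ b, if P a b then w a * w b else 0

section
variable {C D : Type*} [Fintype C] [Fintype D]

lemma pairPoly_true (w : C → ℝ) : pairPoly (fun _ _ => True) w = (∑ a, w a) ^ 2 := by
  simp [pairPoly, sq, Finset.sum_mul_sum]

lemma pairPoly_false (w : C → ℝ) : pairPoly (fun _ _ => False) w = 0 := by
  simp [pairPoly]

lemma lagPoly_false (w : C → ℝ) : lagPoly (fun _ _ _ => False) w = 0 := by
  simp [lagPoly, ind]

lemma lagPoly_joinRel (A : C → C → C → Prop) (Q : C → C → Prop) (P : D → D → Prop)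
    (B : D → D → D → Prop) (w : C ⊕ D → ℝ) :
    lagPoly (joinRel A Q P B) w = lagPoly A (fun a => w (.inl a)) +
      3 * pairPoly Q (fun a => w (.inl a)) * (∑ d, w (.inr d)) +
      3 * (∑ a, w (.inl a)) * pairPoly P (fun d => w (.inr d)) +
      lagPoly B (fun d => w (.inr d)) := by
  classical
  have i1 : ∀ a b c, ind (joinRel A Q P B) (.inl a) (.inl b) (.inl c) = ind A a b c :=
    fun _ _ _ => rfl
  have i2 : ∀ a b c, ind (joinRel A Q P B) (.inr a) (.inr b) (.inr c) = ind B a b c :=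
    fun _ _ _ => rfl
  have q1 : ∑ a, ∑ b, ∑ c, ind (joinRel A Q P B) (.inl a) (.inl b) (.inr c) *
      (w (.inl a) * w (.inl b) * w (.inr c)) =
      pairPoly Q (fun a => w (.inl a)) * (∑ d, w (.inr d)) := by
    rw [pairPoly, Finset.sum_mul]
    refine Finset.sum_congr rfl fun a _ => ?_
    rw [Finset.sum_mul]
    refine Finset.sum_congr rfl fun b _ => ?_
    rw [Finset.mul_sum]
    refine Finset.sum_congr rfl fun c _ => ?_
    by_cases h : Q a b <;> simp [ind, joinRel, h]
  have q2 : ∑ a, ∑ c, ∑ b, ind (joinRel A Q P B) (.inl a) (.inr c) (.inl b) *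
      (w (.inl a) * w (.inr c) * w (.inl b)) =
      pairPoly Q (fun a => w (.inl a)) * (∑ d, w (.inr d)) := by
    rw [← q1]
    refine Finset.sum_congr rfl fun a _ => ?_
    rw [Finset.sum_comm]
    refine Finset.sum_congr rfl fun b _ => Finset.sum_congr rfl fun c _ => ?_
    rw [mul_right_comm (w (.inl a))]; rfl
  have q3 : ∑ c, ∑ a, ∑ b, ind (joinRel A Q P B) (.inr c) (.inl a) (.inl b) *
      (w (.inr c) * w (.inl a) * w (.inl b)) =
      pairPoly Q (fun a => w (.inl a)) * (∑ d, w (.inr d)) := by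
    rw [← q2, Finset.sum_comm]
    refine Finset.sum_congr rfl fun a _ => Finset.sum_congr rfl fun b _ =>
      Finset.sum_congr rfl fun c _ => ?_
    rw [mul_comm (w (.inr b))]; rfl
  have p1 : ∑ c, ∑ a, ∑ b, ind (joinRel A Q P B) (.inl c) (.inr a) (.inr b) *
      (w (.inl c) * w (.inr a) * w (.inr b)) =
      (∑ a, w (.inl a)) * pairPoly P (fun a => w (.inr a)) := by
    rw [pairPoly, Finset.sum_mul]
    refine Finset.sum_congr rfl fun c _ => ?_
    rw [Finset.mul_sum]
    refine Finset.sum_congr rfl fun a _ => ?_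
    rw [Finset.mul_sum]
    refine Finset.sum_congr rfl fun b _ => ?_
    by_cases h : P a b <;> simp [ind, joinRel, h, mul_assoc]
  have p2 : ∑ a, ∑ c, ∑ b, ind (joinRel A Q P B) (.inr a) (.inl c) (.inr b) *
      (w (.inr a) * w (.inl c) * w (.inr b)) =
      (∑ a, w (.inl a)) * pairPoly P (fun a => w (.inr a)) := by
    rw [← p1, Finset.sum_comm]
    refine Finset.sum_congr rfl fun a _ => Finset.sum_congr rfl fun b _ =>
      Finset.sum_congr rfl fun c _ => ?_
    rw [mul_comm (w (.inr b))]; rfl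
  have p3 : ∑ a, ∑ b, ∑ c, ind (joinRel A Q P B) (.inr a) (.inr b) (.inl c) *
      (w (.inr a) * w (.inr b) * w (.inl c)) =
      (∑ a, w (.inl a)) * pairPoly P (fun a => w (.inr a)) := by
    rw [← p2]
    refine Finset.sum_congr rfl fun a _ => ?_
    rw [Finset.sum_comm]
    refine Finset.sum_congr rfl fun b _ => Finset.sum_congr rfl fun c _ => ?_
    rw [mul_right_comm (w (.inr a))]; rfl
  simp only [lagPoly, Fintype.sum_sum_type, Finset.sum_add_distrib, i1, i2, q1, q2, q3, p1, p2, p3]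
  ring
end

/-- The composition of two palettes: triples inside either part follow its own relation, triples
with exactly two elements in the second part are all present, and no other triples are. -/
def frameRel {C D : Type*} (A : C → C → C → Prop) (B : D → D → D → Prop) :
    C ⊕ D → C ⊕ D → C ⊕ D → Prop :=
  joinRel A (fun _ _ => False) (fun _ _ => True) B

lemma symRel_frameRel {C D : Type*} {A : C → C → C → Prop} {B : D → D → D → Prop}
    (hA : SymRel A) (hB : SymRel B) : SymRel (frameRel A B) :=
  symRel_joinRel hA (fun _ _ => id) (fun _ _ => id) hB

/-- The Lagrangian polynomial of a composition, in terms of the mass `s` of the second part. -/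
def framePoly (x r s : ℝ) : ℝ := (1 - s) ^ 3 * x + 3 * (1 - s) * s ^ 2 + s ^ 3 * r

section
variable {C D : Type*} [Fintype C] [Fintype D] (A : C → C → C → Prop) (B : D → D → D → Prop)

lemma lagPoly_frameRel (w : C ⊕ D → ℝ) :
    lagPoly (frameRel A B) w = lagPoly A (fun a => w (.inl a)) +
      3 * (∑ a, w (.inl a)) * (∑ d, w (.inr d)) ^ 2 + lagPoly B (fun d => w (.inr d)) := by
  rw [frameRel, lagPoly_joinRel, pairPoly_false, pairPoly_true]
  ring

lemma framePoly_le_lagr {s : ℝ} (hs : s ∈ Set.Icc (0 : ℝ) 1) [Nonempty C] [Nonempty D] :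
    framePoly (lagr A) (lagr B) s ≤ lagr (frameRel A B) := by
  obtain ⟨u, hu, hu1, hu2⟩ := exists_weight_sum_one A
  obtain ⟨v, hv, hv1, hv2⟩ := exists_weight_sum_one B
  have h0 := hs.1
  have h1 := sub_nonneg.2 hs.2
  have h := lagPoly_le_lagr (A := frameRel A B)
    (w := Sum.elim (fun a => (1 - s) * u a) (fun a => s * v a)) ⟨?_, ?_⟩
  · rw [lagPoly_frameRel] at h
    simp only [Sum.elim_inl, Sum.elim_inr, lagPoly_smul, ← Finset.mul_sum, hu1, hv1, hu2, hv2] at h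
    unfold framePoly
    linarith
  · rintro (a | a)
    · exact mul_nonneg h1 (hu a)
    · exact mul_nonneg h0 (hv a)
  · simp [← Finset.mul_sum, hu1, hv1]

lemma exists_lagr_le_framePoly [Nonempty C] :
    ∃ s ∈ Set.Icc (0 : ℝ) 1, lagr (frameRel A B) ≤ framePoly (lagr A) (lagr B) s := by
  obtain ⟨w, hw, hw1, hw2⟩ := exists_weight_sum_one (frameRel A B)
  rw [Fintype.sum_sum_type] at hw1
  have h1 : 0 ≤ ∑ a, w (.inl a) := Finset.sum_nonneg fun _ _ => hw _
  have h2 : 0 ≤ ∑ a, w (.inr a) := Finset.sum_nonneg fun _ _ => hw _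
  refine ⟨∑ a, w (.inr a), ⟨h2, by linarith⟩, ?_⟩
  rw [← hw2, lagPoly_frameRel, framePoly, ← eq_sub_of_add_eq hw1]
  have h3 := lagPoly_le_lagr_mul (A := A) (w := fun a => w (.inl a)) fun _ => hw _
  have h4 := lagPoly_le_lagr_mul (A := B) (w := fun a => w (.inr a)) fun _ => hw _
  linarith
end

/-- The maximum of `framePoly`. -/
noncomputable def frameMax (x r : ℝ) : ℝ := sSup (framePoly x r '' Set.Icc 0 1)

lemma exists_framePoly_eq (x r : ℝ) : ∃ s ∈ Set.Icc (0 : ℝ) 1, framePoly x r s = frameMax x r := by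
  obtain ⟨s, hs, h⟩ := (isCompact_Icc (a := (0 : ℝ)) (b := 1)).exists_sSup_image_eq
    ⟨0, by simp⟩ (f := framePoly x r) (by unfold framePoly; fun_prop)
  exact ⟨s, hs, h.symm⟩

lemma framePoly_le_frameMax (x r : ℝ) {s : ℝ} (hs : s ∈ Set.Icc (0 : ℝ) 1) :
    framePoly x r s ≤ frameMax x r :=
  le_csSup (isCompact_Icc.image (by unfold framePoly; fun_prop)).bddAbove ⟨s, hs, rfl⟩

lemma frameMax_mem_lagSet {x r : ℝ} (hx : x ∈ lagSet) (hr : r ∈ lagSet) :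
    frameMax x r ∈ lagSet := by
  obtain ⟨C, _, _, A, hA, rfl⟩ := hx
  obtain ⟨D, _, _, B, hB, rfl⟩ := hr
  refine ⟨C ⊕ D, inferInstance, inferInstance, frameRel A B, symRel_frameRel hA hB, ?_⟩
  apply le_antisymm
  · obtain ⟨s, hs, h⟩ := exists_lagr_le_framePoly A B
    exact h.trans (framePoly_le_frameMax _ _ hs)
  · obtain ⟨s, hs, h⟩ := exists_framePoly_eq (lagr A) (lagr B)
    exact h ▸ framePoly_le_lagr A B hs

lemma frameMax_le_add {x y r : ℝ} (h : x ≤ y) : frameMax y r ≤ frameMax x r + (y - x) := by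
  obtain ⟨s, hs, h'⟩ := exists_framePoly_eq y r
  have h1 := framePoly_le_frameMax x r hs
  have h2 : (1 - s) ^ 3 ≤ 1 := pow_le_one₀ (sub_nonneg.2 hs.2) (by linarith [hs.1])
  have h3 := mul_le_mul_of_nonneg_right h2 (sub_nonneg.2 h)
  rw [← h']
  unfold framePoly at *
  linarith

lemma frameMax_mono {x y r : ℝ} (h : x ≤ y) : frameMax x r ≤ frameMax y r := by
  obtain ⟨s, hs, h'⟩ := exists_framePoly_eq x r
  have h1 := framePoly_le_frameMax y r hs
  have h3 := mul_le_mul_of_nonneg_left h (pow_nonneg (sub_nonneg.2 hs.2) 3)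
  rw [← h']
  unfold framePoly at *
  linarith

lemma continuous_frameMax (r : ℝ) : Continuous fun x => frameMax x r := by
  refine LipschitzWith.continuous (K := 1) (LipschitzWith.of_le_add fun x y => ?_)
  rcases le_total x y with h | h
  · exact (frameMax_mono h).trans (le_add_of_nonneg_right dist_nonneg)
  · rw [Real.dist_eq, abs_of_nonneg (sub_nonneg.2 h)]
    exact frameMax_le_add h

lemma zero_mem_lagSet : (0 : ℝ) ∈ lagSet := by
  refine ⟨Unit, inferInstance, inferInstance, fun _ _ _ => False, ⟨by simp, by simp⟩, ?_⟩
  exact le_antisymm (lagr_le_of_forall fun w _ => (lagPoly_false w).le) (lagr_nonneg _)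

lemma exists_frame_fixed_point {r₀ : ℝ} (h0 : 0 ≤ r₀) (h1 : r₀ < 1) :
    ∃ l σ : ℝ, 0 < l ∧ l < 1 ∧ 0 < σ ∧ σ < 1 ∧
      ∀ s, framePoly l r₀ s = l - s * (l + 3 - r₀) * (s - σ) ^ 2 := by
  set q := √((3 - 2 * r₀) ^ 2 + 3) with hq
  have hq2 : q ^ 2 = (3 - 2 * r₀) ^ 2 + 3 := Real.sq_sqrt (by positivity)
  have hq0 : 0 ≤ q := Real.sqrt_nonneg _
  have hl : 0 < q - (3 - 2 * r₀) := by nlinarith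
  have hl1 : q - (3 - 2 * r₀) < 1 := by nlinarith
  set l := q - (3 - 2 * r₀) with hl'
  have heq : l ^ 2 + (6 - 4 * r₀) * l - 3 = 0 := by rw [hl']; nlinarith
  have ha : 0 < l + 3 - r₀ := by linarith
  refine ⟨l, 3 * (l + 1) / (2 * (l + 3 - r₀)), hl, hl1, by positivity, ?_, fun s => ?_⟩
  · rw [div_lt_one (by positivity)]; linarith
  · set σ := 3 * (l + 1) / (2 * (l + 3 - r₀)) with hσ
    have e1 : 2 * (l + 3 - r₀) * σ = 3 * (l + 1) := by rw [hσ]; field_simp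
    have e2 : (l + 3 - r₀) * σ ^ 2 = 3 * l := by
      rw [hσ, div_pow, mul_pow]
      field_simp
      linarith
    unfold framePoly
    linear_combination (-s ^ 2) * e1 + s * e2

/-- `r₀` is approached from above by Lagrangians whose distances to `r₀` have all ratios close
to one. -/
def DenselyApproached (r₀ : ℝ) : Prop :=
  ∀ c, 0 < c → ∃ ρ₀, 0 < ρ₀ ∧ ∀ ρ, 0 < ρ → ρ < ρ₀ →
    ∃ r ∈ lagSet, r₀ + (1 - c) * ρ ≤ r ∧ r < r₀ + ρ

lemma exists_frame_crossing {r₀ l σ : ℝ} (hr1 : r₀ < 1) (hl : 0 < l)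
    (hσ : 0 < σ) (hσ1 : σ < 1)
    (hgap : ∀ s, framePoly l r₀ s = l - s * (l + 3 - r₀) * (s - σ) ^ 2)
    (H : DenselyApproached r₀) :
    ∃ v₀, 0 < v₀ ∧ v₀ ≤ 1 ∧ ∀ v, 0 < v → v ≤ v₀ → ∃ r ∈ lagSet,
      frameMax l r < l + v ∧ l + v < frameMax (l + v) r := by
  set q := 1 - (1 - σ) ^ 3 with hq
  have hq1 : q < 1 := by
    have : 0 < (1 - σ) ^ 3 := pow_pos (by linarith) 3
    linarith
  have hs : ∀ᶠ s in nhdsWithin σ (Set.Ioi σ), s ^ 3 * q < σ ^ 3 ∧ s < 1 ∧ σ < s := by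
    have c1 : ∀ᶠ s in nhds σ, s ^ 3 * q < σ ^ 3 := by
      have hc : Continuous fun s : ℝ => s ^ 3 * q := by fun_prop
      refine hc.continuousAt.eventually_lt continuousAt_const ?_
      exact mul_lt_of_lt_one_right (by positivity) hq1
    have c2 : ∀ᶠ s in nhds σ, s < 1 := eventually_lt_nhds hσ1
    filter_upwards [nhdsWithin_le_nhds c1, nhdsWithin_le_nhds c2, self_mem_nhdsWithin]
      with s h1 h2 h3 using ⟨h1, h2, h3⟩
  obtain ⟨s₁, hs1, hs1', hs1''⟩ := hs.exists
  have hs0 : 0 < s₁ := hσ.trans hs1''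
  set c := (1 - s₁ ^ 3 * q / σ ^ 3) / 2 with hc
  have hc0 : 0 < c := by
    have : s₁ ^ 3 * q / σ ^ 3 < 1 := (div_lt_one (by positivity)).2 hs1
    linarith
  have hc1 : s₁ ^ 3 * q < (1 - c) * σ ^ 3 := by
    have e : s₁ ^ 3 * q = (1 - 2 * c) * σ ^ 3 := by rw [hc]; field_simp; ring
    rw [e]
    have : 0 < σ ^ 3 := by positivity
    nlinarith
  obtain ⟨ρ₀, hρ₀, hρ⟩ := H c hc0
  have ha : 0 < l + 3 - r₀ := by linarith
  set γ := s₁ * (l + 3 - r₀) * (s₁ - σ) ^ 2 with hγ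
  have hγ0 : 0 < γ := by
    have : 0 < s₁ - σ := sub_pos.2 hs1''
    positivity
  refine ⟨s₁ ^ 3 * (min (min ρ₀ γ) 1 / 2), by positivity, ?_, fun v hv hv₀ => ?_⟩
  · have := pow_le_one₀ (n := 3) hs0.le hs1'.le
    have h2 : min (min ρ₀ γ) 1 / 2 ≤ 1 := by linarith [min_le_right (min ρ₀ γ) 1]
    exact mul_le_one₀ this (by positivity) h2
  have hs3 : 0 < s₁ ^ 3 := by positivity
  set ρ := v / s₁ ^ 3 with hρv
  have hvρ : v = s₁ ^ 3 * ρ := by rw [hρv]; field_simp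
  have hρ0 : 0 < ρ := by positivity
  have hρ1 : ρ ≤ min (min ρ₀ γ) 1 / 2 := by
    rw [hvρ] at hv₀
    exact le_of_mul_le_mul_left hv₀ hs3
  have hm : 0 < min (min ρ₀ γ) 1 := by positivity
  have hρρ₀ : ρ < ρ₀ := by
    linarith [(min_le_left (min ρ₀ γ) 1).trans (min_le_left ρ₀ γ)]
  have hργ : ρ < γ := by
    linarith [(min_le_left (min ρ₀ γ) 1).trans (min_le_right ρ₀ γ)]
  obtain ⟨r, hr, hr1, hr2⟩ := hρ ρ hρ0 hρρ₀
  have hadd : ∀ x s, framePoly x r s =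
      framePoly l r₀ s + (1 - s) ^ 3 * (x - l) + s ^ 3 * (r - r₀) := fun x s => by
    unfold framePoly; ring
  refine ⟨r, hr, ?_, ?_⟩
  · obtain ⟨s, ⟨h0s, hs1s⟩, h⟩ := exists_framePoly_eq l r
    rw [← h, hadd, hgap]
    have e0 : s ^ 3 * (r - r₀) ≤ s ^ 3 * ρ := by gcongr; linarith
    rcases le_total s s₁ with hss | hss
    · have e1 : 0 ≤ s * (l + 3 - r₀) * (s - σ) ^ 2 := by positivity
      rcases hss.eq_or_lt with rfl | hlt
      · have e2 : s ^ 3 * (r - r₀) < s ^ 3 * ρ := by gcongr; linarith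
        rw [hvρ]; linarith
      · have e2 : s ^ 3 * ρ < s₁ ^ 3 * ρ := by gcongr
        rw [hvρ]; linarith
    · have e1 : γ ≤ s * (l + 3 - r₀) * (s - σ) ^ 2 := by
        have : 0 < s₁ - σ := sub_pos.2 hs1''
        rw [hγ]; gcongr
      have e2 : s ^ 3 * ρ ≤ ρ := mul_le_of_le_one_left hρ0.le (pow_le_one₀ h0s hs1s)
      linarith
  · refine lt_of_lt_of_le ?_ (framePoly_le_frameMax (l + v) r ⟨hσ.le, hσ1.le⟩)
    rw [hadd, hgap]
    have e1 : σ ^ 3 * ((1 - c) * ρ) ≤ σ ^ 3 * (r - r₀) := by gcongr; linarith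
    have e2 : s₁ ^ 3 * q * ρ < (1 - c) * σ ^ 3 * ρ := by gcongr
    have e3 : (1 - σ) ^ 3 * v = v - s₁ ^ 3 * q * ρ := by rw [hvρ, hq]; ring
    have e4 : l + v - l = v := by ring
    rw [e4, e3]
    simp only [sub_self]
    linarith

lemma Icc_subset_closure_lagSet {r₀ : ℝ} (h0 : 0 ≤ r₀) (h1 : r₀ < 1)
    (H : DenselyApproached r₀) :
    ∃ α β : ℝ, α < β ∧ Set.Icc α β ⊆ closure lagSet := by
  obtain ⟨l, σ, hl, hl1, hσ, hσ1, hgap⟩ := exists_frame_fixed_point h0 h1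
  obtain ⟨v₀, hv₀, hv1, hcross⟩ := exists_frame_crossing h1 hl hσ hσ1 hgap H
  set θ := (1 - l / 3) ^ 3 with hθ
  have hθ0 : 0 ≤ θ := pow_nonneg (by linarith) 3
  have hθ1 : θ < 1 := pow_lt_one₀ (by linarith) (by linarith) (by norm_num)
  have key : ∀ n : ℕ, ∀ x, l < x → x ≤ l + v₀ → ∃ y ∈ lagSet, y ≤ x ∧ x - 2 * θ ^ n ≤ y := by
    intro n
    induction n with
    | zero => exact fun x hx hx' => ⟨0, zero_mem_lagSet, by linarith, by simp; linarith⟩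
    | succ n ih =>
      intro x hx hx'
      obtain ⟨r, hr, hr1, hr2⟩ := hcross (x - l) (by linarith) (by linarith)
      rw [add_sub_cancel] at hr1 hr2
      obtain ⟨z, ⟨hz1, hz2⟩, hz⟩ := intermediate_value_Icc hx.le
        (continuous_frameMax r).continuousOn ⟨hr1.le, hr2.le⟩
      simp only at hz
      have hlz : l < z := hz1.lt_of_ne fun h => by rw [h] at hr1; linarith
      have hzx : z < x := hz2.lt_of_ne fun h => by rw [← h] at hr2; linarith
      obtain ⟨y, hy, hyz, hzy⟩ := ih z hlz (by linarith)
      refine ⟨frameMax y r, frameMax_mem_lagSet hy hr, hz ▸ frameMax_mono hyz, ?_⟩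
      obtain ⟨s, ⟨hs0, hs1⟩, hs⟩ := exists_framePoly_eq z r
      have hsl : l / 3 ≤ s := by
        by_contra! hlt
        have hr1 : r ≤ 1 := by
          obtain ⟨C, _, _, A, -, rfl⟩ := hr
          exact lagr_le_one A
        have e1 : z < framePoly z r s := by rw [hs, hz]; exact hzx
        have e2 : framePoly z r s ≤ (1 - s) ^ 3 * z + 3 * s ^ 2 := by
          unfold framePoly
          have e3 := mul_le_mul_of_nonneg_left hr1 (pow_nonneg hs0 3)
          have e4 := pow_nonneg hs0 3
          linarith
        have e5 : (1 - s) ^ 3 ≤ 1 - s := by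
          have := mul_nonneg (mul_nonneg hs0 (sub_nonneg.2 hs1)) (by linarith : 0 ≤ 2 - s)
          linarith
        have e6 := mul_le_mul_of_nonneg_right e5 (hl.trans hlz).le
        nlinarith
      have e1 := framePoly_le_frameMax y r ⟨hs0, hs1⟩
      have e2 : framePoly y r s = x - (1 - s) ^ 3 * (z - y) := by
        rw [← hz, ← hs]; unfold framePoly; ring
      have e3 : (1 - s) ^ 3 * (z - y) ≤ θ * (2 * θ ^ n) := by
        have : 0 ≤ 1 - s := by linarith
        have e4 : (1 - s) ^ 3 ≤ θ := by rw [hθ]; gcongr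
        exact mul_le_mul e4 (by linarith) (by linarith) hθ0
      rw [pow_succ]
      linarith
  refine ⟨l + v₀ / 2, l + v₀, by linarith, fun x hx => Metric.mem_closure_iff.2 fun ε hε => ?_⟩
  obtain ⟨n, hn⟩ := exists_pow_lt_of_lt_one (by positivity : 0 < ε / 2) hθ1
  obtain ⟨y, hy, hy1, hy2⟩ := key n x (by linarith [hx.1]) hx.2
  refine ⟨y, hy, ?_⟩
  rw [Real.dist_eq, abs_lt]
  constructor <;> linarith

section
open scoped Pointwise
variable {t : ℕ} [Fact t.Prime] {x : ZMod t → ℝ}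

lemma sum_reflect_sq (x : ZMod t → ℝ) (a : ZMod t) : ∑ i, x (a - i) ^ 2 = ∑ i, x i ^ 2 :=
  (Equiv.subLeft a).sum_comp fun i => x i ^ 2

lemma sum_reflect_mul_le (x : ZMod t → ℝ) (a : ZMod t) :
    ∑ i, x i * x (a - i) ≤ ∑ i, x i ^ 2 := by
  have h : ∀ i, x i * x (a - i) ≤ (x i ^ 2 + x (a - i) ^ 2) / 2 := fun i => by
    nlinarith [sq_nonneg (x i - x (a - i))]
  refine (Finset.sum_le_sum fun i _ => h i).trans_eq ?_
  rw [← Finset.sum_div, Finset.sum_add_distrib, sum_reflect_sq]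
  ring

lemma sum_translates (x : ZMod t → ℝ) : ∑ τ, ∑ j, x j * x (j + τ) = (∑ i, x i) ^ 2 := by
  rw [Finset.sum_comm, sq, Finset.sum_mul]
  refine Finset.sum_congr rfl fun j _ => ?_
  rw [← Finset.mul_sum]
  congr 1
  exact Equiv.sum_comp (Equiv.addLeft j) x

lemma translate_of_reflect {S δ : ℝ} (hS : ∑ i, x i ^ 2 = S) {a b : ZMod t}
    (ha : (1 - δ) * S ≤ ∑ i, x i * x (a - i)) (hb : (1 - δ) * S ≤ ∑ i, x i * x (b - i)) :
    (1 - 4 * δ) * S ≤ ∑ j, x j * x (j + (b - a)) := by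
  have h1 : ∑ j, x j * x (j + (b - a)) = ∑ i, x (a - i) * x (b - i) := by
    rw [← (Equiv.subLeft a).sum_comp]
    refine Finset.sum_congr rfl fun i _ => ?_
    simp only [Equiv.subLeft_apply]
    congr 2; ring
  have h2 : ∀ i, (2 * (x i * x (a - i)) + 2 * (x i * x (b - i))) ≤
      x (a - i) * x (b - i) + 2 * x i ^ 2 + (x (a - i) ^ 2 + x (b - i) ^ 2) / 2 := fun i => by
    nlinarith [sq_nonneg (2 * x i - x (a - i) - x (b - i))]
  have h3 := Finset.sum_le_sum fun i (_ : i ∈ Finset.univ) => h2 i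
  simp only [Finset.sum_add_distrib, ← Finset.mul_sum, ← Finset.sum_div, sum_reflect_sq, hS] at h3
  rw [h1]
  linarith

/-- If the number of weighted solutions of `i + j + k = d` is close to its maximum, then the weight
is either nearly concentrated in one point, which the second hypothesis excludes, or spread out. -/
lemma spread_of_many_solutions (hx : ∀ i, 0 ≤ x i) {z S T : ℝ} (hz : ∑ i, x i = z)
    (hS : ∑ i, x i ^ 2 = S) (hS0 : 0 < S) (d : ZMod t)
    (hT1 : T ≤ ∑ k, x k * ∑ i, x i * x (d - k - i)) (hT2 : T ≤ z * (z ^ 2 - S))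
    (hT : (1 - 1 / 400) * (z * S) ≤ T) : t * S ≤ 5 / 4 * z ^ 2 := by
  classical
  have hz0 : 0 < z := by
    refine (hz ▸ Finset.sum_nonneg fun i _ => hx i : 0 ≤ z).lt_of_ne fun h => ?_
    rw [← h] at hz
    have := (Finset.sum_eq_zero_iff_of_nonneg fun i _ => hx i).1 hz
    have h0 : ∑ i, x i ^ 2 = 0 := Finset.sum_eq_zero fun i hi => by rw [this i hi]; simp
    linarith
  set ρ : ZMod t → ℝ := fun k => ∑ i, x i * x (d - k - i) with hρ
  have hρS : ∀ k, ρ k ≤ S := fun k => hS ▸ sum_reflect_mul_le x (d - k)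
  set X : Finset (ZMod t) := Finset.univ.filter fun k => (1 - 1 / 20) * S ≤ ρ k with hX
  -- the weight of the complement of `X`
  have hXc : 19 / 20 * z ≤ ∑ k ∈ X, x k := by
    have h1 : ∀ k, x k * ρ k ≤ x k * S - S / 20 * (if k ∈ X then 0 else x k) := fun k => by
      split_ifs with hk
      · have := mul_le_mul_of_nonneg_left (hρS k) (hx k)
        linarith
      · have hk' : ρ k ≤ (1 - 1 / 20) * S := by
          simp only [hX, Finset.mem_filter, Finset.mem_univ, true_and, not_le] at hk
          exact hk.le
        have := mul_le_mul_of_nonneg_left hk' (hx k)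
        linarith
    have h2 := hT.trans (hT1.trans (Finset.sum_le_sum fun k _ => h1 k))
    rw [Finset.sum_sub_distrib, ← Finset.sum_mul, hz, ← Finset.mul_sum] at h2
    have h3 : ∑ k, (if k ∈ X then 0 else x k) = z - ∑ k ∈ X, x k := by
      rw [← hz, ← Finset.sum_filter_add_sum_filter_not Finset.univ (· ∈ X) x,
        Finset.sum_ite]
      simp
    rw [h3] at h2
    have h4 : S * (z - ∑ k ∈ X, x k) ≤ S * (z / 20) := by linarith
    have := le_of_mul_le_mul_left h4 hS0
    linarith
  have hXne : X.Nonempty := by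
    by_contra h
    rw [Finset.not_nonempty_iff_eq_empty] at h
    rw [h, Finset.sum_empty] at hXc
    linarith
  have hXS : (19 / 20 * z) ^ 2 ≤ X.card * S := by
    calc (19 / 20 * z) ^ 2 ≤ (∑ k ∈ X, x k) ^ 2 := by gcongr
      _ ≤ X.card * ∑ k ∈ X, x k ^ 2 := sq_sum_le_card_mul_sum_sq
      _ ≤ _ := by
        rw [← hS]
        gcongr
        exact Finset.subset_univ _
  have hdiff : (X - X).card * (4 / 5 * S) ≤ z ^ 2 := by
    have h1 : ∀ τ ∈ X - X, 4 / 5 * S ≤ ∑ j, x j * x (j + τ) := by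
      intro τ hτ
      obtain ⟨k, hk, l, hl, rfl⟩ := Finset.mem_sub.1 hτ
      simp only [hX, Finset.mem_filter, Finset.mem_univ, true_and, hρ] at hk hl
      have := translate_of_reflect hS hk hl
      have e : d - l - (d - k) = k - l := by ring
      rw [e] at this
      linarith
    rw [← hz, ← sum_translates, ← nsmul_eq_mul, ← Finset.sum_const]
    refine (Finset.sum_le_sum h1).trans
      (Finset.sum_le_univ_sum_of_nonneg (s := X - X) (f := fun τ => ∑ j, x j * x (j + τ)) fun τ => ?_)
    exact Finset.sum_nonneg fun j _ => mul_nonneg (hx _) (hx _)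
  have hcd := ZMod.cauchy_davenport (Fact.out : t.Prime) hXne hXne.neg
  rw [Finset.card_neg, ← sub_eq_add_neg] at hcd
  rcases min_le_iff.1 hcd with h | h
  · have h' : (t : ℝ) ≤ (X - X).card := by exact_mod_cast h
    have : (t : ℝ) * (4 / 5 * S) ≤ z ^ 2 := le_trans (by gcongr) hdiff
    linarith
  · exfalso
    have h' : 2 * (X.card : ℝ) - 1 ≤ (X - X).card := by
      have : 2 * X.card ≤ (X - X).card + 1 := by omega
      have : 2 * (X.card : ℝ) ≤ (X - X).card + 1 := by exact_mod_cast this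
      linarith
    have h2 : (2 * (X.card : ℝ) - 1) * (4 / 5 * S) ≤ z ^ 2 := le_trans (by gcongr) hdiff
    have h3 : 55 / 100 * z ^ 2 ≤ S := by linarith
    have h4 : z * ((1 - 1 / 400) * S) ≤ z * (z ^ 2 - S) := by linarith
    have h5 := le_of_mul_le_mul_left h4 hz0
    nlinarith [sq_pos_of_pos hz0]
end

/-- The symmetric relation of a family of triples. -/
def tripleRel {I : Type*} [DecidableEq I] (E : Finset (Finset I)) (i j k : I) : Prop :=
  {i, j, k} ∈ E

lemma symRel_tripleRel {I : Type*} [DecidableEq I] (E : Finset (Finset I)) :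
    SymRel (tripleRel E) := by
  constructor
  · intro a b c h
    unfold tripleRel at *
    rwa [Finset.insert_comm] at h
  · intro a b c h
    unfold tripleRel at *
    rwa [Finset.pair_comm] at h

lemma lagPoly_tripleRel_le_add {I : Type*} [DecidableEq I] [Fintype I] (E : Finset (Finset I))
    {e : Finset I} (he : e.card = 3) {x : I → ℝ} {M : ℝ} (hx : ∀ i, 0 ≤ x i)
    (hM : ∀ i, x i ≤ M) :
    lagPoly (tripleRel E) x ≤ lagPoly (tripleRel (E.erase e)) x + 6 * M ^ 3 := by
  have h := sum_triples_eq {e} (by simpa using he) (Finset.univ : Finset I)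
  have h6 : ((({e} : Finset (Finset I)).filter (fun e => e ⊆ Finset.univ)).card : ℝ) = 1 := by
    simp
  rw [h6, mul_one] at h
  rw [← h, Finset.sum_mul, lagPoly, lagPoly, ← Finset.sum_add_distrib]
  refine Finset.sum_le_sum fun i _ => ?_
  rw [Finset.sum_mul, ← Finset.sum_add_distrib]
  refine Finset.sum_le_sum fun j _ => ?_
  rw [Finset.sum_mul, ← Finset.sum_add_distrib]
  refine Finset.sum_le_sum fun k _ => ?_
  have hi := hx i; have hj := hx j; have hk := hx k
  have h3 : x i * x j * x k ≤ M ^ 3 := by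
    have hM0 : 0 ≤ M := hi.trans (hM i)
    calc x i * x j * x k ≤ M * M * M := by gcongr <;> apply hM
      _ = M ^ 3 := by ring
  have h4 : 0 ≤ x i * x j * x k := by positivity
  unfold ind tripleRel
  by_cases h1 : ({i, j, k} : Finset I) = e
  · simp only [h1, Finset.mem_erase, ne_eq, not_true_eq_false, false_and, if_false,
      Finset.mem_singleton, if_true]
    split_ifs <;> linarith
  · simp [h1]

section
variable {t : ℕ} [Fact t.Prime] {x : ZMod t → ℝ}

/-- The three-element subsets of `ZMod t` with sum `0`, `1` or `2`. -/
def sumTriples (t : ℕ) [Fact t.Prime] : Finset (Finset (ZMod t)) :=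
  Finset.univ.filter fun e => e.card = 3 ∧ ∑ i ∈ e, i ∈ ({0, 1, 2} : Finset (ZMod t))

lemma card_of_mem_sumTriples {e : Finset (ZMod t)} (he : e ∈ sumTriples t) : e.card = 3 :=
  (Finset.mem_filter.1 he).2.1

lemma card_triple_iff {I : Type*} [DecidableEq I] {i j k : I} :
    ({i, j, k} : Finset I).card = 3 ↔ i ≠ j ∧ i ≠ k ∧ j ≠ k := by
  constructor
  · intro h
    refine ⟨?_, ?_, ?_⟩ <;> rintro rfl
    · have := Finset.card_le_two (a := i) (b := k)
      simp at h; omega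
    · have := Finset.card_le_two (a := j) (b := i)
      rw [Finset.insert_comm] at h
      simp at h; omega
    · have := Finset.card_le_two (a := i) (b := j)
      simp at h; omega
  · rintro ⟨h1, h2, h3⟩
    exact Finset.card_eq_three.2 ⟨i, j, k, h1, h2, h3, rfl⟩

lemma triple_mem_sumTriples {i j k : ZMod t} : ({i, j, k} : Finset (ZMod t)) ∈ sumTriples t ↔
    (i ≠ j ∧ i ≠ k ∧ j ≠ k) ∧ i + j + k ∈ ({0, 1, 2} : Finset (ZMod t)) := by
  rw [sumTriples, Finset.mem_filter, card_triple_iff]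
  simp only [Finset.mem_univ, true_and]
  refine and_congr_right fun ⟨h1, h2, h3⟩ => ?_
  rw [Finset.sum_insert (by simp [h1, h2]), Finset.sum_insert (by simp [h3]), Finset.sum_singleton,
    add_assoc]

/-- Weighted solutions of `i + j + k = d` with `i ≠ j`. -/
noncomputable def solSum (x : ZMod t → ℝ) (d : ZMod t) : ℝ :=
  ∑ i, ∑ j, if i = j then 0 else x i * x j * x (d - i - j)

lemma solSum_le_reflect (hx : ∀ i, 0 ≤ x i) (d : ZMod t) :
    solSum x d ≤ ∑ k, x k * ∑ i, x i * x (d - k - i) := by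
  refine Finset.sum_le_sum fun i _ => ?_
  rw [Finset.mul_sum]
  refine Finset.sum_le_sum fun j _ => ?_
  have hi := hx i; have hj := hx j; have hk := hx (d - i - j)
  split_ifs
  · positivity
  · exact (mul_assoc _ _ _).le

lemma solSum_le_mul (hx : ∀ i, 0 ≤ x i) (d : ZMod t) :
    solSum x d ≤ (∑ i, x i) * ∑ i, x i ^ 2 := by
  refine (solSum_le_reflect hx d).trans ?_
  rw [Finset.sum_mul]
  exact Finset.sum_le_sum fun k _ =>
    mul_le_mul_of_nonneg_left (sum_reflect_mul_le x (d - k)) (hx k)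

lemma sum_offDiag_eq (x : ZMod t → ℝ) : ∑ i, ∑ j, (if i = j then 0 else x i * x j) =
    (∑ i, x i) ^ 2 - ∑ i, x i ^ 2 := by
  rw [sq (∑ i, x i), Finset.sum_mul_sum, eq_sub_iff_add_eq, ← Finset.sum_add_distrib]
  refine Finset.sum_congr rfl fun i _ => ?_
  have h : x i ^ 2 = ∑ j, if i = j then x i * x j else 0 := by simp [sq]
  rw [h, ← Finset.sum_add_distrib]
  refine Finset.sum_congr rfl fun j _ => ?_
  split_ifs <;> simp

lemma solSum_le_offDiag (hx : ∀ i, 0 ≤ x i) (d : ZMod t) :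
    solSum x d ≤ (∑ i, x i) * ((∑ i, x i) ^ 2 - ∑ i, x i ^ 2) := by
  rw [← sum_offDiag_eq, solSum, Finset.mul_sum]
  refine Finset.sum_le_sum fun i _ => ?_
  rw [Finset.mul_sum]
  refine Finset.sum_le_sum fun j _ => ?_
  split_ifs
  · simp
  · rw [mul_comm]
    exact mul_le_mul_of_nonneg_right (Finset.single_le_sum (f := x) (fun i _ => hx i) (Finset.mem_univ _))
      (mul_nonneg (hx i) (hx j))

lemma sum_shift (f : ZMod t → ℝ) (i j : ZMod t) : ∑ k, f k = ∑ d, f (d - i - j) := by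
  simp_rw [sub_sub]
  exact (Equiv.sum_comp (Equiv.subRight (i + j)) f).symm

lemma lagPoly_tripleRel_le_sum {E : Finset (Finset (ZMod t))} (hE : E ⊆ sumTriples t)
    (hx : ∀ i, 0 ≤ x i) : lagPoly (tripleRel E) x ≤ ∑ d ∈ {0, 1, 2}, solSum x d := by
  have hcomm : ∑ d ∈ ({0, 1, 2} : Finset (ZMod t)), solSum x d =
      ∑ i, ∑ j, ∑ d ∈ ({0, 1, 2} : Finset (ZMod t)),
        if i = j then 0 else x i * x j * x (d - i - j) := by
    unfold solSum
    rw [Finset.sum_comm]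
    exact Finset.sum_congr rfl fun i _ => Finset.sum_comm
  rw [hcomm, lagPoly]
  refine Finset.sum_le_sum fun i _ => Finset.sum_le_sum fun j _ => ?_
  rw [sum_shift _ i j]
  refine (Finset.sum_le_sum (g := fun d => if d ∈ ({0, 1, 2} : Finset (ZMod t)) then
    (if i = j then 0 else x i * x j * x (d - i - j)) else 0) fun d _ => ?_).trans_eq ?_
  · have hi := hx i; have hj := hx j; have hk := hx (d - i - j)
    unfold ind
    split_ifs with h1 h2 h3
    · exact absurd h3 (triple_mem_sumTriples.1 (hE h1)).1.1
    · simp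
    · refine absurd (triple_mem_sumTriples.1 (hE h1)).2 ?_
      rwa [show i + j + (d - i - j) = d by ring]
    · simp
    · rw [zero_mul]; positivity
    · simp
  · rw [Finset.sum_ite_mem, Finset.univ_inter]

lemma card_zero_one_two_le : (({0, 1, 2} : Finset (ZMod t)).card : ℝ) ≤ 3 := by
  exact_mod_cast Finset.card_le_three

lemma lagPoly_tripleRel_le_mul {E : Finset (Finset (ZMod t))} (hE : E ⊆ sumTriples t)
    (hx : ∀ i, 0 ≤ x i) : lagPoly (tripleRel E) x ≤ 3 * ((∑ i, x i) * ∑ i, x i ^ 2) := by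
  refine (lagPoly_tripleRel_le_sum hE hx).trans
    ((Finset.sum_le_card_nsmul _ _ _ fun d _ => solSum_le_mul hx d).trans ?_)
  rw [nsmul_eq_mul]
  refine mul_le_mul_of_nonneg_right card_zero_one_two_le ?_
  exact mul_nonneg (Finset.sum_nonneg fun i _ => hx i) (Finset.sum_nonneg fun i _ => sq_nonneg _)

lemma lagPoly_tripleRel_le_offDiag {E : Finset (Finset (ZMod t))} (hE : E ⊆ sumTriples t)
    (hx : ∀ i, 0 ≤ x i) :
    lagPoly (tripleRel E) x ≤ (∑ i, x i) * ((∑ i, x i) ^ 2 - ∑ i, x i ^ 2) := by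
  rw [← sum_offDiag_eq, mul_comm, Finset.sum_mul]
  refine Finset.sum_le_sum fun i _ => ?_
  rw [Finset.sum_mul]
  refine Finset.sum_le_sum fun j _ => ?_
  rw [Finset.mul_sum]
  refine Finset.sum_le_sum fun k _ => ?_
  have hi := hx i; have hj := hx j; have hk := hx k
  unfold ind
  split_ifs with h1 h2
  · exact absurd h2 (triple_mem_sumTriples.1 (hE h1)).1.1
  · simp
  · simp
  · rw [zero_mul]; positivity

/-- If a family of triples of the prescribed sums is nearly as dense as possible with respect to a
weight, then this weight is spread out. -/
lemma spread_of_dense_triples {E : Finset (Finset (ZMod t))} (hE : E ⊆ sumTriples t)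
    (hx : ∀ i, 0 ≤ x i) (hS0 : 0 < ∑ i, x i ^ 2)
    (h : 3 * (1 - 1 / 1200) * ((∑ i, x i) * ∑ i, x i ^ 2) ≤ lagPoly (tripleRel E) x) :
    t * ∑ i, x i ^ 2 ≤ 5 / 4 * (∑ i, x i) ^ 2 := by
  have h1 := h.trans (lagPoly_tripleRel_le_sum hE hx)
  set P := (∑ i, x i) * ∑ i, x i ^ 2 with hP
  have hP0 : 0 ≤ P :=
    mul_nonneg (Finset.sum_nonneg fun i _ => hx i) (Finset.sum_nonneg fun i _ => sq_nonneg _)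
  have h2 : ∃ d ∈ ({0, 1, 2} : Finset (ZMod t)), (1 - 1 / 400) * P ≤ solSum x d := by
    by_contra! hlt
    have h3 := Finset.sum_lt_sum_of_nonempty (by simp) hlt
    rw [Finset.sum_const, nsmul_eq_mul] at h3
    have h4 := mul_le_mul_of_nonneg_right (card_zero_one_two_le (t := t))
      (by linarith : 0 ≤ (1 - 1 / 400) * P)
    linarith
  obtain ⟨d, -, hd⟩ := h2
  exact spread_of_many_solutions hx rfl rfl hS0 d (solSum_le_reflect hx d)
    (solSum_le_offDiag hx d) hd

lemma le_lagPoly_sumTriples (ht : 2 < t) {y : ℝ} (hy : 0 ≤ y) :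
    3 * ((t : ℝ) ^ 2 - 3 * t) * y ^ 3 ≤ lagPoly (tripleRel (sumTriples t)) fun _ => y := by
  have hcard : (({0, 1, 2} : Finset (ZMod t)).card : ℝ) = 3 := by
    have hp : (Fact.out : t.Prime).two_le = ht.le := rfl
    have h2 : (2 : ZMod t) ≠ 0 := by
      have : ((2 : ℕ) : ZMod t) ≠ 0 := by
        rw [Ne, ZMod.natCast_eq_zero_iff]
        exact fun h => absurd (Nat.le_of_dvd (by norm_num) h) (by omega)
      exact_mod_cast this
    have h1 : (1 : ZMod t) ≠ 2 := fun h => one_ne_zero (α := ZMod t) (by linear_combination -h)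
    have : ({0, 1, 2} : Finset (ZMod t)).card = 3 :=
      card_triple_iff.2 ⟨zero_ne_one, h2.symm, h1⟩
    exact_mod_cast this
  have key : ∀ i j : ZMod t, ∑ d ∈ ({0, 1, 2} : Finset (ZMod t)), (1 - (if i = j then (1 : ℝ) else 0) -
      (if j = d - i - i then 1 else 0) - (if i = d - j - j then 1 else 0)) ≤
      ∑ k, ind (tripleRel (sumTriples t)) i j k := by
    intro i j
    rw [sum_shift _ i j]
    refine (Finset.sum_le_sum fun d hd => ?_).trans
      (Finset.sum_le_univ_sum_of_nonneg (s := {0, 1, 2}) fun d => ind_nonneg _ _ _ _)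
    by_cases h1 : i = j
    · rw [if_pos h1]
      refine le_trans ?_ (ind_nonneg _ _ _ _)
      split_ifs <;> norm_num
    by_cases h2 : j = d - i - i
    · rw [if_pos h2]
      refine le_trans ?_ (ind_nonneg _ _ _ _)
      split_ifs <;> norm_num
    by_cases h3 : i = d - j - j
    · rw [if_neg h1, if_neg h2, if_pos h3]
      simpa using ind_nonneg _ _ _ _
    have h4 : tripleRel (sumTriples t) i j (d - i - j) := by
      refine triple_mem_sumTriples.2 ⟨⟨h1, fun h => h2 ?_, fun h => h3 ?_⟩, ?_⟩
      · linear_combination h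
      · linear_combination h
      · rwa [show i + j + (d - i - j) = d by ring]
    simp [ind, h1, h2, h3, h4]
  have hsum : ∑ i : ZMod t, ∑ j : ZMod t, ∑ d ∈ ({0, 1, 2} : Finset (ZMod t)),
      (1 - (if i = j then (1 : ℝ) else 0) -
      (if j = d - i - i then 1 else 0) - (if i = d - j - j then 1 else 0)) =
      3 * ((t : ℝ) ^ 2 - 3 * t) := by
    have hd : ∀ d : ZMod t, ∑ i : ZMod t, ∑ j : ZMod t, (1 - (if i = j then (1 : ℝ) else 0) -
        (if j = d - i - i then 1 else 0) - (if i = d - j - j then 1 else 0)) =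
        (t : ℝ) ^ 2 - 3 * t := by
      intro d
      simp only [Finset.sum_sub_distrib]
      rw [Finset.sum_comm (f := fun i j : ZMod t => if i = d - j - j then (1 : ℝ) else 0)]
      simp
      ring
    simp_rw [fun i : ZMod t => Finset.sum_comm (s := Finset.univ) (t := ({0, 1, 2} : Finset (ZMod t)))
      (f := fun j d => (1 - (if i = j then (1 : ℝ) else 0) -
      (if j = d - i - i then 1 else 0) - (if i = d - j - j then 1 else 0)))]
    rw [Finset.sum_comm]
    simp only [hd, Finset.sum_const, nsmul_eq_mul, hcard]
  rw [← hsum, lagPoly, Finset.sum_mul]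
  refine Finset.sum_le_sum fun i _ => ?_
  rw [Finset.sum_mul]
  refine Finset.sum_le_sum fun j _ => ?_
  rw [← Finset.sum_mul]
  have := mul_le_mul_of_nonneg_right (key i j) (pow_nonneg hy 3)
  refine this.trans_eq ?_
  ring
end

lemma lagPoly_not_all_eq {C : Type*} [Fintype C] (w : C → ℝ) :
    lagPoly (fun a b c => ¬ (a = b ∧ b = c)) w = (∑ a, w a) ^ 3 - ∑ a, w a ^ 3 := by
  classical
  rw [sum_cube_eq, eq_sub_iff_add_eq, lagPoly, ← Finset.sum_add_distrib]
  refine Finset.sum_congr rfl fun a _ => ?_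
  have h : w a ^ 3 = ∑ b, ∑ c, if a = b then (if b = c then w a * w b * w c else 0) else 0 := by
    simp [pow_three']
  rw [h, ← Finset.sum_add_distrib]
  refine Finset.sum_congr rfl fun b _ => ?_
  rw [← Finset.sum_add_distrib]
  refine Finset.sum_congr rfl fun c _ => ?_
  by_cases h2 : b = c
  · subst h2
    by_cases h1 : a = b <;> simp [ind, h1]
  · by_cases h1 : a = b <;> simp [ind, h1, h2]

lemma exists_lagr_near_one {ε : ℝ} (hε : 0 < ε) : ∃ (n : ℕ)
    (A : Fin (n + 1) → Fin (n + 1) → Fin (n + 1) → Prop),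
    SymRel A ∧ 1 - ε ≤ lagr A ∧ lagr A < 1 := by
  obtain ⟨n, hn⟩ := exists_nat_one_div_lt hε
  refine ⟨n, fun a b c => ¬ (a = b ∧ b = c), ⟨?_, ?_⟩, ?_, ?_⟩
  · rintro a b c h ⟨rfl, rfl⟩; exact h ⟨rfl, rfl⟩
  · rintro a b c h ⟨rfl, rfl⟩; exact h ⟨rfl, rfl⟩
  · have hn0 : (0 : ℝ) < n + 1 := by positivity
    refine le_trans ?_ (lagPoly_le_lagr (w := fun _ => 1 / ((n : ℝ) + 1)) ⟨fun _ => ?_, ?_⟩)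
    · rw [lagPoly_not_all_eq]
      simp only [Finset.sum_const, Finset.card_univ, Fintype.card_fin, nsmul_eq_mul]
      push_cast
      have e1 : ((n : ℝ) + 1) * (1 / (n + 1)) = 1 := by field_simp
      have e2 : ((n : ℝ) + 1) * (1 / (n + 1)) ^ 3 = (1 / (n + 1)) ^ 2 := by field_simp
      have e3 : 1 / ((n : ℝ) + 1) ≤ 1 := by
        rw [div_le_one hn0]; linarith [Nat.cast_nonneg (α := ℝ) n]
      rw [e1, e2]
      have e4 : 0 < 1 / ((n : ℝ) + 1) := by positivity
      nlinarith
    · positivity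
    · simp only [Finset.sum_const, Finset.card_univ, Fintype.card_fin, nsmul_eq_mul]
      push_cast
      exact (by field_simp : ((n : ℝ) + 1) * (1 / (n + 1)) = 1).le
  · obtain ⟨w, hw, hw1, hw2⟩ :=
      exists_weight_sum_one (C := Fin (n + 1)) fun a b c => ¬ (a = b ∧ b = c)
    rw [← hw2, lagPoly_not_all_eq, hw1]
    have h : 0 < ∑ a, w a ^ 3 := by
      refine (Finset.sum_nonneg fun a _ => pow_nonneg (hw a) 3).lt_of_ne fun h => ?_
      have h0 := (Finset.sum_eq_zero_iff_of_nonneg fun a _ => pow_nonneg (hw a) 3).1 h.symm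
      have : ∑ a, w a = 0 := Finset.sum_eq_zero fun a ha => by simpa using h0 a ha
      linarith
    linarith

/-- The main part of the Lagrangian polynomial of the gadget palettes, when the three kinds of
colours have masses `z`, `b` and `1 - z - b`. -/
def basePoly (δ z b : ℝ) : ℝ :=
  1 - δ * (1 - z - b) ^ 3 - 3 * (1 - z - b) * (z ^ 2 + b ^ 2) - z ^ 3 - b ^ 3 - 3 * b ^ 2 * z

lemma basePoly_add_sub (δ m h : ℝ) : basePoly δ (m + h) (m - h) = basePoly δ m m -
    6 * (1 - 2 * m) * h ^ 2 + 3 * m ^ 2 * h - 3 * m * h ^ 2 - 3 * h ^ 3 := by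
  unfold basePoly; ring

/-- A maximum of `basePoly` on the simplex. -/
structure IsBaseMax (δ r₀ z₀ b₀ : ℝ) : Prop where
  eq : basePoly δ z₀ b₀ = r₀
  le : ∀ z b, 0 ≤ z → 0 ≤ b → z + b ≤ 1 → basePoly δ z b ≤ r₀
  b_pos : 0 < b₀
  b_lt : b₀ < z₀
  add_le : z₀ + b₀ ≤ 1
  lt_one : r₀ < 1

lemma IsBaseMax.one_sub_le {δ r₀ z₀ b₀ : ℝ} (h : IsBaseMax δ r₀ z₀ b₀) : 1 - δ ≤ r₀ := by
  have := h.le 0 0 le_rfl le_rfl (by norm_num)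
  simpa [basePoly] using this

lemma exists_basePoly_max (δ : ℝ) : ∃ z b : ℝ, 0 ≤ z ∧ 0 ≤ b ∧ z + b ≤ 1 ∧
    ∀ z' b', 0 ≤ z' → 0 ≤ b' → z' + b' ≤ 1 → basePoly δ z' b' ≤ basePoly δ z b := by
  have hcpt : IsCompact {p : ℝ × ℝ | 0 ≤ p.1 ∧ 0 ≤ p.2 ∧ p.1 + p.2 ≤ 1} := by
    refine IsCompact.of_isClosed_subset (isCompact_Icc (a := (0 : ℝ × ℝ)) (b := 1)) ?_ ?_
    · exact (isClosed_le continuous_const continuous_fst).inter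
        ((isClosed_le continuous_const continuous_snd).inter
          (isClosed_le (continuous_fst.add continuous_snd) continuous_const))
    · rintro ⟨z, b⟩ ⟨h1, h2, h3⟩
      simp only at h1 h2 h3
      exact ⟨⟨h1, h2⟩, ⟨by simp only [Prod.fst_one]; linarith,
        by simp only [Prod.snd_one]; linarith⟩⟩
  have hcont : Continuous fun p : ℝ × ℝ => basePoly δ p.1 p.2 := by unfold basePoly; fun_prop
  obtain ⟨⟨z, b⟩, ⟨hz, hb, hzb⟩, hmax⟩ :=
    hcpt.exists_isMaxOn ⟨((0 : ℝ), (0 : ℝ)), by simp⟩ hcont.continuousOn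
  refine ⟨z, b, hz, hb, hzb, fun z' b' h1 h2 h3 => ?_⟩
  exact isMaxOn_iff.1 hmax (z', b') ⟨h1, h2, h3⟩

lemma exists_isBaseMax {δ : ℝ} (hδ : 0 < δ) (hδ1 : δ ≤ 1) :
    ∃ r₀ z₀ b₀, IsBaseMax δ r₀ z₀ b₀ := by
  obtain ⟨z, b, hz, hb, hzb, hle⟩ := exists_basePoly_max δ
  obtain ⟨m, h, rfl, rfl⟩ : ∃ m h, z = m + h ∧ b = m - h :=
    ⟨(z + b) / 2, (z - b) / 2, by ring, by ring⟩
  have hm1 : m ≤ 1 / 2 := by linarith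
  have hm : 0 < m := by
    by_contra hm
    have h0 : m = 0 := by linarith
    have h1 : h = 0 := by linarith
    have h2 := hle (δ / 6) (δ / 6) (by positivity) (by positivity) (by linarith)
    have h3 : 0 < basePoly δ (δ / 6) (δ / 6) - (1 - δ) := by
      have : basePoly δ (δ / 6) (δ / 6) - (1 - δ) =
          δ ^ 2 * (5 / 6 - 65 / 216 * δ + δ ^ 2 / 27) := by unfold basePoly; ring
      rw [this]
      have : 0 < 5 / 6 - 65 / 216 * δ + δ ^ 2 / 27 := by nlinarith
      positivity
    have h4 : basePoly δ (m + h) (m - h) = 1 - δ := by rw [h0, h1]; unfold basePoly; ring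
    linarith
  have hg : 0 ≤ 1 - 2 * m := by linarith
  have hbetter : basePoly δ m m < basePoly δ (m + h) (m - h) := by
    refine lt_of_lt_of_le ?_ (hle (m + m ^ 2 / 10) (m - m ^ 2 / 10) (by positivity)
      (by nlinarith) (by linarith))
    rw [basePoly_add_sub]
    have e : -(6 * (1 - 2 * m) * (m ^ 2 / 10) ^ 2) + 3 * m ^ 2 * (m ^ 2 / 10) -
        3 * m * (m ^ 2 / 10) ^ 2 - 3 * (m ^ 2 / 10) ^ 3 =
        m ^ 4 / 1000 * (240 + 90 * m - 3 * m ^ 2) := by ring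
    have : 0 < m ^ 4 / 1000 * (240 + 90 * m - 3 * m ^ 2) := by
      have : 0 < 240 + 90 * m - 3 * m ^ 2 := by nlinarith
      positivity
    linarith
  rw [basePoly_add_sub] at hbetter
  have hh0 : 0 < h := by
    by_contra! hneg
    have e1 : 0 ≤ (1 - 2 * m) * h ^ 2 := by positivity
    have e2 : 0 ≤ h ^ 2 * (m + h) := by positivity
    have e3 : m ^ 2 * h ≤ 0 := mul_nonpos_of_nonneg_of_nonpos (by positivity) hneg
    linarith
  have hhm : h < m := by
    by_contra! hge
    have e0 : h = m := by linarith
    subst e0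
    have e1 : 0 ≤ (1 - 2 * h) * h ^ 2 := by positivity
    have e2 : 0 < h ^ 3 := by positivity
    linarith
  refine ⟨_, m + h, m - h, rfl, hle, by linarith, by linarith, hzb, ?_⟩
  have e1 : 0 < (m + h) ^ 3 := by positivity
  have e2 : 0 ≤ (m - h) ^ 3 := by positivity
  have e3 : 0 ≤ 1 - (m + h) - (m - h) := by linarith
  have e4 : 0 ≤ δ * (1 - (m + h) - (m - h)) ^ 3 := by positivity
  have e5 : 0 ≤ (1 - (m + h) - (m - h)) * ((m + h) ^ 2 + (m - h) ^ 2) := by positivity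
  have e6 : 0 ≤ (m - h) ^ 2 * (m + h) := by positivity
  unfold basePoly
  linarith

/-- Triples inside the first kind of colours cannot compensate for an unbalanced mass
distribution. -/
lemma IsBaseMax.le_of_unbalanced {δ r₀ z₀ b₀ z b S T : ℝ} (h : IsBaseMax δ r₀ z₀ b₀)
    (hδ : 0 ≤ δ) (hδ1 : δ ≤ 1 / 10 ^ 14) (hz : 0 ≤ z) (hb : 0 ≤ b) (hzb : z + b ≤ 1)
    (hS : 0 ≤ S) (hT : T ≤ 3 * (z * S)) (hT' : T ≤ z * (z ^ 2 - S))
    (hunb : b < (1 - 1 / 1200) * z) :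
    basePoly δ z b - 3 * b * S + T ≤ r₀ := by
  have hbS : 0 ≤ b * S := by positivity
  obtain ⟨m, k, rfl, rfl⟩ : ∃ m h, z = m + h ∧ b = m - h :=
    ⟨(z + b) / 2, (z - b) / 2, by ring, by ring⟩
  have hk : 1 / 2400 * m ≤ k := by linarith
  have hm : 0 ≤ m := by linarith
  have hzS : 0 ≤ (m + k) * S := by positivity
  have hb3 : 0 ≤ (m - k) ^ 3 := by positivity
  have hz3 : 0 ≤ (m + k) ^ 3 := by positivity
  have hbz : 0 ≤ (m - k) ^ 2 * (m + k) := by positivity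
  have hg : 0 ≤ 1 - 2 * m := by linarith
  have hδg : 0 ≤ δ * (1 - 2 * m) ^ 3 := by positivity
  have hq : 0 ≤ (1 - 2 * m) * ((m + k) ^ 2 + (m - k) ^ 2) := by positivity
  have hbase : basePoly δ (m + k) (m - k) = 1 - δ * (1 - 2 * m) ^ 3 -
      3 * ((1 - 2 * m) * ((m + k) ^ 2 + (m - k) ^ 2)) - (m + k) ^ 3 - (m - k) ^ 3 -
      3 * ((m - k) ^ 2 * (m + k)) := by unfold basePoly; ring
  have hr := h.one_sub_le
  rcases le_total m (1 / 10 ^ 7) with hmc | hmc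
  · refine le_trans ?_ (h.le m m hm hm (by linarith))
    have hmm : basePoly δ m m = 1 - δ * (1 - 2 * m) ^ 3 -
      6 * ((1 - 2 * m) * m ^ 2) - 5 * m ^ 3 := by unfold basePoly; ring
    rw [hbase, hmm]
    have e1 : (1 - 2 * m) * ((m + k) ^ 2 + (m - k) ^ 2) =
      2 * ((1 - 2 * m) * m ^ 2) + 2 * ((1 - 2 * m) * k ^ 2) := by ring
    rw [e1]
    have e2 : 1 / 2 * k ^ 2 ≤ (1 - 2 * m) * k ^ 2 := by
      gcongr; linarith
    have e3 : (1 / 2400 * m) ^ 2 ≤ k ^ 2 := by gcongr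
    have e4 : m ^ 2 * m ≤ m ^ 2 * (1 / 10 ^ 7) := by gcongr
    linarith
  · refine le_trans ?_ hr
    rw [hbase]
    rcases le_total (1 / 4) (1 - 2 * m) with hg' | hg'
    · have e1 : 1 / 4 * ((m + k) ^ 2 + (m - k) ^ 2) ≤
        (1 - 2 * m) * ((m + k) ^ 2 + (m - k) ^ 2) := by gcongr
      have e2 : (1 / 10 ^ 7) ^ 2 ≤ m ^ 2 := by gcongr
      have e3 := sq_nonneg k
      linarith
    · have e1 : T ≤ 3 / 4 * (m + k) ^ 3 := by linarith
      have e2 : (3 / 8) ^ 3 ≤ m ^ 3 := by gcongr; linarith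
      have e3 : 0 ≤ m * k ^ 2 := by positivity
      linarith

/-- The palette extending `A` by the triples `E` and one special colour. -/
def gadgetRel {C I : Type*} [DecidableEq I] (A : C → C → C → Prop) (E : Finset (Finset I)) :
    C ⊕ (I ⊕ Unit) → C ⊕ (I ⊕ Unit) → C ⊕ (I ⊕ Unit) → Prop :=
  joinRel A (fun _ _ => True) (fun p q => p.isLeft ≠ q.isLeft)
    (joinRel (tripleRel E) (fun i j => i ≠ j) (fun _ _ => False) fun _ _ _ => False)

lemma symRel_gadgetRel {C I : Type*} [DecidableEq I] {A : C → C → C → Prop} (hA : SymRel A)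
    (E : Finset (Finset I)) : SymRel (gadgetRel A E) :=
  symRel_joinRel hA (fun _ _ h => h) (fun _ _ h => h.symm)
    (symRel_joinRel (symRel_tripleRel E) (fun _ _ h => h.symm) (fun _ _ h => h)
      ⟨fun _ _ _ h => h, fun _ _ _ h => h⟩)

section
variable {C : Type*} [Fintype C] {A : C → C → C → Prop} {t : ℕ} [Fact t.Prime]
  {E : Finset (Finset (ZMod t))}

lemma lagPoly_gadgetRel {g z b : ℝ} (w : C ⊕ (ZMod t ⊕ Unit) → ℝ)
    (hg : ∑ a, w (.inl a) = g) (hz : ∑ i, w (.inr (.inl i)) = z) (hb : w (.inr (.inr ())) = b)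
    (h1 : g + z + b = 1) (δ : ℝ) :
    lagPoly (gadgetRel A E) w = basePoly δ z b +
      (lagPoly A (fun a => w (.inl a)) - (1 - δ) * g ^ 3) -
      3 * b * ∑ i, w (.inr (.inl i)) ^ 2 + lagPoly (tripleRel E) fun i => w (.inr (.inl i)) := by
  have hcross : pairPoly (fun p q : ZMod t ⊕ Unit => p.isLeft ≠ q.isLeft)
      (fun d => w (.inr d)) = 2 * (z * b) := by
    simp [pairPoly, ← hz, ← hb, ← Finset.sum_mul, ← Finset.mul_sum]
    ring
  have hoff : pairPoly (fun i j : ZMod t => i ≠ j) (fun i => w (.inr (.inl i))) =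
      z ^ 2 - ∑ i, w (.inr (.inl i)) ^ 2 := by
    rw [← hz, ← sum_offDiag_eq, pairPoly]
    refine Finset.sum_congr rfl fun i _ => Finset.sum_congr rfl fun j _ => ?_
    by_cases h : i = j <;> simp [h]
  rw [gadgetRel, lagPoly_joinRel, lagPoly_joinRel, pairPoly_true, pairPoly_false, lagPoly_false,
    hcross, hoff, hg, Fintype.sum_sum_type, hz]
  simp only [Finset.univ_unique, Finset.sum_singleton, PUnit.default_eq_unit, hb]
  obtain rfl : g = 1 - z - b := by linarith
  unfold basePoly
  ring

lemma lagPoly_gadgetRel_le {g z b : ℝ} {w : C ⊕ (ZMod t ⊕ Unit) → ℝ} (hw : ∀ a, 0 ≤ w a)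
    (hg : ∑ a, w (.inl a) = g) (hz : ∑ i, w (.inr (.inl i)) = z) (hb : w (.inr (.inr ())) = b)
    (h1 : g + z + b = 1) :
    lagPoly (gadgetRel A E) w ≤ basePoly (1 - lagr A) z b -
      3 * b * ∑ i, w (.inr (.inl i)) ^ 2 + lagPoly (tripleRel E) fun i => w (.inr (.inl i)) := by
  rw [lagPoly_gadgetRel w hg hz hb h1 (1 - lagr A)]
  have := lagPoly_le_lagr_mul (A := A) (w := fun a => w (.inl a)) fun a => hw _
  rw [hg] at this
  linarith

lemma le_lagr_gadgetRel_sumTriples [Nonempty C] {r₀ z₀ b₀ : ℝ}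
    (h : IsBaseMax (1 - lagr A) r₀ z₀ b₀) (ht : 2 < t) :
    r₀ + 3 * z₀ ^ 2 * (z₀ - b₀) / t - 9 / t ^ 2 ≤ lagr (gadgetRel A (sumTriples t)) := by
  obtain ⟨γ, hγ, hγ1, hγA⟩ := exists_weight_sum_one A
  have hb := h.b_pos
  have hz : 0 < z₀ := hb.trans h.b_lt
  have hz1 : z₀ ≤ 1 := by linarith [h.add_le]
  have hg : 0 ≤ 1 - z₀ - b₀ := by linarith [h.add_le]
  have ht0 : (0 : ℝ) < t := by exact_mod_cast (by omega : 0 < t)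
  let w : C ⊕ (ZMod t ⊕ Unit) → ℝ :=
    Sum.elim (fun a => (1 - z₀ - b₀) * γ a) (Sum.elim (fun _ => z₀ / t) fun _ => b₀)
  have hsg : ∑ a, w (.inl a) = 1 - z₀ - b₀ := by
    simp only [w, Sum.elim_inl, ← Finset.mul_sum, hγ1, mul_one]
  have hsz : ∑ i, w (.inr (.inl i)) = z₀ := by
    simp only [w, Sum.elim_inl, Sum.elim_inr, Finset.sum_const, Finset.card_univ, ZMod.card,
      nsmul_eq_mul]
    field_simp
  have hS : ∑ i, w (.inr (.inl i)) ^ 2 = z₀ ^ 2 / t := by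
    simp only [w, Sum.elim_inl, Sum.elim_inr, Finset.sum_const, Finset.card_univ, ZMod.card,
      nsmul_eq_mul]
    field_simp
  have hw : w ∈ subSimplex (C ⊕ (ZMod t ⊕ Unit)) := by
    constructor
    · rintro (a | i | u)
      · exact mul_nonneg hg (hγ a)
      · exact div_nonneg hz.le ht0.le
      · exact hb.le
    · rw [Fintype.sum_sum_type, Fintype.sum_sum_type, hsg, hsz]
      simp [w]
  refine le_trans ?_ (lagPoly_le_lagr hw)
  rw [lagPoly_gadgetRel w hsg hsz (b := b₀) rfl (by ring) (1 - lagr A), hS, h.eq]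
  have e1 : lagPoly A (fun a => w (.inl a)) = (1 - z₀ - b₀) ^ 3 * lagr A := by
    rw [← hγA, ← lagPoly_smul]; rfl
  have e2 := le_lagPoly_sumTriples ht (y := z₀ / t) (by positivity)
  have e3 : 3 * ((t : ℝ) ^ 2 - 3 * t) * (z₀ / t) ^ 3 = 3 * z₀ ^ 3 / t - 9 * z₀ ^ 3 / t ^ 2 := by
    field_simp
    ring
  have e4 : 9 * z₀ ^ 3 / t ^ 2 ≤ 9 / (t : ℝ) ^ 2 := by
    gcongr
    nlinarith [pow_le_one₀ hz.le hz1 (n := 3)]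
  have e5 : 3 * z₀ ^ 2 * (z₀ - b₀) / t = 3 * z₀ ^ 3 / t - 3 * b₀ * (z₀ ^ 2 / t) := by
    field_simp
  change _ ≤ r₀ + _ - _ + lagPoly (tripleRel (sumTriples t)) fun _ => z₀ / t
  rw [e1]
  linarith

lemma sq_le_of_lt_lagPoly_gadgetRel {r₀ z₀ b₀ : ℝ} (h : IsBaseMax (1 - lagr A) r₀ z₀ b₀)
    (hA : 1 - 1 / 10 ^ 14 ≤ lagr A) (hE : E ⊆ sumTriples t) {w : C ⊕ (ZMod t ⊕ Unit) → ℝ}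
    (hw : ∀ a, 0 ≤ w a) (hw1 : ∑ a, w a = 1) (hlt : r₀ < lagPoly (gadgetRel A E) w)
    (i : ZMod t) : w (.inr (.inl i)) ^ 2 ≤ 5 / 4 / t := by
  have ht0 : (0 : ℝ) < t := by exact_mod_cast (Fact.out : t.Prime).pos
  set x : ZMod t → ℝ := fun i => w (.inr (.inl i)) with hx
  set z := ∑ i, x i with hz
  set b := w (.inr (.inr ())) with hb
  set g := ∑ a, w (.inl a) with hg
  set S := ∑ i, x i ^ 2 with hS
  have hx0 : ∀ i, 0 ≤ x i := fun i => hw _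
  have hz0 : 0 ≤ z := Finset.sum_nonneg fun i _ => hx0 i
  have hg0 : 0 ≤ g := Finset.sum_nonneg fun i _ => hw _
  have hb0 : 0 ≤ b := hw _
  have hS0 : 0 ≤ S := Finset.sum_nonneg fun i _ => sq_nonneg _
  have hsum : g + z + b = 1 := by
    rw [← hw1, Fintype.sum_sum_type, Fintype.sum_sum_type, hg, hz, hb]
    simp [hx, add_assoc]
  have hle := hlt.trans_le (lagPoly_gadgetRel_le (A := A) (E := E) hw hg.symm hz.symm hb.symm hsum)
  have hT := lagPoly_tripleRel_le_mul hE hx0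
  have hT' := lagPoly_tripleRel_le_offDiag hE hx0
  have hbase := h.le z b hz0 hb0 (by linarith)
  have hbal : (1 - 1 / 1200) * z ≤ b := by
    by_contra! hunb
    exact absurd (h.le_of_unbalanced (by linarith [lagr_le_one A]) (by linarith) hz0 hb0
      (by linarith) hS0 hT hT' hunb) (not_le.2 hle)
  have hbS : (1 - 1 / 1200) * z * S ≤ b * S := by gcongr
  have hpos : 0 < S := by
    refine hS0.lt_of_ne fun h0 => ?_
    have hle' : r₀ < basePoly (1 - lagr A) z b - 3 * b * S + lagPoly (tripleRel E) x := hle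
    rw [← hS, ← hz, ← h0] at hT
    rw [← h0] at hle'
    linarith
  have hspread := spread_of_dense_triples hE hx0 hpos (by linarith)
  rw [← hS, ← hz] at hspread
  have hz1 : z ^ 2 ≤ 1 := pow_le_one₀ hz0 (by linarith)
  have hi : x i ^ 2 ≤ S :=
    Finset.single_le_sum (f := fun i => x i ^ 2) (fun i _ => sq_nonneg _) (Finset.mem_univ i)
  refine hi.trans ?_
  rw [le_div_iff₀ ht0]
  linarith

lemma lagr_gadgetRel_empty_le [Nonempty C] {r₀ z₀ b₀ : ℝ}
    (h : IsBaseMax (1 - lagr A) r₀ z₀ b₀) :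
    lagr (gadgetRel A (∅ : Finset (Finset (ZMod t)))) ≤ r₀ := by
  obtain ⟨w, hw, hw1, hw2⟩ := exists_weight_sum_one (gadgetRel A (∅ : Finset (Finset (ZMod t))))
  have hg0 : 0 ≤ ∑ a, w (.inl a) := Finset.sum_nonneg fun i _ => hw _
  have hz0 : 0 ≤ ∑ i, w (.inr (.inl i)) := Finset.sum_nonneg fun i _ => hw _
  have hb0 := hw (.inr (.inr ()))
  have hS0 : 0 ≤ ∑ i, w (.inr (.inl i)) ^ 2 := Finset.sum_nonneg fun i _ => sq_nonneg _
  have hsum : ∑ a, w (.inl a) + ∑ i, w (.inr (.inl i)) + w (.inr (.inr ())) = 1 := by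
    rw [← hw1, Fintype.sum_sum_type, Fintype.sum_sum_type]
    simp [add_assoc]
  rw [← hw2]
  refine (lagPoly_gadgetRel_le hw rfl rfl rfl hsum).trans ?_
  have hT : lagPoly (tripleRel (∅ : Finset (Finset (ZMod t))))
      (fun i => w (.inr (.inl i))) = 0 := by simp [lagPoly, ind, tripleRel]
  have := h.le _ _ hz0 hb0 (by linarith)
  have := mul_nonneg hb0 hS0
  rw [hT]
  linarith

lemma lagr_gadgetRel_le_erase [Nonempty C] {r₀ z₀ b₀ M : ℝ}
    (h : IsBaseMax (1 - lagr A) r₀ z₀ b₀) (hA : 1 - 1 / 10 ^ 14 ≤ lagr A)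
    (hE : E ⊆ sumTriples t) (hM : 0 ≤ M) (hMt : 5 / 4 / t ≤ M ^ 2)
    (hlt : r₀ < lagr (gadgetRel A E)) {e : Finset (ZMod t)} (he : e ∈ E) :
    lagr (gadgetRel A E) ≤ lagr (gadgetRel A (E.erase e)) + 6 * M ^ 3 := by
  obtain ⟨w, hw, hw1, hw2⟩ := exists_weight_sum_one (gadgetRel A E)
  rw [← hw2] at hlt ⊢
  have hx := fun i => abs_le_of_sq_le_sq
    ((sq_le_of_lt_lagPoly_gadgetRel h hA hE hw hw1 hlt i).trans hMt) hM
  have hsum : ∑ a, w (.inl a) + ∑ i, w (.inr (.inl i)) + w (.inr (.inr ())) = 1 := by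
    rw [← hw1, Fintype.sum_sum_type, Fintype.sum_sum_type]
    simp [add_assoc]
  have h1 := lagPoly_le_lagr (A := gadgetRel A (E.erase e)) ⟨hw, hw1.le⟩
  rw [lagPoly_gadgetRel w rfl rfl rfl hsum 0] at h1 ⊢
  have h2 := lagPoly_tripleRel_le_add E (card_of_mem_sumTriples (hE he))
    (x := fun i => w (.inr (.inl i))) (fun i => hw _) fun i => (le_abs_self _).trans (hx i)
  linarith

end

lemma IsBaseMax.denselyApproached {C : Type} [Fintype C] [Nonempty C] {A : C → C → C → Prop}
    (hsym : SymRel A) {r₀ z₀ b₀ : ℝ} (h : IsBaseMax (1 - lagr A) r₀ z₀ b₀)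
    (hA : 1 - 1 / 10 ^ 14 ≤ lagr A) : DenselyApproached r₀ := by
  intro c hc
  have hz : 0 < z₀ := h.b_pos.trans h.b_lt
  have hzb : 0 < z₀ - b₀ := sub_pos.2 h.b_lt
  set κ := 3 * z₀ ^ 2 * (z₀ - b₀) with hκ
  have hκ0 : 0 < κ := by positivity
  refine ⟨min (κ / 8) (min (κ ^ 2 / 144) ((c * κ / 30) ^ 2 * κ / 5)), by positivity,
    fun ρ hρ hρ₀ => ?_⟩
  obtain ⟨h1, h2, h3⟩ : ρ < κ / 8 ∧ ρ < κ ^ 2 / 144 ∧ ρ < (c * κ / 30) ^ 2 * κ / 5 := by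
    simpa only [lt_min_iff] using hρ₀
  have hN2 : 2 < κ / (4 * ρ) := by rw [lt_div_iff₀ (by positivity)]; linarith
  have hN : ⌊κ / (4 * ρ)⌋₊ ≠ 0 := by
    rw [← Nat.pos_iff_ne_zero, Nat.floor_pos]; linarith
  obtain ⟨t, htp, hNt, htN⟩ := Nat.exists_prime_lt_and_le_two_mul _ hN
  have : Fact t.Prime := ⟨htp⟩
  have ht1 : κ / (4 * ρ) < t := Nat.lt_of_floor_lt hNt
  have ht2 : (t : ℝ) ≤ 2 * (κ / (4 * ρ)) := by
    calc (t : ℝ) ≤ 2 * (⌊κ / (4 * ρ)⌋₊ : ℝ) := by exact_mod_cast htN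
      _ ≤ _ := by gcongr; exact Nat.floor_le (by positivity)
  have ht : 2 < t := by exact_mod_cast hN2.trans ht1
  have ht0 : (0 : ℝ) < t := by linarith
  have hinv : 1 / (t : ℝ) ≤ 4 * ρ / κ := by
    rw [div_le_div_iff₀ ht0 hκ0]
    rw [div_lt_iff₀ (by positivity)] at ht1
    linarith
  have hκt : 2 * ρ ≤ κ / t := by
    rw [le_div_iff₀ ht0]
    have : 2 * (κ / (4 * ρ)) = κ / (2 * ρ) := by field_simp; norm_num
    rw [this, le_div_iff₀ (by positivity)] at ht2
    linarith
  have h9 : 9 / (t : ℝ) ^ 2 ≤ ρ := by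
    calc 9 / (t : ℝ) ^ 2 = 9 * (1 / t) ^ 2 := by field_simp
      _ ≤ 9 * (4 * ρ / κ) ^ 2 := by gcongr
      _ = ρ * (144 * ρ / κ ^ 2) := by field_simp; norm_num
      _ ≤ ρ * 1 := by
        gcongr
        rw [div_le_one (by positivity)]; linarith
      _ = ρ := mul_one ρ
  have hM2 : √(5 * ρ / κ) ^ 2 = 5 * ρ / κ := Real.sq_sqrt (by positivity)
  have hM : √(5 * ρ / κ) ≤ c * κ / 30 := by
    refine Real.sqrt_le_iff.2 ⟨by positivity, ?_⟩
    rw [div_le_iff₀ hκ0]; linarith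
  have hM3 : 6 * √(5 * ρ / κ) ^ 3 ≤ c * ρ := by
    calc 6 * √(5 * ρ / κ) ^ 3 = 6 * (5 * ρ / κ) * √(5 * ρ / κ) := by
          rw [pow_succ, hM2, mul_assoc]
      _ ≤ 6 * (5 * ρ / κ) * (c * κ / 30) := by gcongr
      _ = c * ρ := by field_simp; norm_num
  have hMt : 5 / 4 / (t : ℝ) ≤ √(5 * ρ / κ) ^ 2 := by
    rw [hM2, div_eq_mul_one_div]
    calc 5 / 4 * (1 / (t : ℝ)) ≤ 5 / 4 * (4 * ρ / κ) := by gcongr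
      _ = 5 * ρ / κ := by ring
  obtain ⟨E, hE, hmin⟩ := Finset.exists_min_image
    ((sumTriples t).powerset.filter fun E => r₀ + ρ ≤ lagr (gadgetRel A E)) Finset.card
    ⟨sumTriples t, Finset.mem_filter.2 ⟨Finset.mem_powerset_self _,
      le_trans (by linarith) (le_lagr_gadgetRel_sumTriples h ht)⟩⟩
  rw [Finset.mem_filter, Finset.mem_powerset] at hE
  obtain ⟨hEs, hEr⟩ := hE
  obtain ⟨e, he⟩ : E.Nonempty := by
    rw [Finset.nonempty_iff_ne_empty]
    rintro rfl
    linarith [lagr_gadgetRel_empty_le (t := t) h]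
  refine ⟨lagr (gadgetRel A (E.erase e)), ⟨_, inferInstance, inferInstance, _,
    symRel_gadgetRel hsym _, rfl⟩, ?_, ?_⟩
  · have := lagr_gadgetRel_le_erase h hA hEs (Real.sqrt_nonneg _) hMt (by linarith) he
    linarith
  · by_contra! hge
    have := hmin (E.erase e) (Finset.mem_filter.2
      ⟨Finset.mem_powerset.2 ((Finset.erase_subset e E).trans hEs), hge⟩)
    exact absurd (Finset.card_erase_lt_of_mem he) (not_lt.2 this)

lemma exists_Icc_subset_closure_lagSet : ∃ α β : ℝ, α < β ∧ Set.Icc α β ⊆ closure lagSet := by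
  obtain ⟨n, A, hsym, hA, hA1⟩ := exists_lagr_near_one (ε := 1 / 10 ^ 14) (by norm_num)
  obtain ⟨r₀, z₀, b₀, h⟩ := exists_isBaseMax (δ := 1 - lagr A) (by linarith)
    (by linarith [lagr_nonneg A])
  exact Icc_subset_closure_lagSet (by linarith [h.one_sub_le, lagr_nonneg A]) h.lt_one
    (h.denselyApproached hsym hA)

/-- There are reals `α < β` such that `Π_{⫿,fin}` is dense in `[α, β]`,
i.e. `[α, β] ⊆ closure(Π_{⫿,fin})`. -/
theorem uniform_turan_densities_dense_in_interval :
    ∃ α β : ℝ, α < β ∧ Set.Icc α β ⊆ closure PiUnifFin := by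
  obtain ⟨α, β, h, hsub⟩ := exists_Icc_subset_closure_lagSet
  exact ⟨α, β, h, hsub.trans (closure_minimal lagSet_subset_closure isClosed_closure)⟩
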